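/- There exists a small constant ε₀ > 0 such that the following a priori estimate holds. Suppose u ∈ L∞([0,∞); 𝓗¹(ℝ²₊)) is a smooth global solution of the 2D Prandtl–Shercliff system (with w and f determined as in the system, and with sufficient smoothness and decay as z → ∞ to justify integration by parts), with initial datum u₀ satisfying ‖u₀‖_{𝓗¹} ≤ ε₀. Then for every t ≥ 0 one has ‖u(t)‖²_{𝓗¹} + ∫₀ᵗ D(s) ds ≤ ε₀², where D(t) = ‖⟨z⟩∂_z²u(t)‖²_{H¹ₓL²_z} + ‖⟨z⟩∂ₓu(t)‖²_{H¹ₓL²_z}. -/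

import Mathlib

open MeasureTheory Filter Set

noncomputable section

/-- `∂ₓ` for a function of `(x, z)`. -/
def pdx (h : ℝ → ℝ → ℝ) : ℝ → ℝ → ℝ := fun x z => deriv (fun x' => h x' z) x

/-- `∂_z` for a function of `(x, z)`. -/
def pdz (h : ℝ → ℝ → ℝ) : ℝ → ℝ → ℝ := fun x z => deriv (fun z' => h x z') z

/-- `∂ₜ` for a function of `(t, x, z)`. -/
def pdt (u : ℝ → ℝ → ℝ → ℝ) : ℝ → ℝ → ℝ → ℝ := fun t x z => deriv (fun s => u s x z) t

/-- The squared anisotropic norm `‖h‖²_{H¹ₓL²_z} = ∫_{ℝ²₊} (h² + (∂ₓh)²) dx dz`. -/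
def H1xL2sq (h : ℝ → ℝ → ℝ) : ENNReal :=
  ∫⁻ x : ℝ, ∫⁻ z in Set.Ioi (0 : ℝ), ENNReal.ofReal ((h x z) ^ 2 + (pdx h x z) ^ 2)

/-- `⟨z⟩ = (1 + z²)^{1/2}`. -/
def jz (z : ℝ) : ℝ := Real.sqrt (1 + z ^ 2)

/-- `‖h‖²_{𝓗¹} = ‖h‖²_{H¹ₓL²_z} + ‖⟨z⟩∂_z h‖²_{H¹ₓL²_z}`. -/
def H1sq (h : ℝ → ℝ → ℝ) : ENNReal :=
  H1xL2sq h + H1xL2sq fun x z => jz z * pdz h x z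

/-- `‖h‖_{𝓗¹}`. -/
def H1norm (h : ℝ → ℝ → ℝ) : ENNReal := H1sq h ^ (1 / 2 : ℝ)

/-- A smooth global solution `(u, w, f)` of the 2D Prandtl–Shercliff system on `ℝ²₊`:
the momentum equation `∂ₜu + u∂ₓu + w∂_zu − ∂_z²u = ∂ₓf`, the magnetic relation
`∂ₓu + ∂_z²f = 0`, the divergence-free condition `∂ₓu + ∂_zw = 0`, the Dirichlet boundary
conditions at `z = 0`, and the decay conditions `u, f → 0` as `z → ∞`. -/
structure IsPS2D (u w f : ℝ → ℝ → ℝ → ℝ) : Prop where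
  smooth_u : ContDiff ℝ (⊤ : ℕ∞) fun p : ℝ × ℝ × ℝ => u p.1 p.2.1 p.2.2
  smooth_w : ContDiff ℝ (⊤ : ℕ∞) fun p : ℝ × ℝ × ℝ => w p.1 p.2.1 p.2.2
  smooth_f : ContDiff ℝ (⊤ : ℕ∞) fun p : ℝ × ℝ × ℝ => f p.1 p.2.1 p.2.2
  momentum : ∀ t > (0 : ℝ), ∀ x : ℝ, ∀ z > (0 : ℝ),
    pdt u t x z + u t x z * pdx (u t) x z + w t x z * pdz (u t) x z
      - pdz (pdz (u t)) x z = pdx (f t) x z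
  magnetic : ∀ t > (0 : ℝ), ∀ x : ℝ, ∀ z > (0 : ℝ),
    pdx (u t) x z + pdz (pdz (f t)) x z = 0
  divfree : ∀ t > (0 : ℝ), ∀ x : ℝ, ∀ z > (0 : ℝ),
    pdx (u t) x z + pdz (w t) x z = 0
  bc_u : ∀ t ≥ (0 : ℝ), ∀ x : ℝ, u t x 0 = 0
  bc_w : ∀ t ≥ (0 : ℝ), ∀ x : ℝ, w t x 0 = 0
  bc_f : ∀ t ≥ (0 : ℝ), ∀ x : ℝ, f t x 0 = 0
  lim_u : ∀ t ≥ (0 : ℝ), ∀ x : ℝ, Tendsto (fun z => u t x z) atTop (nhds 0)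
  lim_f : ∀ t ≥ (0 : ℝ), ∀ x : ℝ, Tendsto (fun z => f t x z) atTop (nhds 0)

/-- The dissipation functional `D(t) = ‖⟨z⟩∂_z²u(t)‖²_{H¹ₓL²_z} + ‖⟨z⟩∂ₓu(t)‖²_{H¹ₓL²_z}`. -/
def Dfun (u : ℝ → ℝ → ℝ → ℝ) (t : ℝ) : ENNReal :=
  H1xL2sq (fun x z => jz z * pdz (pdz (u t)) x z)
    + H1xL2sq fun x z => jz z * pdx (u t) x z

open ENNReal (ofReal ofReal_mul ofReal_add ofReal_le_ofReal ofReal_ne_top)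

def unc (g : ℝ → ℝ → ℝ → ℝ) : ℝ × ℝ × ℝ → ℝ := fun p => g p.1 p.2.1 p.2.2
def Sm (g : ℝ → ℝ → ℝ → ℝ) : Prop := ContDiff ℝ (⊤ : ℕ∞) (unc g)
def dx (g : ℝ → ℝ → ℝ → ℝ) : ℝ → ℝ → ℝ → ℝ := fun t => pdx (g t)
def dz (g : ℝ → ℝ → ℝ → ℝ) : ℝ → ℝ → ℝ → ℝ := fun t => pdz (g t)

theorem Sm.cont {g} (h : Sm g) : Continuous (unc g) := ContDiff.continuous h
theorem Sm.diff {g} (h : Sm g) : Differentiable ℝ (unc g) := ContDiff.differentiable h (by simp)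

theorem Sm.hasz {g} (h : Sm g) (t x z : ℝ) : HasDerivAt (fun y => g t x y) (fderiv ℝ (unc g) (t,x,z) (0,0,1)) z := by
  have h1 : HasFDerivAt (unc g) (fderiv ℝ (unc g) (t,x,z)) (t,x,z) := (h.diff _).hasFDerivAt
  have h2 : HasDerivAt (fun y : ℝ => ((t, x, y) : ℝ × ℝ × ℝ)) (0,0,1) z :=
    (hasDerivAt_const z t).prodMk ((hasDerivAt_const z x).prodMk (hasDerivAt_id z))
  exact h1.comp_hasDerivAt z h2
theorem Sm.hasx {g} (h : Sm g) (t x z : ℝ) : HasDerivAt (fun y => g t y z) (fderiv ℝ (unc g) (t,x,z) (0,1,0)) x := by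
  have h1 : HasFDerivAt (unc g) (fderiv ℝ (unc g) (t,x,z)) (t,x,z) := (h.diff _).hasFDerivAt
  have h2 : HasDerivAt (fun y : ℝ => ((t, y, z) : ℝ × ℝ × ℝ)) (0,1,0) x :=
    (hasDerivAt_const x t).prodMk ((hasDerivAt_id x).prodMk (hasDerivAt_const x z))
  exact h1.comp_hasDerivAt x h2
theorem Sm.hast {g} (h : Sm g) (t x z : ℝ) : HasDerivAt (fun y => g y x z) (fderiv ℝ (unc g) (t,x,z) (1,0,0)) t := by
  have h1 : HasFDerivAt (unc g) (fderiv ℝ (unc g) (t,x,z)) (t,x,z) := (h.diff _).hasFDerivAt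
  have h2 : HasDerivAt (fun y : ℝ => ((y, x, z) : ℝ × ℝ × ℝ)) (1,0,0) t :=
    (hasDerivAt_id t).prodMk ((hasDerivAt_const t x).prodMk (hasDerivAt_const t z))
  exact h1.comp_hasDerivAt t h2

theorem Sm.dz_eq {g} (h : Sm g) : unc (dz g) = fun p => fderiv ℝ (unc g) p (0,0,1) := by
  funext p; exact (h.hasz p.1 p.2.1 p.2.2).deriv
theorem Sm.dx_eq {g} (h : Sm g) : unc (dx g) = fun p => fderiv ℝ (unc g) p (0,1,0) := by
  funext p; exact (h.hasx p.1 p.2.1 p.2.2).deriv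
theorem Sm.dt_eq {g} (h : Sm g) : unc (pdt g) = fun p => fderiv ℝ (unc g) p (1,0,0) := by
  funext p; exact (h.hast p.1 p.2.1 p.2.2).deriv

theorem cd_dir {G : ℝ × ℝ × ℝ → ℝ} (h : ContDiff ℝ (⊤ : ℕ∞) G) (v : ℝ × ℝ × ℝ) :
    ContDiff ℝ (⊤ : ℕ∞) (fun p => fderiv ℝ G p v) :=
  (h.fderiv_right (m := ((⊤ : ℕ∞) : WithTop ℕ∞)) (by norm_num)).clm_apply contDiff_const

theorem Sm.dz {g} (h : Sm g) : Sm (dz g) := by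
  unfold Sm; rw [h.dz_eq]; exact cd_dir h _
theorem Sm.dx {g} (h : Sm g) : Sm (dx g) := by
  unfold Sm; rw [h.dx_eq]; exact cd_dir h _
theorem Sm.dt {g} (h : Sm g) : Sm (pdt g) := by
  unfold Sm; rw [h.dt_eq]; exact cd_dir h _

theorem Sm.Hz {g} (h : Sm g) (t x z : ℝ) : HasDerivAt (fun y => g t x y) (_root_.dz g t x z) z := by
  have := h.hasz t x z
  rwa [← this.deriv] at this
theorem Sm.Hx {g} (h : Sm g) (t x z : ℝ) : HasDerivAt (fun y => g t y z) (_root_.dx g t x z) x := by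
  have := h.hasx t x z
  rwa [← this.deriv] at this
theorem Sm.Ht {g} (h : Sm g) (t x z : ℝ) : HasDerivAt (fun y => g y x z) (pdt g t x z) t := by
  have := h.hast t x z
  rwa [← this.deriv] at this

theorem dir_comm {G : ℝ × ℝ × ℝ → ℝ} (h : ContDiff ℝ (⊤ : ℕ∞) G) (v w p : ℝ × ℝ × ℝ) :
    fderiv ℝ (fun p => fderiv ℝ G p v) p w = fderiv ℝ (fun p => fderiv ℝ G p w) p v := by
  have hd : DifferentiableAt ℝ (fderiv ℝ G) p :=
    ((h.fderiv_right (m := ((⊤ : ℕ∞) : WithTop ℕ∞)) (by norm_num)).differentiable (by simp)) p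
  have e : ∀ v w, fderiv ℝ (fun p => fderiv ℝ G p v) p w = fderiv ℝ (fderiv ℝ G) p w v := by
    intro v w
    rw [fderiv_clm_apply hd (differentiableAt_const v)]
    simp
  rw [e, e]
  exact (h.contDiffAt.isSymmSndFDerivAt (by simp only [minSmoothness_of_isRCLikeNormedField]; exact WithTop.coe_le_coe.2 le_top)).eq w v

theorem unc_inj {g h : ℝ → ℝ → ℝ → ℝ} (e : unc g = unc h) : g = h := by
  funext t x z; exact congrFun e (t,x,z)

theorem Sm.xz {g} (h : Sm g) : _root_.dx (_root_.dz g) = _root_.dz (_root_.dx g) := by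
  apply unc_inj
  rw [h.dz.dx_eq, h.dx.dz_eq, h.dz_eq, h.dx_eq]
  funext p; exact dir_comm h _ _ _
theorem Sm.tz {g} (h : Sm g) : pdt (_root_.dz g) = _root_.dz (pdt g) := by
  apply unc_inj
  rw [h.dz.dt_eq, h.dt.dz_eq, h.dz_eq, h.dt_eq]
  funext p; exact dir_comm h _ _ _
theorem Sm.sub {g h} (a : Sm g) (b : Sm h) : Sm (fun t x z => g t x z - h t x z) := ContDiff.sub a b
theorem Sm.add {g h} (a : Sm g) (b : Sm h) : Sm (fun t x z => g t x z + h t x z) := ContDiff.add a b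
theorem Sm.mul {g h} (a : Sm g) (b : Sm h) : Sm (fun t x z => g t x z * h t x z) := ContDiff.mul a b

theorem Sm.c1 {g} (h : Sm g) (t x : ℝ) : Continuous (fun z => g t x z) :=
  h.cont.comp (by fun_prop : Continuous fun z : ℝ => ((t, x, z) : ℝ × ℝ × ℝ))
theorem Sm.cxz {g} (h : Sm g) (t : ℝ) : Continuous (fun p : ℝ × ℝ => g t p.1 p.2) :=
  h.cont.comp (by fun_prop : Continuous fun p : ℝ × ℝ => ((t, p.1, p.2) : ℝ × ℝ × ℝ))
theorem Sm.ct {g} (h : Sm g) (x z : ℝ) : Continuous (fun t => g t x z) :=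
  h.cont.comp (by fun_prop : Continuous fun t : ℝ => ((t, x, z) : ℝ × ℝ × ℝ))
theorem Sm.c3 {g} (h : Sm g) : Continuous (fun p : ℝ × ℝ × ℝ => g p.1 p.2.1 p.2.2) := h.cont

theorem ext_eq {g h : ℝ → ℝ → ℝ → ℝ} (a : Continuous (unc g)) (b : Continuous (unc h))
    (e : ∀ t > 0, ∀ x, ∀ z > 0, g t x z = h t x z) : ∀ t ≥ 0, ∀ x, ∀ z ≥ 0, g t x z = h t x z := by
  intro t ht x z hz
  have hc : Continuous fun s : ℝ => unc g (t + s, x, z + s) - unc h (t + s, x, z + s) := by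
    have : Continuous fun s : ℝ => ((t + s, x, z + s) : ℝ × ℝ × ℝ) := by fun_prop
    exact (a.comp this).sub (b.comp this)
  have h1 : Tendsto (fun s : ℝ => unc g (t + s, x, z + s) - unc h (t + s, x, z + s))
      (nhdsWithin 0 (Ioi 0)) (nhds (unc g (t + 0, x, z + 0) - unc h (t + 0, x, z + 0))) :=
    (hc.tendsto 0).mono_left nhdsWithin_le_nhds
  have h2 : Tendsto (fun s : ℝ => unc g (t + s, x, z + s) - unc h (t + s, x, z + s))
      (nhdsWithin 0 (Ioi 0)) (nhds 0) := by
    apply tendsto_const_nhds.congr'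
    filter_upwards [self_mem_nhdsWithin] with s hs
    have hs' : (0:ℝ) < s := hs
    have := e (t + s) (by linarith) x (z + s) (by linarith)
    simp [unc, this]
  have := tendsto_nhds_unique h1 h2
  simp [unc] at this
  linarith

theorem dz_congr {g h : ℝ → ℝ → ℝ → ℝ} 
    (e : ∀ t > 0, ∀ x, ∀ z > 0, g t x z = h t x z) : ∀ t > 0, ∀ x, ∀ z > 0, dz g t x z = dz h t x z := by
  intro t ht x z hz
  apply Filter.EventuallyEq.deriv_eq
  filter_upwards [Ioi_mem_nhds hz] with y hy using e t ht x y hy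
theorem dx_congr {g h : ℝ → ℝ → ℝ → ℝ} 
    (e : ∀ t > 0, ∀ x, ∀ z > 0, g t x z = h t x z) : ∀ t > 0, ∀ x, ∀ z > 0, dx g t x z = dx h t x z := by
  intro t ht x z hz
  apply Filter.EventuallyEq.deriv_eq
  filter_upwards with y using e t ht y z hz

structure Sol (u w f : ℝ → ℝ → ℝ → ℝ) : Prop where
  su : Sm u
  sw : Sm w
  sf : Sm f
  ut : ∀ t ≥ 0, ∀ x, ∀ z ≥ 0, pdt u t x z = -(u t x z * dx u t x z) - w t x z * dz u t x z
      + dz (dz u) t x z + dx f t x z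
  utz : ∀ t ≥ 0, ∀ x, ∀ z ≥ 0, pdt (dz u) t x z = -(u t x z * dx (dz u) t x z) - w t x z * dz (dz u) t x z
      + dz (dz (dz u)) t x z + dx (dz f) t x z
  fzz : ∀ t ≥ 0, ∀ x, ∀ z ≥ 0, dz (dz f) t x z = - dx u t x z
  fxzz : ∀ t ≥ 0, ∀ x, ∀ z ≥ 0, dz (dx (dz f)) t x z = - dx (dx u) t x z
  wz : ∀ t ≥ 0, ∀ x, ∀ z ≥ 0, dz w t x z = - dx u t x z
  u0 : ∀ t ≥ 0, ∀ x, u t x 0 = 0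
  w0 : ∀ t ≥ 0, ∀ x, w t x 0 = 0
  f0 : ∀ t ≥ 0, ∀ x, f t x 0 = 0
  ux0 : ∀ t ≥ 0, ∀ x, dx u t x 0 = 0
  uzz0 : ∀ t ≥ 0, ∀ x, dz (dz u) t x 0 = 0
  lu : ∀ t ≥ 0, ∀ x, Tendsto (fun z => u t x z) atTop (nhds 0)
  lf : ∀ t ≥ 0, ∀ x, Tendsto (fun z => f t x z) atTop (nhds 0)

theorem IsPS2D.sol {u w f} (H : IsPS2D u w f) : Sol u w f := by
  have su : Sm u := H.smooth_u
  have sw : Sm w := H.smooth_w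
  have sf : Sm f := H.smooth_f
  have ut0 : ∀ t > 0, ∀ x, ∀ z > 0, pdt u t x z = -(u t x z * dx u t x z) - w t x z * dz u t x z
      + dz (dz u) t x z + dx f t x z := by
    intro t ht x z hz
    have := H.momentum t ht x z hz
    simp only [dx, dz]; linarith
  have wz0 : ∀ t > 0, ∀ x, ∀ z > 0, dz w t x z = - dx u t x z := by
    intro t ht x z hz
    have := H.divfree t ht x z hz
    simp only [dx, dz]; linarith
  have fzz0 : ∀ t > 0, ∀ x, ∀ z > 0, dz (dz f) t x z = - dx u t x z := by
    intro t ht x z hz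
    have := H.magnetic t ht x z hz
    simp only [dx, dz]; linarith
  have ut : ∀ t ≥ 0, ∀ x, ∀ z ≥ 0, pdt u t x z = -(u t x z * dx u t x z) - w t x z * dz u t x z
      + dz (dz u) t x z + dx f t x z :=
    ext_eq su.dt.cont (by
      have h1 := su.cont; have h2 := su.dx.cont; have h3 := sw.cont; have h4 := su.dz.cont
      have h5 := su.dz.dz.cont; have h6 := sf.dx.cont
      exact ((((h1.mul h2).neg).sub (h3.mul h4)).add h5).add h6) ut0
  have ux0 : ∀ t ≥ 0, ∀ x, dx u t x 0 = 0 := by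
    intro t ht x
    have : (fun y => u t y 0) = fun _ => 0 := by funext y; exact H.bc_u t ht y
    show deriv (fun y => u t y 0) x = 0
    rw [this]; simp
  have fx0 : ∀ t ≥ 0, ∀ x, dx f t x 0 = 0 := by
    intro t ht x
    have : (fun y => f t y 0) = fun _ => 0 := by funext y; exact H.bc_f t ht y
    show deriv (fun y => f t y 0) x = 0
    rw [this]; simp
  have ut00 : ∀ t > 0, ∀ x, pdt u t x 0 = 0 := by
    intro t ht x
    have : (fun s => u s x 0) =ᶠ[nhds t] fun _ => 0 := by
      filter_upwards [Ioi_mem_nhds ht] with s hs using H.bc_u s (le_of_lt hs) x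
    show deriv (fun s => u s x 0) t = 0
    rw [this.deriv_eq]; simp
  have uzz00 : ∀ t > 0, ∀ x, ∀ z > (0:ℝ), dz (dz u) t x 0 = 0 := by
    intro t ht x z _
    have := ut t ht.le x 0 le_rfl
    rw [ut00 t ht x, fx0 t ht.le x, H.bc_u t ht.le x, H.bc_w t ht.le x] at this
    linarith
  refine ⟨su, sw, sf, ut, ?_, ?_, ?_, ?_, H.bc_u, H.bc_w, H.bc_f, ux0, ?_, H.lim_u, H.lim_f⟩
  · refine ext_eq su.dz.dt.cont (by
      have h1 := su.cont; have h2 := su.dz.dx.cont; have h3 := sw.cont; have h4 := su.dz.dz.cont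
      have h5 := su.dz.dz.dz.cont; have h6 := sf.dz.dx.cont
      exact ((((h1.mul h2).neg).sub (h3.mul h4)).add h5).add h6) ?_
    intro t ht x z hz
    rw [su.tz, dz_congr ut0 t ht x z hz]
    have := ((((su.Hz t x z).mul (su.dx.Hz t x z)).neg.sub ((sw.Hz t x z).mul (su.dz.Hz t x z))).add
      (su.dz.dz.Hz t x z)).add (sf.dx.Hz t x z)
    have e := this.deriv
    have e2 : dz (fun t x z => -(u t x z * dx u t x z) - w t x z * dz u t x z
      + dz (dz u) t x z + dx f t x z) t x z = _ := e
    rw [e2, wz0 t ht x z hz, su.xz, sf.xz]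
    ring
  · exact ext_eq sf.dz.dz.cont su.dx.cont.neg fzz0
  · refine ext_eq sf.dz.dx.dz.cont su.dx.dx.cont.neg ?_
    intro t ht x z hz
    rw [← sf.dz.xz, dx_congr fzz0 t ht x z hz]
    exact (su.dx.Hx t x z).neg.deriv
  · exact ext_eq sw.dz.cont su.dx.cont.neg wz0
  · intro t ht x
    have := ext_eq (g := fun t x _ => dz (dz u) t x 0) (h := fun _ _ _ => 0)
      (su.dz.dz.cont.comp (by fun_prop : Continuous fun p : ℝ × ℝ × ℝ => ((p.1, p.2.1, 0) : ℝ × ℝ × ℝ)))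
      continuous_const uzz00
    exact this t ht x 0 le_rfl

theorem IsPS2D.zero : IsPS2D (fun _ _ _ => 0) (fun _ _ _ => 0) (fun _ _ _ => 0) := by
  constructor <;> intros <;> simp [pdx, pdz, pdt, contDiff_const]

theorem IsPS2D.shift {u w f} (H : IsPS2D u w f) (h : ℝ) :
    IsPS2D (fun t x z => u t (x + h) z) (fun t x z => w t (x + h) z) (fun t x z => f t (x + h) z) := by
  have key : ContDiff ℝ (⊤ : ℕ∞) (fun p : ℝ × ℝ × ℝ => ((p.1, p.2.1 + h, p.2.2) : ℝ × ℝ × ℝ)) := by fun_prop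
  have e : ∀ (g : ℝ → ℝ → ℝ) x z, pdx (fun x z => g (x + h) z) x z = pdx g (x + h) z := by
    intro g x z
    simp only [pdx]
    exact deriv_comp_add_const (f := fun x' => g x' z) h x
  refine ⟨H.smooth_u.comp key, H.smooth_w.comp key, H.smooth_f.comp key, ?_, ?_, ?_, ?_, ?_, ?_, ?_, ?_⟩
  · intro t ht x z hz
    rw [e (u t), e (f t)]
    exact H.momentum t ht (x + h) z hz
  · intro t ht x z hz
    rw [e (u t)]
    exact H.magnetic t ht (x + h) z hz
  · intro t ht x z hz
    rw [e (u t)]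
    exact H.divfree t ht (x + h) z hz
  · intro t ht x; exact H.bc_u t ht _
  · intro t ht x; exact H.bc_w t ht _
  · intro t ht x; exact H.bc_f t ht _
  · intro t ht x; exact H.lim_u t ht _
  · intro t ht x; exact H.lim_f t ht _

theorem hasDeriv_ii {G G' : ℝ → ℝ → ℝ} (hG : Continuous (Function.uncurry G))
    (hG' : Continuous (Function.uncurry G')) (a b : ℝ)
    (hd : ∀ y z, HasDerivAt (fun y => G y z) (G' y z) y) (y : ℝ) :
    HasDerivAt (fun y => ∫ z in a..b, G y z) (∫ z in a..b, G' y z) y := by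
  have hK : IsCompact (Icc (y-1) (y+1) ×ˢ uIcc a b) := isCompact_Icc.prod isCompact_uIcc
  obtain ⟨C, hC⟩ := hK.exists_bound_of_continuousOn hG'.continuousOn
  refine (intervalIntegral.hasDerivAt_integral_of_dominated_loc_of_deriv_le (F := G) (F' := G')
    (bound := fun _ => C) (s := Icc (y-1) (y+1)) (Icc_mem_nhds (by linarith) (by linarith))
    ?_ ?_ ?_ ?_ ?_ ?_).2
  · exact Eventually.of_forall fun x => (hG.comp (by fun_prop : Continuous fun z : ℝ => (x, z))).aestronglyMeasurable
  · exact (hG.comp (by fun_prop : Continuous fun z : ℝ => (y, z))).intervalIntegrable _ _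
  · exact (hG'.comp (by fun_prop : Continuous fun z : ℝ => (y, z))).aestronglyMeasurable
  · refine Eventually.of_forall fun z hz x hx => ?_
    exact hC (x, z) ⟨hx, uIoc_subset_uIcc hz⟩
  · exact intervalIntegrable_const
  · exact Eventually.of_forall fun z _ x _ => hd x z

theorem ofReal_int_le {α} [MeasurableSpace α] (μ : Measure α) (f : α → ℝ) :
    ofReal (∫ x, f x ∂μ) ≤ ∫⁻ x, ofReal (f x) ∂μ := by
  by_cases hf : Integrable f μ
  · rw [integral_eq_lintegral_pos_part_sub_lintegral_neg_part hf]
    refine (ofReal_le_ofReal (sub_le_self _ ENNReal.toReal_nonneg)).trans ?_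
    exact ENNReal.ofReal_toReal_le
  · rw [integral_undef hf]; simp

theorem ofReal_ii_le {a b : ℝ} (hab : a ≤ b) (f : ℝ → ℝ) :
    ofReal (∫ x in a..b, f x) ≤ ∫⁻ x in Ioc a b, ofReal (f x) := by
  rw [intervalIntegral.integral_of_le hab]; exact ofReal_int_le _ _

theorem ofReal_ii_eq {a b : ℝ} (hab : a ≤ b) {f : ℝ → ℝ} (hf : Continuous f) (h0 : ∀ x ∈ Icc a b, 0 ≤ f x) :
    ofReal (∫ x in a..b, f x) = ∫⁻ x in Ioc a b, ofReal (f x) := by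
  rw [intervalIntegral.integral_of_le hab]
  refine ofReal_integral_eq_lintegral_ofReal ?_ ?_
  · exact (hf.intervalIntegrable a b).1
  · exact (ae_restrict_iff' measurableSet_Ioc).2 (Eventually.of_forall fun x hx => h0 x ⟨hx.1.le, hx.2⟩)

theorem exists_small {h : ℝ → ENNReal} (hf : ∫⁻ R in Ioi 0, h R ≠ ⊤) (ε : ENNReal) (hε : ε ≠ 0) (R0 : ℝ) :
    ∃ R ≥ R0, 0 < R ∧ h R ≤ ε := by
  by_contra! hc
  apply hf
  rw [eq_top_iff]
  calc (⊤ : ENNReal) = ∫⁻ R in Ioi (max R0 0), ε := by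
        rw [setLIntegral_const, Real.volume_Ioi, ENNReal.mul_top hε]
    _ ≤ ∫⁻ R in Ioi (max R0 0), h R := by
        apply setLIntegral_mono' measurableSet_Ioi
        intro R hR
        have : max R0 0 < R := hR
        exact (hc R (le_trans (le_max_left _ _) this.le) (lt_of_le_of_lt (le_max_right _ _) this)).le
    _ ≤ _ := lintegral_mono_set (Ioi_subset_Ioi (le_max_right _ _))

theorem union_box : (⋃ n : ℕ, Ioc (-(n:ℝ)) n) = univ := by
  ext x; simp only [mem_iUnion, mem_univ, iff_true]
  obtain ⟨n, hn⟩ := exists_nat_gt |x|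
  exact ⟨n, by linarith [neg_abs_le x], by linarith [le_abs_self x]⟩

theorem box_mono : Monotone fun n : ℕ => Ioc (-(n:ℝ)) n := by
  intro m n h
  have : (m:ℝ) ≤ n := by exact_mod_cast h
  exact Ioc_subset_Ioc (by linarith) this

theorem lint_iSup_box (f : ℝ → ENNReal) : ∫⁻ x, f x = ⨆ n : ℕ, ∫⁻ x in Ioc (-(n:ℝ)) n, f x := by
  rw [← setLIntegral_iUnion_of_directed f (box_mono.directed_le), union_box, Measure.restrict_univ]

theorem meas_lint {g : ℝ → ℝ → ENNReal} (hg : Measurable (Function.uncurry g)) (μ : Measure ℝ) [SFinite μ] :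
    Measurable fun t => ∫⁻ x, g t x ∂μ := Measurable.lintegral_prod_right' hg

theorem ofReal_meas2 {d : ℝ → ℝ → ℝ} (hd : Continuous (Function.uncurry d)) :
    Measurable (Function.uncurry fun t x => ofReal (d t x)) :=
  ENNReal.measurable_ofReal.comp hd.measurable

theorem lemmaB {s T : ℝ} (hsT : s ≤ T) {e et d Φ Φx : ℝ → ℝ → ℝ} {a b : ℝ → ℝ} {g : ℝ → ℝ → ENNReal}
    (ce : Continuous (Function.uncurry e))
    (cet : Continuous (Function.uncurry et)) (cd : Continuous (Function.uncurry d))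
    (cΦ : Continuous (Function.uncurry Φ)) (cΦx : Continuous (Function.uncurry Φx))
    (ca : Continuous a) (cb : Continuous b) (a0 : ∀ x, 0 ≤ a x) (b0 : ∀ x, 0 ≤ b x)
    (d0 : ∀ t x, 0 ≤ d t x)
    (hab : ∀ x, a x + e s x ≤ b x + e T x)
    (he : ∀ x t, HasDerivAt (fun τ => e τ x) (et t x) t)
    (hΦ : ∀ t x, HasDerivAt (fun y => Φ t y) (Φx t x) x)
    (hg : ∀ t ∈ Ioc s T, ∀ x, ofReal (et t x + d t x - Φx t x) ≤ g t x)
    (hfin : ∫⁻ t in Ioc s T, ∫⁻ x, ofReal |Φ t x| ≠ ⊤) :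
    (∫⁻ x, ofReal (a x)) + ∫⁻ t in Ioc s T, ∫⁻ x, ofReal (d t x) ≤
    (∫⁻ x, ofReal (b x)) + ∫⁻ t in Ioc s T, ∫⁻ x, g t x := by
  set RHS := (∫⁻ x, ofReal (b x)) + ∫⁻ t in Ioc s T, ∫⁻ x, g t x with hRHS
  have c1 : ∀ {q : ℝ → ℝ → ℝ}, Continuous (Function.uncurry q) → ∀ x, Continuous fun t => q t x :=
    fun hq x => hq.comp (by fun_prop : Continuous fun t : ℝ => (t, x))
  have c2 : ∀ {q : ℝ → ℝ → ℝ}, Continuous (Function.uncurry q) → ∀ t, Continuous fun x => q t x :=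
    fun hq t => hq.comp (by fun_prop : Continuous fun x : ℝ => (t, x))
  have cswap : ∀ {q : ℝ → ℝ → ℝ}, Continuous (Function.uncurry q) → ∀ R, Continuous fun t => ∫ x in (-R)..R, q t x :=
    fun hq R => intervalIntegral.continuous_parametric_intervalIntegral_of_continuous' hq _ _
  set J : ℝ → ℝ := fun R => ∫ t in s..T, (|Φ t R| + |Φ t (-R)|) with hJ
  have main : ∀ R > 0, (∫ x in (-R)..R, a x) + (∫ t in s..T, ∫ x in (-R)..R, d t x) ≤
      (∫ x in (-R)..R, b x) + (∫ t in s..T, ∫ x in (-R)..R, (et t x + d t x - Φx t x)) + J R := by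
    intro R hR
    have h1 : (∫ t in s..T, ∫ x in (-R)..R, (et t x + d t x - Φx t x)) =
        (∫ t in s..T, ∫ x in (-R)..R, et t x) + (∫ t in s..T, ∫ x in (-R)..R, d t x)
        - ∫ t in s..T, (Φ t R - Φ t (-R)) := by
      rw [← intervalIntegral.integral_add, ← intervalIntegral.integral_sub]
      · congr 1; funext t
        rw [intervalIntegral.integral_sub, intervalIntegral.integral_add]
        · congr 1
          exact (intervalIntegral.integral_eq_sub_of_hasDerivAt (fun x _ => hΦ t x)
            ((c2 cΦx t).intervalIntegrable _ _))
        · exact (c2 cet t).intervalIntegrable _ _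
        · exact (c2 cd t).intervalIntegrable _ _
        · exact ((c2 cet t).add (c2 cd t)).intervalIntegrable _ _
        · exact (c2 cΦx t).intervalIntegrable _ _
      · exact ((cswap cet R).add (cswap cd R)).intervalIntegrable _ _
      · exact ((c1 cΦ R).sub (c1 cΦ (-R))).intervalIntegrable _ _
      · exact (cswap cet R).intervalIntegrable _ _
      · exact (cswap cd R).intervalIntegrable _ _
    have h2 : (∫ t in s..T, ∫ x in (-R)..R, et t x) = ∫ x in (-R)..R, (e T x - e s x) := by
      have hd := fun t => hasDeriv_ii ce cet (-R) R (fun y z => he z y) t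
      rw [intervalIntegral.integral_eq_sub_of_hasDerivAt (fun t _ => hd t)
        ((cswap cet R).intervalIntegrable _ _), intervalIntegral.integral_sub]
      · exact (c2 ce T).intervalIntegrable _ _
      · exact (c2 ce s).intervalIntegrable _ _
    have h3 : (∫ x in (-R)..R, a x) ≤ (∫ x in (-R)..R, b x) + ∫ x in (-R)..R, (e T x - e s x) := by
      rw [← intervalIntegral.integral_add (cb.intervalIntegrable _ _) ((by have := (c2 ce T); have := c2 ce s; fun_prop : Continuous fun x => e T x - e s x).intervalIntegrable _ _)]
      apply intervalIntegral.integral_mono_on (by linarith) (ca.intervalIntegrable _ _)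
        ((by have := (c2 ce T); have := c2 ce s; fun_prop : Continuous fun x => b x + (e T x - e s x)).intervalIntegrable _ _)
      intro x _; have := hab x; linarith
    have h4 : (∫ t in s..T, (Φ t R - Φ t (-R))) ≤ J R := by
      apply intervalIntegral.integral_mono_on hsT
      · exact ((c1 cΦ R).sub (c1 cΦ (-R))).intervalIntegrable _ _
      · exact ((c1 cΦ R).abs.add (c1 cΦ (-R)).abs).intervalIntegrable _ _
      · intro t _; have := le_abs_self (Φ t R); have := neg_abs_le (Φ t (-R)); linarith
    linarith
  have J0 : ∀ R, 0 ≤ J R := fun R => intervalIntegral.integral_nonneg hsT (fun t _ => by positivity)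
  have mainE : ∀ R > 0, (∫⁻ x in Ioc (-R) R, ofReal (a x)) + (∫⁻ t in Ioc s T, ∫⁻ x in Ioc (-R) R, ofReal (d t x))
      ≤ RHS + ofReal (J R) := by
    intro R hR
    have hRR : -R ≤ R := by linarith
    have e1 : ∫⁻ x in Ioc (-R) R, ofReal (a x) = ofReal (∫ x in (-R)..R, a x) :=
      (ofReal_ii_eq hRR ca (fun x _ => a0 x)).symm
    have e2 : (∫⁻ t in Ioc s T, ∫⁻ x in Ioc (-R) R, ofReal (d t x)) =
        ofReal (∫ t in s..T, ∫ x in (-R)..R, d t x) := by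
      rw [ofReal_ii_eq hsT (cswap cd R) (fun t _ => intervalIntegral.integral_nonneg hRR fun x _ => d0 t x)]
      congr 1; funext t
      exact (ofReal_ii_eq hRR (c2 cd t) (fun x _ => d0 t x)).symm
    rw [e1, e2, ← ofReal_add (intervalIntegral.integral_nonneg hRR fun x _ => a0 x)
      (intervalIntegral.integral_nonneg hsT fun t _ => intervalIntegral.integral_nonneg hRR fun x _ => d0 t x)]
    refine (ofReal_le_ofReal (main R hR)).trans ?_
    refine ENNReal.ofReal_add_le.trans ?_
    gcongr
    refine ENNReal.ofReal_add_le.trans ?_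
    rw [hRHS]
    gcongr
    · refine (ofReal_ii_le hRR b).trans (setLIntegral_le_lintegral _ _)
    · refine (ofReal_ii_le hsT _).trans ?_
      apply setLIntegral_mono' measurableSet_Ioc
      intro t ht
      refine (ofReal_ii_le hRR _).trans ((setLIntegral_le_lintegral _ _).trans ?_)
      exact lintegral_mono (fun x => hg t ht x)
  have Jfin : ∫⁻ R in Ioi 0, ofReal (J R) ≠ ⊤ := by
    have mΦ : Measurable (Function.uncurry fun t x => ofReal |Φ t x|) := ofReal_meas2 (d := fun t x => |Φ t x|) cΦ.abs
    have k1 : ∀ R, ofReal (J R) = (∫⁻ t in Ioc s T, ofReal |Φ t R|) + ∫⁻ t in Ioc s T, ofReal |Φ t (-R)| := by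
      intro R
      rw [hJ]; simp only
      rw [ofReal_ii_eq hsT (by have := c1 cΦ R; have := c1 cΦ (-R); fun_prop : Continuous fun t => |Φ t R| + |Φ t (-R)|) (fun t _ => by positivity), ← lintegral_add_left]
      · congr 1; funext t; rw [ofReal_add (abs_nonneg _) (abs_nonneg _)]
      · exact (ENNReal.measurable_ofReal.comp (c1 cΦ R).abs.measurable)
    set H : ℝ → ENNReal := fun R => ∫⁻ t in Ioc s T, ofReal |Φ t R| with hH
    have mH : Measurable H := Measurable.lintegral_prod_left' (μ := volume.restrict (Ioc s T)) (f := Function.uncurry fun t x => ofReal |Φ t x|) mΦ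
    have HT : ∫⁻ R, H R ≠ ⊤ := by
      rw [hH, lintegral_lintegral_swap]
      · exact hfin
      · exact (mΦ.comp measurable_swap).aemeasurable
    have : ∀ R, ofReal (J R) = H R + H (-R) := k1
    simp_rw [this]
    refine ne_top_of_le_ne_top ?_ (setLIntegral_le_lintegral _ _)
    rw [lintegral_add_left mH]
    have : ∫⁻ R, H (-R) = ∫⁻ R, H R :=
      (Measure.measurePreserving_neg (volume : Measure ℝ)).lintegral_comp mH
    rw [this]
    exact ENNReal.add_ne_top.2 ⟨HT, HT⟩
  have fin : ∀ n : ℕ, (∫⁻ x in Ioc (-(n:ℝ)) n, ofReal (a x)) + (∫⁻ t in Ioc s T, ∫⁻ x in Ioc (-(n:ℝ)) n, ofReal (d t x)) ≤ RHS := by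
    intro n
    refine ENNReal.le_of_forall_pos_le_add ?_
    intro ε hε _
    obtain ⟨R, hR, hR0, hRε⟩ := exists_small Jfin ε (by exact_mod_cast hε.ne') n
    have hsub : Ioc (-(n:ℝ)) n ⊆ Ioc (-R) R := Ioc_subset_Ioc (by linarith) hR
    refine le_trans (add_le_add (lintegral_mono_set hsub) (lintegral_mono fun t => lintegral_mono_set hsub)) ?_
    exact (mainE R hR0).trans (by gcongr)
  have e3 : ∫⁻ t in Ioc s T, ∫⁻ x, ofReal (d t x) = ⨆ n : ℕ, ∫⁻ t in Ioc s T, ∫⁻ x in Ioc (-(n:ℝ)) n, ofReal (d t x) := by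
    rw [← lintegral_iSup]
    · congr 1; funext t; exact lint_iSup_box _
    · intro n; exact meas_lint (ofReal_meas2 cd) _
    · intro m n h t; exact lintegral_mono_set (box_mono h)
  rw [e3, lint_iSup_box, ENNReal.iSup_add_iSup_of_monotone]
  · exact iSup_le fin
  · intro m n h; exact lintegral_mono_set (box_mono h)
  · intro m n h; exact lintegral_mono fun t => lintegral_mono_set (box_mono h)

theorem lemmaD {G : ℝ → ℝ → ℝ → ENNReal} (hG : Measurable fun p : ℝ × ℝ × ℝ => G p.1 p.2.1 p.2.2)
    {s T : ℝ} (hfin : ∫⁻ t in Ioc s T, ∫⁻ x, ∫⁻ z in Ioi 0, G t x z ≠ ⊤)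
    {m : ℕ → ℝ → ENNReal} (hm : ∀ n, Measurable (m n)) {C : ENNReal} (hC : C ≠ ⊤) (h1 : ∀ n z, m n z ≤ C)
    (h0 : ∀ z, Tendsto (fun n => m n z) atTop (nhds 0)) :
    Tendsto (fun n => ∫⁻ t in Ioc s T, ∫⁻ x, ∫⁻ z in Ioi 0, m n z * G t x z) atTop (nhds 0) := by
  set μ := (volume.restrict (Ioc s T)).prod ((volume : Measure ℝ).prod (volume.restrict (Ioi (0:ℝ)))) with hμ
  have conv : ∀ g : ℝ × ℝ × ℝ → ENNReal, Measurable g → ∫⁻ t in Ioc s T, ∫⁻ x, ∫⁻ z in Ioi 0, g (t, x, z) = ∫⁻ p, g p ∂μ := by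
    intro g hg
    rw [hμ, lintegral_prod _ hg.aemeasurable]
    congr 1; funext t
    rw [lintegral_prod (fun q => g (t, q)) (hg.comp (by fun_prop : Measurable fun q : ℝ × ℝ => (t, q))).aemeasurable]
  have e : ∀ n, ∫⁻ t in Ioc s T, ∫⁻ x, ∫⁻ z in Ioi 0, m n z * G t x z = ∫⁻ p, m n p.2.2 * G p.1 p.2.1 p.2.2 ∂μ := fun n =>
    conv (fun p => m n p.2.2 * G p.1 p.2.1 p.2.2) (((hm n).comp (by fun_prop)).mul hG)
  simp_rw [e]
  have eG := conv _ hG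
  simp only at eG
  rw [eG] at hfin
  have := tendsto_lintegral_of_dominated_convergence (μ := μ) (F := fun n p => m n p.2.2 * G p.1 p.2.1 p.2.2)
    (f := fun _ => 0) (fun p => C * G p.1 p.2.1 p.2.2) (fun n => ((hm n).comp (by fun_prop)).mul hG)
    (fun n => Eventually.of_forall fun p => mul_le_mul_left (h1 n _) _) 
    (by rw [lintegral_const_mul _ hG]; exact ENNReal.mul_ne_top hC hfin) ?_
  · simpa using this
  · have hae := ae_lt_top hG hfin
    filter_upwards [hae] with p hp
    have := ENNReal.Tendsto.mul_const (h0 p.2.2) (b := G p.1 p.2.1 p.2.2) (Or.inr hp.ne)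
    simpa using this

theorem cs_ii {f g : ℝ → ℝ} {a b : ℝ} (hab : a ≤ b) (hf : ContinuousOn f (Icc a b)) (hg : ContinuousOn g (Icc a b)) :
    (∫ x in a..b, f x * g x) ^ 2 ≤ (∫ x in a..b, f x ^ 2) * ∫ x in a..b, g x ^ 2 := by
  rw [← uIcc_of_le hab] at hf hg
  have key : ∀ l : ℝ, 0 ≤ (∫ x in a..b, g x ^ 2) * (l * l) + (-2 * ∫ x in a..b, f x * g x) * l + ∫ x in a..b, f x ^ 2 := by
    intro l
    have h0 : 0 ≤ ∫ x in a..b, (g x ^ 2 * (l * l) + (-2 * l) * (f x * g x) + f x ^ 2) := by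
      apply intervalIntegral.integral_nonneg hab
      intro x _; nlinarith [sq_nonneg (f x - l * g x)]
    rw [intervalIntegral.integral_add, intervalIntegral.integral_add, intervalIntegral.integral_mul_const,
      intervalIntegral.integral_const_mul] at h0
    · linarith
    · exact ((hg.pow 2).mul continuousOn_const).intervalIntegrable
    · exact (continuousOn_const.mul (hf.mul hg)).intervalIntegrable
    · exact (((hg.pow 2).mul continuousOn_const).add (continuousOn_const.mul (hf.mul hg))).intervalIntegrable
    · exact (hf.pow 2).intervalIntegrable
  have := discrim_le_zero key
  unfold discrim at this
  nlinarith

theorem ii_mono {f g : ℝ → ℝ} {a b : ℝ} (hab : a ≤ b) (hf : Continuous f) (hg : Continuous g)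
    (h : ∀ x ∈ Icc a b, f x ≤ g x) : (∫ x in a..b, f x) ≤ ∫ x in a..b, g x :=
  intervalIntegral.integral_mono_on hab (hf.intervalIntegrable _ _) (hg.intervalIntegrable _ _) h

theorem ii_sub_le {f : ℝ → ℝ} {a b c : ℝ} (hac : a ≤ c) (hcb : c ≤ b) (hf : Continuous f)
    (h0 : ∀ x ∈ Icc a b, 0 ≤ f x) : (∫ x in c..b, f x) ≤ ∫ x in a..b, f x := by
  rw [← intervalIntegral.integral_add_adjacent_intervals (hf.intervalIntegrable a c) (hf.intervalIntegrable c b)]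
  have : 0 ≤ ∫ x in a..c, f x := intervalIntegral.integral_nonneg hac fun x hx => h0 x ⟨hx.1, hx.2.trans hcb⟩
  linarith

def FS (g : ℝ → ℝ) : Prop := ∀ δ > 0, ∀ Y : ℝ, ∃ y ≥ Y, |g y| ≤ δ

theorem FS_of_tendsto {g : ℝ → ℝ} (h : Tendsto g atTop (nhds 0)) : FS g := by
  intro δ hδ Y
  have h1 := (h.abs).eventually (gt_mem_nhds (by simpa using hδ : |(0:ℝ)| < δ))
  obtain ⟨y, hy, hY⟩ := (h1.and (eventually_ge_atTop Y)).exists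
  exact ⟨y, hY, hy.le⟩

theorem FS_deriv {g g' : ℝ → ℝ} (hd : ∀ z, HasDerivAt g (g' z) z) (h : Tendsto g atTop (nhds 0)) : FS g' := by
  intro δ hδ Y
  have h1 := (h.abs).eventually (gt_mem_nhds (by simp only [abs_zero]; positivity : |(0:ℝ)| < δ/2))
  obtain ⟨Y1, hY1⟩ := eventually_atTop.1 h1
  set y := max Y Y1
  obtain ⟨c, hc, hc2⟩ := exists_hasDerivAt_eq_slope g g' (by linarith : y < y + 1)
    (fun x _ => (hd x).continuousAt.continuousWithinAt) (fun x _ => hd x)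
  refine ⟨c, (le_max_left Y Y1).trans hc.1.le, ?_⟩
  rw [hc2]
  have a1 := hY1 y (le_max_right _ _)
  have a2 := hY1 (y+1) ((le_max_right Y Y1).trans (by linarith))
  rw [show y + 1 - y = 1 by ring, div_one]
  rw [abs_lt] at a1 a2
  rw [abs_le]; constructor <;> linarith

def Bd (h : ℝ → ℝ) (B : ℝ) : Prop := ∀ Z ≥ 0, (∫ z in (0:ℝ)..Z, h z) ≤ B

theorem Bd_iff {h : ℝ → ℝ} (hc : Continuous h) (h0 : ∀ z ≥ 0, 0 ≤ h z) {B : ℝ} (hB : 0 ≤ B) :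
    (∫⁻ z in Ioi (0:ℝ), ofReal (h z)) ≤ ofReal B ↔ Bd h B := by
  constructor
  · intro H Z hZ
    have := ofReal_ii_eq hZ hc (fun x hx => h0 x hx.1)
    rw [← ENNReal.ofReal_le_ofReal_iff hB, this]
    exact (lintegral_mono_set Ioc_subset_Ioi_self).trans H
  · intro H
    have hU : (⋃ n : ℕ, Ioc (0:ℝ) n) = Ioi 0 := by
      ext x; simp only [mem_iUnion, mem_Ioc, mem_Ioi]
      constructor
      · rintro ⟨n, h, _⟩; exact h
      · intro h; obtain ⟨n, hn⟩ := exists_nat_gt x; exact ⟨n, h, hn.le⟩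
    have hm : Monotone fun n : ℕ => Ioc (0:ℝ) n := by
      intro m n h; exact Ioc_subset_Ioc_right (by exact_mod_cast h)
    rw [← hU, setLIntegral_iUnion_of_directed _ hm.directed_le]
    refine iSup_le fun n => ?_
    rw [← ofReal_ii_eq (Nat.cast_nonneg n) hc (fun x hx => h0 x hx.1)]
    exact ofReal_le_ofReal (H n (Nat.cast_nonneg n))

theorem Bd_toReal {h : ℝ → ℝ} (hc : Continuous h) (h0 : ∀ z ≥ 0, 0 ≤ h z)
    (hf : ∫⁻ z in Ioi (0:ℝ), ofReal (h z) ≠ ⊤) :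
    Bd h (∫⁻ z in Ioi (0:ℝ), ofReal (h z)).toReal :=
  (Bd_iff hc h0 ENNReal.toReal_nonneg).1 (by rw [ENNReal.ofReal_toReal hf])

theorem Bd.nonneg {h : ℝ → ℝ} {B : ℝ} (H : Bd h B) : 0 ≤ B := by simpa using H 0 le_rfl

theorem jz_pos (z : ℝ) : 0 < jz z := Real.sqrt_pos.2 (by positivity)
theorem jz_sq (z : ℝ) : jz z ^ 2 = 1 + z ^ 2 := Real.sq_sqrt (by positivity)
theorem jz_cont : Continuous jz := by unfold jz; fun_prop

theorem int_jz_inv {a b : ℝ} (ha : 0 ≤ a) : (∫ s in a..b, ((jz s)⁻¹) ^ 2) ≤ 2 := by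
  have : (fun s : ℝ => ((jz s)⁻¹) ^ 2) = fun s => (1 + s^2)⁻¹ := by
    funext s; rw [inv_pow, jz_sq]
  rw [this, integral_inv_one_add_sq]
  have h1 := Real.arctan_lt_pi_div_two b
  have h2 := Real.arctan_nonneg.2 ha
  have := Real.pi_le_four
  linarith

theorem int_abs_sq {g : ℝ → ℝ} (hg : Continuous g) {a b B : ℝ} (ha : 0 ≤ a) (hab : a ≤ b)
    (hB : (∫ s in a..b, (1 + s^2) * g s ^ 2) ≤ B) : (∫ s in a..b, |g s|) ^ 2 ≤ 2 * B := by
  have h := cs_ii (f := fun s => (jz s)⁻¹) (g := fun s => jz s * |g s|) hab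
    ((jz_cont.inv₀ fun s => (jz_pos s).ne').continuousOn) ((jz_cont.mul hg.abs).continuousOn)
  have e1 : (fun s => (jz s)⁻¹ * (jz s * |g s|)) = fun s => |g s| := by
    funext s; rw [← mul_assoc, inv_mul_cancel₀ (jz_pos s).ne', one_mul]
  have e2 : (fun s => (jz s * |g s|) ^ 2) = fun s => (1 + s^2) * g s ^ 2 := by
    funext s; rw [mul_pow, jz_sq, sq_abs]
  rw [e1, e2] at h
  have h0 : 0 ≤ ∫ s in a..b, (1 + s^2) * g s ^ 2 := intervalIntegral.integral_nonneg hab fun s _ => by positivity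
  have := int_jz_inv (b := b) ha
  nlinarith

theorem int_sq {g : ℝ → ℝ} (hg : Continuous g) {z : ℝ} (hz : 0 ≤ z) :
    (∫ s in (0:ℝ)..z, g s) ^ 2 ≤ z * ∫ s in (0:ℝ)..z, g s ^ 2 := by
  have h := cs_ii (f := fun _ => 1) (g := g) hz continuousOn_const hg.continuousOn
  simpa using h

theorem bd_sub {g : ℝ → ℝ} (hg : Continuous g) {B : ℝ} (hB : Bd (fun s => (1 + s^2) * g s ^ 2) B) {z y : ℝ} (hz : 0 ≤ z)
    (hzy : z ≤ y) : (∫ s in z..y, (1 + s^2) * g s ^ 2) ≤ B :=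
  (ii_sub_le hz hzy (by fun_prop) (fun x _ => by positivity)).trans (hB y (hz.trans hzy))

theorem sup_bd {g g' : ℝ → ℝ} (hd : ∀ z, HasDerivAt g (g' z) z) (hc : Continuous g') (hs : FS g) {B : ℝ}
    (hB : Bd (fun s => (1 + s^2) * g' s ^ 2) B) {z : ℝ} (hz : 0 ≤ z) : g z ^ 2 ≤ 2 * B := by
  have key : ∀ δ > 0, |g z| ≤ δ + √(2 * B) := by
    intro δ hδ
    obtain ⟨y, hy, hyδ⟩ := hs δ hδ z
    have h1 := intervalIntegral.integral_eq_sub_of_hasDerivAt (fun x _ => hd x) (hc.intervalIntegrable z y)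
    have h2 : |∫ s in z..y, g' s| ≤ ∫ s in z..y, |g' s| := intervalIntegral.abs_integral_le_integral_abs hy
    have h3 := Real.le_sqrt_of_sq_le (int_abs_sq hc hz hy (bd_sub hc hB hz hy))
    rw [h1] at h2
    have : |g z| ≤ |g y| + |g y - g z| := by
      have := abs_sub_abs_le_abs_sub (g z) (g y); rw [abs_sub_comm] at this; linarith
    linarith
  have h : |g z| ≤ √(2 * B) := le_of_forall_pos_le_add (fun δ hδ => by rw [add_comm]; exact key δ hδ)
  have hB0 := hB.nonneg
  calc g z ^ 2 = |g z| ^ 2 := (sq_abs _).symm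
    _ ≤ √(2*B) ^ 2 := by gcongr
    _ = _ := Real.sq_sqrt (by positivity)

theorem z_sup_bd {g g' : ℝ → ℝ} (hd : ∀ z, HasDerivAt g (g' z) z) (hc : Continuous g') (hs : FS g) {B : ℝ}
    (hB : Bd (fun s => (1 + s^2) * g' s ^ 2) B) {z : ℝ} (hz : 0 < z) : z * g z ^ 2 ≤ B := by
  have hB0 := hB.nonneg
  have key : ∀ δ > 0, |g z| ≤ δ + √(B / z) := by
    intro δ hδ
    obtain ⟨y, hy, hyδ⟩ := hs δ hδ z
    have h1 := intervalIntegral.integral_eq_sub_of_hasDerivAt (fun x _ => hd x) (hc.intervalIntegrable z y)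
    have hpos : ∀ s ∈ Icc z y, s ≠ 0 := fun s hs => (hz.trans_le hs.1).ne'
    have h := cs_ii (f := fun s => s⁻¹) (g := fun s => s * g' s) hy
      (continuousOn_id.inv₀ hpos) ((continuous_id.mul hc).continuousOn)
    have e1 : (∫ s in z..y, s⁻¹ * (s * g' s)) = g y - g z := by
      rw [← h1]; apply intervalIntegral.integral_congr
      intro s hs; rw [uIcc_of_le hy] at hs
      simp only; rw [← mul_assoc, inv_mul_cancel₀ (hpos s hs), one_mul]
    have e2 : (∫ s in z..y, (s⁻¹) ^ 2) ≤ 1 / z := by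
      have : (∫ s in z..y, (s⁻¹) ^ 2) = (-(y⁻¹)) - (-(z⁻¹)) := by
        apply intervalIntegral.integral_eq_sub_of_hasDerivAt (f := fun s => -(s⁻¹))
        · intro s hs; rw [uIcc_of_le hy] at hs
          have := (hasDerivAt_inv (hpos s hs)).neg
          refine HasDerivAt.congr_deriv this ?_
          simp
        · apply ContinuousOn.intervalIntegrable
          rw [uIcc_of_le hy]; exact (continuousOn_id.inv₀ hpos).pow 2
      rw [this, one_div]
      have : 0 < y⁻¹ := inv_pos.2 (hz.trans_le hy)
      linarith
    have e3 : (∫ s in z..y, (s * g' s) ^ 2) ≤ B :=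
      (ii_mono hy (by fun_prop) (by fun_prop) (fun s _ => by nlinarith [sq_nonneg (g' s)])).trans (bd_sub hc hB hz.le hy)
    rw [e1] at h
    have e4 : (g y - g z)^2 ≤ B / z := by
      have p1 : 0 ≤ ∫ s in z..y, (s * g' s) ^ 2 := intervalIntegral.integral_nonneg hy fun s _ => by positivity
      calc _ ≤ _ := h
        _ ≤ (1/z) * B := by gcongr
        _ = _ := by ring
    have h3 := Real.abs_le_sqrt e4
    have : |g z| ≤ |g y| + |g y - g z| := by
      have := abs_sub_abs_le_abs_sub (g z) (g y); rw [abs_sub_comm] at this; linarith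
    linarith
  have h : |g z| ≤ √(B / z) := le_of_forall_pos_le_add (fun δ hδ => by rw [add_comm]; exact key δ hδ)
  calc z * g z ^ 2 = z * |g z| ^ 2 := by rw [sq_abs]
    _ ≤ z * √(B/z) ^ 2 := by gcongr
    _ = z * (B/z) := by rw [Real.sq_sqrt (by positivity)]
    _ = B := by field_simp

theorem hardyB {g g' : ℝ → ℝ} (hd : ∀ z, HasDerivAt g (g' z) z) (hc : Continuous g') (hs : FS g) {B : ℝ}
    (hB : Bd (fun s => (1 + s^2) * g' s ^ 2) B) : Bd (fun s => g s ^ 2) (6 * B) := by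
  intro Z hZ
  have cg : Continuous g := continuous_iff_continuousAt.2 fun z => (hd z).continuousAt
  have h1 : ∀ z, HasDerivAt (fun z => z * g z ^ 2) (g z ^ 2 + 2 * z * (g z * g' z)) z := by
    intro z
    have := (hasDerivAt_id z).mul ((hd z).pow 2)
    refine HasDerivAt.congr_deriv this ?_
    simp; ring
  have h2 := intervalIntegral.integral_eq_sub_of_hasDerivAt (a := 0) (b := Z) (fun x _ => h1 x)
    (by apply Continuous.intervalIntegrable; fun_prop)
  have h3 : (∫ z in (0:ℝ)..Z, (g z ^ 2 - 4 * ((1+z^2) * g' z ^ 2))) ≤ ∫ z in (0:ℝ)..Z, 2 * (g z ^ 2 + 2 * z * (g z * g' z)) := by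
    apply ii_mono hZ (by fun_prop) (by fun_prop)
    intro z hz
    nlinarith [sq_nonneg (g z + 2 * z * g' z), sq_nonneg (g' z)]
  rw [intervalIntegral.integral_const_mul, h2, intervalIntegral.integral_sub, intervalIntegral.integral_const_mul] at h3
  · have h4 := hB Z hZ
    have h5 : Z * g Z ^ 2 ≤ B := by
      rcases hZ.eq_or_lt with h | h
      · rw [← h]; simpa using hB.nonneg
      · exact z_sup_bd hd hc hs hB h
    simp at h3
    linarith
  · apply Continuous.intervalIntegrable; fun_prop
  · apply Continuous.intervalIntegrable; fun_prop

theorem inv_sq_cont {g : ℝ → ℝ} (cg : Continuous g) : Continuous fun z => g z ^ 2 / (1 + z^2) :=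
  (cg.pow 2).div (by fun_prop) (fun z => by positivity)

theorem hardyA {g g' : ℝ → ℝ} (hd : ∀ z, HasDerivAt g (g' z) z) (hc : Continuous g') (h0 : g 0 = 0) {Z : ℝ} (hZ : 0 ≤ Z) :
    (∫ z in (0:ℝ)..Z, g z ^ 2 / (1 + z^2)) ≤ 8 * ∫ z in (0:ℝ)..Z, g' z ^ 2 := by
  have cg : Continuous g := continuous_iff_continuousAt.2 fun z => (hd z).continuousAt
  have h1 : ∀ z ∈ uIcc 0 Z, HasDerivAt (fun z => -(g z ^ 2) / (1 + z)) (g z ^ 2 / (1+z)^2 - 2 * (g z * g' z) / (1+z)) z := by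
    intro z hz; rw [uIcc_of_le hZ] at hz
    have hz1 : (1 + z) ≠ 0 := by linarith [hz.1]
    have := ((hd z).pow 2).neg.div ((hasDerivAt_id z).const_add 1) hz1
    refine HasDerivAt.congr_deriv this ?_
    simp; field_simp; ring
  have hco : ∀ k : ℝ → ℝ, Continuous k → ∀ n, ContinuousOn (fun z => k z / (1+z)^n) (uIcc 0 Z) := by
    intro k hk n
    apply hk.continuousOn.div (by fun_prop)
    intro z hz; rw [uIcc_of_le hZ] at hz
    have : 0 < 1 + z := by linarith [hz.1]
    positivity
  have i1 : IntervalIntegrable (fun z => g z ^ 2 / (1+z)^2 - 2 * (g z * g' z) / (1+z)) volume 0 Z := by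
    apply ContinuousOn.intervalIntegrable
    have := hco (fun z => 2 * (g z * g' z)) (by fun_prop) 1
    simp only [pow_one] at this
    exact (hco (fun z => g z ^ 2) (by fun_prop) 2).sub this
  have h2 := intervalIntegral.integral_eq_sub_of_hasDerivAt h1 i1
  have h3 : (∫ z in (0:ℝ)..Z, (g z ^ 2 / (1+z^2) - 8 * g' z ^ 2)) ≤ ∫ z in (0:ℝ)..Z, 4 * (g z ^ 2 / (1+z)^2 - 2 * (g z * g' z) / (1+z)) := by
    apply intervalIntegral.integral_mono_on hZ
    · exact ((inv_sq_cont cg).sub (by fun_prop)).intervalIntegrable _ _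
    · exact i1.const_mul 4
    intro z hz
    have hz1 : 0 < 1 + z := by linarith [hz.1]
    have a1 : g z ^ 2 / (1+z^2) ≤ 2 * (g z ^ 2 / (1+z)^2) := by
      rw [← mul_div_assoc, div_le_div_iff₀ (by positivity) (by positivity)]
      nlinarith [sq_nonneg (z-1), sq_nonneg (g z), mul_nonneg (sq_nonneg (g z)) (sq_nonneg (z-1))]
    have a2 : 2 * (g z * g' z) / (1+z) = 2 * (g z / (1+z)) * g' z := by ring
    have a3 : g z ^ 2 / (1+z)^2 = (g z / (1+z))^2 := by rw [div_pow]
    rw [a2]; rw [a3] at a1 ⊢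
    nlinarith [sq_nonneg (g z / (1+z) - 2 * g' z)]
  rw [intervalIntegral.integral_const_mul, h2, intervalIntegral.integral_sub, intervalIntegral.integral_const_mul] at h3
  · rw [h0] at h3
    have : -(g Z ^ 2) / (1 + Z) ≤ 0 := by
      rw [neg_div]; exact neg_nonpos.2 (by positivity)
    simp at h3
    linarith
  · exact (inv_sq_cont cg).intervalIntegrable _ _
  · apply Continuous.intervalIntegrable; fun_prop

theorem hardyB_E {g g' : ℝ → ℝ} (hd : ∀ z, HasDerivAt g (g' z) z) (hc : Continuous g') (hs : FS g) :
    (∫⁻ z in Ioi (0:ℝ), ofReal (g z ^ 2)) ≤ 6 * ∫⁻ z in Ioi (0:ℝ), ofReal ((1 + z^2) * g' z ^ 2) := by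
  have cg : Continuous g := continuous_iff_continuousAt.2 fun z => (hd z).continuousAt
  by_cases hf : (∫⁻ z in Ioi (0:ℝ), ofReal ((1 + z^2) * g' z ^ 2)) = ⊤
  · rw [hf, ENNReal.mul_top (by norm_num)]; exact le_top
  have h := hardyB hd hc hs (Bd_toReal (by fun_prop) (fun z _ => by positivity) hf)
  have h2 := (Bd_iff (by fun_prop) (fun z _ => by positivity) h.nonneg).2 h
  rw [ofReal_mul (by norm_num), ENNReal.ofReal_toReal hf] at h2
  simpa using h2

theorem hardyA_E {g g' : ℝ → ℝ} (hd : ∀ z, HasDerivAt g (g' z) z) (hc : Continuous g') (h0 : g 0 = 0) :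
    (∫⁻ z in Ioi (0:ℝ), ofReal (g z ^ 2 / (1 + z^2))) ≤ 8 * ∫⁻ z in Ioi (0:ℝ), ofReal (g' z ^ 2) := by
  have cg : Continuous g := continuous_iff_continuousAt.2 fun z => (hd z).continuousAt
  by_cases hf : (∫⁻ z in Ioi (0:ℝ), ofReal (g' z ^ 2)) = ⊤
  · rw [hf, ENNReal.mul_top (by norm_num)]; exact le_top
  have h := (Bd_toReal (h := fun z => g' z ^ 2) (by fun_prop) (fun z _ => by positivity) hf)
  have h' : Bd (fun z => g z ^ 2 / (1 + z^2)) (8 * (∫⁻ z in Ioi (0:ℝ), ofReal (g' z ^ 2)).toReal) := by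
    intro Z hZ
    have := hardyA hd hc h0 hZ
    have := h Z hZ
    linarith
  have h2 := (Bd_iff (inv_sq_cont cg) (fun z _ => by positivity) h'.nonneg).2 h'
  rw [ofReal_mul (by norm_num), ENNReal.ofReal_toReal hf] at h2
  simpa using h2

def r0 : ℝ → ℝ := fun _ => 1
def r2 : ℝ → ℝ := fun z => 1 + z ^ 2
theorem r0c : Continuous r0 := continuous_const
theorem r2c : Continuous r2 := by unfold r2; fun_prop
theorem r0p (z : ℝ) : 0 ≤ r0 z := zero_le_one
theorem r2p (z : ℝ) : 0 ≤ r2 z := by unfold r2; positivity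
theorem r02 (z : ℝ) : r0 z ≤ r2 z := by unfold r2 r0; nlinarith [sq_nonneg z]

def QQ (ρ : ℝ → ℝ) (h : ℝ → ℝ → ℝ) (x : ℝ) : ENNReal := ∫⁻ z in Ioi (0:ℝ), ofReal (ρ z * h x z ^ 2)
def NN (ρ : ℝ → ℝ) (h : ℝ → ℝ → ℝ) : ENNReal := ∫⁻ x, QQ ρ h x

abbrev C2 (h : ℝ → ℝ → ℝ) : Prop := Continuous (Function.uncurry h)

theorem Sm.C2 {g} (h : Sm g) (t : ℝ) : _root_.C2 (g t) := h.cxz t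

theorem C2.mm {h : ℝ → ℝ → ℝ} (hh : C2 h) {ρ : ℝ → ℝ} (cρ : Continuous ρ) :
    Measurable (Function.uncurry fun x z => ofReal (ρ z * h x z ^ 2)) :=
  ofReal_meas2 (d := fun x z => ρ z * h x z ^ 2) ((cρ.comp continuous_snd).mul (hh.pow 2))

theorem C2.mQ {h : ℝ → ℝ → ℝ} (hh : C2 h) {ρ : ℝ → ℝ} (cρ : Continuous ρ) : Measurable (QQ ρ h) :=
  meas_lint (hh.mm cρ) _

theorem C2.sl {h : ℝ → ℝ → ℝ} (hh : C2 h) (x : ℝ) : Continuous (h x) :=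
  hh.comp (by fun_prop : Continuous fun z : ℝ => (x, z))
theorem C2.sx {h : ℝ → ℝ → ℝ} (hh : C2 h) (z : ℝ) : Continuous (fun x => h x z) :=
  hh.comp (by fun_prop : Continuous fun x : ℝ => (x, z))

theorem QQ_mono_r (h : ℝ → ℝ → ℝ) (x : ℝ) : QQ r0 h x ≤ QQ r2 h x := by
  apply lintegral_mono; intro z
  apply ofReal_le_ofReal
  exact mul_le_mul_of_nonneg_right (r02 z) (sq_nonneg _)
theorem NN_mono_r (h : ℝ → ℝ → ℝ) : NN r0 h ≤ NN r2 h := lintegral_mono (QQ_mono_r h)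

theorem QQ_sub {ρ : ℝ → ℝ} (cρ : Continuous ρ) (ρ0 : ∀ z, 0 ≤ ρ z) {g : ℝ → ℝ → ℝ} (cg : C2 g) (h : ℝ → ℝ → ℝ) (x : ℝ) :
    QQ ρ (fun x z => g x z - h x z) x ≤ 2 * QQ ρ g x + 2 * QQ ρ h x := by
  unfold QQ
  have m1 : Measurable fun z => ofReal (ρ z * g x z ^ 2) := by
    have := cg.sl x
    exact ENNReal.measurable_ofReal.comp (by fun_prop : Continuous fun z => ρ z * g x z ^ 2).measurable
  rw [← lintegral_const_mul _ m1, ← lintegral_const_mul' _ _ (by norm_num), ← lintegral_add_left (m1.const_mul 2)]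
  apply lintegral_mono; intro z
  have e : (2:ENNReal) = ofReal 2 := by simp
  simp only
  rw [e, ← ofReal_mul (by norm_num), ← ofReal_mul (by norm_num), ← ofReal_add]
  · apply ofReal_le_ofReal
    nlinarith [mul_nonneg (ρ0 z) (sq_nonneg (g x z + h x z))]
  · have := ρ0 z; positivity
  · have := ρ0 z; positivity

theorem NN_sub {ρ : ℝ → ℝ} (cρ : Continuous ρ) (ρ0 : ∀ z, 0 ≤ ρ z) {g h : ℝ → ℝ → ℝ} (cg : C2 g) :
    NN ρ (fun x z => g x z - h x z) ≤ 2 * NN ρ g + 2 * NN ρ h := by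
  unfold NN
  rw [← lintegral_const_mul _ (cg.mQ cρ), ← lintegral_const_mul' _ _ (by norm_num), ← lintegral_add_left ((cg.mQ cρ).const_mul 2)]
  exact lintegral_mono fun x => QQ_sub cρ ρ0 cg h x

theorem NN_shift (ρ : ℝ → ℝ) (g : ℝ → ℝ → ℝ) (h : ℝ) : NN ρ (fun x z => g (x + h) z) = NN ρ g :=
  lintegral_add_right_eq_self (fun x => QQ ρ g x) h

theorem agmon_pt {k k' : ℝ → ℝ} (hd : ∀ y, HasDerivAt k (k' y) y) (hc : Continuous k') {l : ℝ} (hl : 0 < l) (x : ℝ) :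
    k x ^ 2 ≤ 2 * l * (∫ y in x..(x + 1/l), k y ^ 2) + 1/l * ∫ y in x..(x + 1/l), k' y ^ 2 := by
  have ck : Continuous k := continuous_iff_continuousAt.2 fun z => (hd z).continuousAt
  set M := 1/l with hM
  have M0 : 0 < M := by positivity
  have h1 : ∀ y, HasDerivAt (fun y => (x + M - y) * k y ^ 2) (-(k y ^ 2) + 2 * (x + M - y) * (k y * k' y)) y := by
    intro y
    have := ((hasDerivAt_id y).const_sub (x + M)).mul ((hd y).pow 2)
    refine HasDerivAt.congr_deriv this ?_
    simp; ring
  have h2 := intervalIntegral.integral_eq_sub_of_hasDerivAt (a := x) (b := x + M) (fun y _ => h1 y)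
    (by apply Continuous.intervalIntegrable; fun_prop)
  have h3 : (∫ y in x..(x+M), (-2 * k y ^ 2 + (-M^2) * k' y ^ 2)) ≤ ∫ y in x..(x+M), (-(k y ^ 2) + 2 * (x + M - y) * (k y * k' y)) := by
    apply ii_mono (by linarith) (by fun_prop) (by fun_prop)
    intro y hy
    have a1 : 0 ≤ x + M - y := by linarith [hy.2]
    have a2 : x + M - y ≤ M := by linarith [hy.1]
    have a3 : (x + M - y)^2 ≤ M^2 := by gcongr
    nlinarith [sq_nonneg (k y + (x + M - y) * k' y), mul_le_mul_of_nonneg_right a3 (sq_nonneg (k' y))]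
  rw [h2, intervalIntegral.integral_add, intervalIntegral.integral_const_mul, intervalIntegral.integral_const_mul] at h3
  · have e : M * l = 1 := by rw [hM]; field_simp
    have h4 : M * k x ^ 2 ≤ 2 * (∫ y in x..(x + M), k y ^ 2) + M^2 * ∫ y in x..(x + M), k' y ^ 2 := by
      have : (x + M - (x + M)) = 0 := by ring
      rw [this] at h3
      have : (x + M - x) = M := by ring
      rw [this] at h3
      linarith
    have h5 := mul_le_mul_of_nonneg_left h4 hl.le
    calc k x ^ 2 = l * (M * k x ^ 2) := by rw [← mul_assoc, mul_comm l M, e, one_mul]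
      _ ≤ _ := h5
      _ = 2 * l * (∫ y in x..(x + M), k y ^ 2) + (M * l) * M * ∫ y in x..(x + M), k' y ^ 2 := by ring
      _ = _ := by rw [e, one_mul]
  · apply Continuous.intervalIntegrable; fun_prop
  · apply Continuous.intervalIntegrable; fun_prop

theorem swap_box {ρ : ℝ → ℝ} (cρ : Continuous ρ) (ρ0 : ∀ z, 0 ≤ ρ z) {h : ℝ → ℝ → ℝ} (ch : C2 h) {a b : ℝ} (hab : a ≤ b) :
    ∫⁻ z in Ioi (0:ℝ), ofReal (ρ z * ∫ y in a..b, h y z ^ 2) = ∫⁻ y in Ioc a b, QQ ρ h y := by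
  unfold QQ
  rw [lintegral_lintegral_swap (ch.mm cρ).aemeasurable]
  congr 1; funext z
  rw [← intervalIntegral.integral_const_mul, ofReal_ii_eq hab]
  · have := ch.sx z; fun_prop
  · intro y _; have := ρ0 z; positivity

theorem agmon {ρ : ℝ → ℝ} (cρ : Continuous ρ) (ρ0 : ∀ z, 0 ≤ ρ z) {h h' : ℝ → ℝ → ℝ} (ch : C2 h) (ch' : C2 h')
    (hd : ∀ x z, HasDerivAt (fun y => h y z) (h' x z) x) {l : ℝ} (hl : 0 < l) (x : ℝ) :
    QQ ρ h x ≤ ofReal (2 * l) * NN ρ h + ofReal (1/l) * NN ρ h' := by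
  have hab : x ≤ x + 1/l := by have : 0 < 1/l := by positivity
                               linarith
  calc QQ ρ h x ≤ ∫⁻ z in Ioi (0:ℝ), (ofReal (2*l) * ofReal (ρ z * ∫ y in x..(x+1/l), h y z ^ 2)
        + ofReal (1/l) * ofReal (ρ z * ∫ y in x..(x+1/l), h' y z ^ 2)) := by
        apply lintegral_mono; intro z
        have p1 : 0 ≤ ∫ y in x..(x+1/l), h y z ^ 2 := intervalIntegral.integral_nonneg hab fun _ _ => by positivity
        have p2 : 0 ≤ ∫ y in x..(x+1/l), h' y z ^ 2 := intervalIntegral.integral_nonneg hab fun _ _ => by positivity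
        have := ρ0 z
        simp only
        rw [← ofReal_mul (by positivity), ← ofReal_mul (by positivity), ← ofReal_add (by positivity) (by positivity)]
        apply ofReal_le_ofReal
        have := mul_le_mul_of_nonneg_left (agmon_pt (fun y => hd y z) (ch'.sx z) hl x) (ρ0 z)
        linarith
    _ = ofReal (2*l) * (∫⁻ y in Ioc x (x+1/l), QQ ρ h y) + ofReal (1/l) * ∫⁻ y in Ioc x (x+1/l), QQ ρ h' y := by
        have cz : ∀ {k : ℝ → ℝ → ℝ}, C2 k → Measurable fun z => ofReal (ρ z * ∫ y in x..(x+1/l), k y z ^ 2) := by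
          intro k hk
          apply ENNReal.measurable_ofReal.comp
          apply Continuous.measurable
          apply cρ.mul
          apply intervalIntegral.continuous_parametric_intervalIntegral_of_continuous' (f := fun z y => k y z ^ 2)
          exact (hk.comp continuous_swap).pow 2
        rw [lintegral_add_left ((cz ch).const_mul _), lintegral_const_mul _ (cz ch), lintegral_const_mul _ (cz ch'),
          swap_box cρ ρ0 ch hab, swap_box cρ ρ0 ch' hab]
    _ ≤ _ := by
        gcongr <;> exact setLIntegral_le_lintegral _ _

theorem diffq {ρ : ℝ → ℝ} (cρ : Continuous ρ) (ρ0 : ∀ z, 0 ≤ ρ z) {h h' : ℝ → ℝ → ℝ} (ch' : C2 h')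
    (hd : ∀ x z, HasDerivAt (fun y => h y z) (h' x z) x) {l : ℝ} (hl : 0 < l) :
    NN ρ (fun x z => h (x + l) z - h x z) ≤ ofReal (l^2) * NN ρ h' := by
  have step : ∀ x, QQ ρ (fun x z => h (x + l) z - h x z) x ≤ ofReal l * ∫⁻ s in Ioc 0 l, QQ ρ h' (x + s) := by
    intro x
    have csh : C2 fun s z => h' (x + s) z := ch'.comp (by fun_prop : Continuous fun p : ℝ × ℝ => (x + p.1, p.2))
    have e := swap_box cρ ρ0 csh hl.le
    have e' : ∫⁻ s in Ioc 0 l, QQ ρ h' (x + s) = ∫⁻ s in Ioc 0 l, QQ ρ (fun s z => h' (x + s) z) s := rfl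
    rw [e', ← e, ← lintegral_const_mul' _ _ ofReal_ne_top]
    apply lintegral_mono; intro z
    simp only
    rw [← ofReal_mul hl.le]
    apply ofReal_le_ofReal
    have c1 : Continuous fun s => h' (x + s) z := csh.sx z
    have h1 : (∫ s in (0:ℝ)..l, h' (x + s) z) = h (x + l) z - h x z := by
      have := intervalIntegral.integral_eq_sub_of_hasDerivAt (a := 0) (b := l) (f := fun s => h (x + s) z) (f' := fun s => h' (x + s) z)
        (fun s _ => by simpa using (hd (x + s) z).comp_const_add x s) (c1.intervalIntegrable _ _)
      simpa using this
    have h2 := int_sq c1 hl.le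
    rw [h1] at h2
    nlinarith [mul_le_mul_of_nonneg_left h2 (ρ0 z)]
  unfold NN
  refine (lintegral_mono step).trans ?_
  rw [lintegral_const_mul' _ _ ofReal_ne_top, lintegral_lintegral_swap]
  · have : ∀ s, ∫⁻ x, QQ ρ h' (x + s) = ∫⁻ x, QQ ρ h' x := fun s => lintegral_add_right_eq_self (fun x => QQ ρ h' x) s
    simp_rw [this]
    rw [setLIntegral_const, Real.volume_Ioc, sub_zero, mul_comm (∫⁻ x, QQ ρ h' x), ← mul_assoc, ← ofReal_mul hl.le, pow_two]
  · exact ((ch'.mQ cρ).comp (measurable_fst.add measurable_snd)).aemeasurable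

def th (c z : ℝ) : ℝ := (1 - c * z^2)^3
def th1 (c z : ℝ) : ℝ := -6 * c * z * (1 - c * z^2)^2
def th2 (c z : ℝ) : ℝ := -6 * c * (1 - c * z^2)^2 + 24 * c^2 * z^2 * (1 - c * z^2)
def ph (c z : ℝ) : ℝ := (1 + z^2) * th c z
def ph1 (c z : ℝ) : ℝ := 2 * z * th c z + (1 + z^2) * th1 c z
def ph2 (c z : ℝ) : ℝ := 2 * th c z + 4 * z * th1 c z + (1 + z^2) * th2 c z

theorem th_d (c z : ℝ) : HasDerivAt (th c) (th1 c z) z := by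
  have := (((hasDerivAt_id z).pow 2).const_mul c).const_sub 1 |>.pow 3
  refine HasDerivAt.congr_deriv this ?_
  simp [th1]; ring
theorem th1_d (c z : ℝ) : HasDerivAt (th1 c) (th2 c z) z := by
  have := ((hasDerivAt_id z).const_mul (-6 * c)).mul ((((hasDerivAt_id z).pow 2).const_mul c).const_sub 1 |>.pow 2)
  refine HasDerivAt.congr_deriv this ?_
  simp [th2]; ring
theorem ph_d (c z : ℝ) : HasDerivAt (ph c) (ph1 c z) z := by
  have := (((hasDerivAt_id z).pow 2).const_add 1).mul (th_d c z)
  refine HasDerivAt.congr_deriv this ?_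
  simp [ph1]
theorem ph1_d (c z : ℝ) : HasDerivAt (ph1 c) (ph2 c z) z := by
  have := (((hasDerivAt_id z).const_mul 2).mul (th_d c z)).add ((((hasDerivAt_id z).pow 2).const_add 1).mul (th1_d c z))
  refine HasDerivAt.congr_deriv this ?_
  simp [ph2]; ring
@[fun_prop] theorem th_c (c : ℝ) : Continuous (th c) := by unfold th; fun_prop
@[fun_prop] theorem th1_c (c : ℝ) : Continuous (th1 c) := by unfold th1; fun_prop
@[fun_prop] theorem th2_c (c : ℝ) : Continuous (th2 c) := by unfold th2; fun_prop
@[fun_prop] theorem ph_c (c : ℝ) : Continuous (ph c) := by unfold ph; fun_prop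
@[fun_prop] theorem ph1_c (c : ℝ) : Continuous (ph1 c) := by unfold ph1; fun_prop
@[fun_prop] theorem ph2_c (c : ℝ) : Continuous (ph2 c) := by unfold ph2; fun_prop

theorem wt_bounds {c z : ℝ} (hc : 0 ≤ c) (hc1 : c ≤ 1) (hz : 0 ≤ z) (hy : c * z^2 ≤ 1) :
    (0 ≤ th c z ∧ th c z ≤ 1) ∧ (0 ≤ ph c z ∧ ph c z ≤ 1 + z^2) ∧ |th1 c z| ≤ 6 * c * z ∧ |th2 c z| ≤ 30 * c ∧
    |ph1 c z| ≤ 14 * z ∧ |ph2 c z| ≤ 86 ∧ |1/2 * ph2 c z - th c z| ≤ 27 * (c * (1 + z^2)) := by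
  set q := 1 - c * z^2 with hq
  have q0 : 0 ≤ q := by linarith
  have q1 : q ≤ 1 := by nlinarith [sq_nonneg z]
  have q2 : 0 ≤ q^2 := sq_nonneg q
  have q21 : q^2 ≤ 1 := by nlinarith
  have t0 : 0 ≤ th c z := by unfold th; rw [← hq]; positivity
  have t1 : th c z ≤ 1 := by unfold th; rw [← hq]; exact pow_le_one₀ q0 q1
  have a1 : |th1 c z| ≤ 6 * c * z := by
    unfold th1; rw [← hq, abs_mul, abs_of_nonneg q2]
    have : |-6 * c * z| = 6 * c * z := by rw [abs_of_nonpos] <;> nlinarith [mul_nonneg hc hz]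
    rw [this]; nlinarith [mul_nonneg hc hz]
  have yy : 0 ≤ c * z^2 := by positivity
  have a2 : |th2 c z| ≤ 30 * c := by
    unfold th2; rw [← hq, abs_le]
    have e1 : 0 ≤ c * (c * z^2 * q) := by positivity
    have e2 : c * (c * z^2 * q) ≤ c * 1 := by
      apply mul_le_mul_of_nonneg_left _ hc; nlinarith
    have e3 : 0 ≤ c * q^2 := by positivity
    have e4 : c * q^2 ≤ c * 1 := by
      apply mul_le_mul_of_nonneg_left _ hc; nlinarith
    constructor <;> nlinarith
  have b1 : c * (1 + z^2) ≤ 2 := by nlinarith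
  have b0 : 0 ≤ c * (1 + z^2) := by positivity
  have k1 : |(1 + z^2) * th1 c z| ≤ 12 * z := by
    rw [abs_mul, abs_of_nonneg (by positivity)]
    calc (1 + z^2) * |th1 c z| ≤ (1 + z^2) * (6 * c * z) := by gcongr
      _ = 6 * z * (c * (1 + z^2)) := by ring
      _ ≤ 6 * z * 2 := by gcongr
      _ = 12 * z := by ring
  have k2 : |(1 + z^2) * th2 c z| ≤ 30 * (c * (1 + z^2)) := by
    rw [abs_mul, abs_of_nonneg (by positivity)]
    calc (1 + z^2) * |th2 c z| ≤ (1 + z^2) * (30 * c) := by gcongr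
      _ = _ := by ring
  have k3 : |z * th1 c z| ≤ 6 * (c * z^2) := by
    rw [abs_mul, abs_of_nonneg hz]
    calc z * |th1 c z| ≤ z * (6 * c * z) := by gcongr
      _ = _ := by ring
  have k4 : |2 * z * th c z| ≤ 2 * z := by
    rw [abs_of_nonneg (by positivity)]; nlinarith
  refine ⟨⟨t0, t1⟩, ⟨by unfold ph; positivity, by unfold ph; nlinarith [sq_nonneg z]⟩, a1, a2, ?_, ?_, ?_⟩
  · unfold ph1; exact (abs_add_le _ _).trans (by linarith)
  · unfold ph2
    rw [abs_le] at k2 k3 ⊢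
    constructor <;> linarith
  · unfold ph2
    rw [abs_le] at k2 k3 ⊢
    constructor <;> linarith

def Rest2 (φ φ' φ'' θ θ' θ'' v vx vz vzz F Fz u w Ψ p pz pxz W : ℝ) : ℝ :=
  ((1/2*φ''-θ)*(vz^2+Fz^2)+1/2*θ''*(v^2+F^2)+vx*(φ''*Ψ*vz-φ'*u*vz+φ'*Ψ*vzz)-φ*vz*v*pxz+pz*(φ'*vz*W+φ*vzz*W-φ*vz*vx)+1/2*θ'*w*v^2+2*θ*v*vx*p-θ*v*W*pz)
def Bp2 (φ φ' φ'' θ θ' θ'' v vx vz vzz vzzz vxz F Fz Fzz u w wz Ψ pz pzz W Wz : ℝ) : ℝ :=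
  (φ'*vz*vzz+φ*vzz^2+φ*vz*vzzz -1/2*φ''*vz^2-φ'*vz*vzz + θ'*v*vz+θ*vz^2+θ*v*vzz -1/2*θ''*v^2-θ'*v*vz -φ'*vx*Fz-φ*vxz*Fz-φ*vx*Fzz -1/2*φ''*Fz^2-φ'*Fz*Fzz+θ'*F*Fz+θ*Fz^2+θ*F*Fzz-1/2*θ''*F^2-θ'*F*Fz-1/2*(φ'*w*vz^2+φ*wz*vz^2+2*φ*w*vz*vzz) -(φ''*Ψ*vz*vx -φ'*u*vz*vx+φ'*Ψ*vzz*vx+φ'*Ψ*vz*vxz) -(φ'*vz*W*pz+φ*vzz*W*pz+φ*vz*Wz*pz+φ*vz*W*pzz)-1/2*(θ'*w*v^2+θ*wz*v^2+2*θ*w*v*vz))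

theorem alg2 (φ φ' φ'' θ θ' θ'' v vx vz vzz vzzz vxz vt vtz F Fz Fzz Fx Fxz u u_x w wz Ψ p px pz pxz pzz W Wz : ℝ)
  (h1 : vt = vzz + Fx - (u * vx + w * vz + v * px + W * pz))
  (h2 : vtz = vzzz + Fxz - (u * vxz + w * vzz + v * pxz + W * pzz))
  (h3 : Fzz = - vx) (h4 : Wz = - vx) (h5 : wz = -u_x) :
  φ * vz * vtz + θ * v * vt + φ * (vzz^2 + vx^2)
  - (φ*(vxz*Fz + vz*Fxz)+θ*(vx*F+v*Fx)-1/2*φ*(u_x*vz^2+2*u*vz*vxz)+1/2*φ'*(w*vz^2+2*Ψ*vz*vxz)-1/2*θ*(u_x*v^2+2*u*v*vx)-θ*(2*v*vx*p+v^2*px))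
  = Bp2 φ φ' φ'' θ θ' θ'' v vx vz vzz vzzz vxz F Fz Fzz u w wz Ψ pz pzz W Wz
  + Rest2 φ φ' φ'' θ θ' θ'' v vx vz vzz F Fz u w Ψ p pz pxz W := by
  unfold Bp2 Rest2
  subst h1 h2 h3 h4 h5
  ring

theorem amg {t k X Y : ℝ} (hk : 0 ≤ k) (h : |t| ≤ k * (X * Y)) : t ≤ k / 2 * (X^2 + Y^2) := by
  have := (abs_le.1 h).2
  nlinarith [mul_nonneg hk (sq_nonneg (X - Y))]

theorem amga {t k X Y a δ : ℝ} (ha : 0 < a) (hk : 0 ≤ k) (h : |t| ≤ k * (X * (2 * δ) * Y)) : t ≤ k * (a * X^2 + Y^2 * δ^2 / a) := by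
  have := (abs_le.1 h).2
  refine this.trans ?_
  apply mul_le_mul_of_nonneg_left _ hk
  have e : a * X^2 + Y^2 * δ^2 / a - X * (2 * δ) * Y = (a * X - Y * δ)^2 / a := by field_simp; ring
  have : 0 ≤ (a * X - Y * δ)^2 / a := by positivity
  linarith

theorem abs4 {a b c d A B C D : ℝ} (h1 : |a| ≤ A) (h2 : |b| ≤ B) (h3 : |c| ≤ C) (h4 : |d| ≤ D) : |a*b*c*d| ≤ A*B*C*D := by
  rw [abs_mul, abs_mul, abs_mul]
  have := abs_nonneg a; have := abs_nonneg b; have := abs_nonneg c; have := abs_nonneg d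
  have := h1.trans' (abs_nonneg a)
  have := h2.trans' (abs_nonneg b)
  have := h3.trans' (abs_nonneg c)
  gcongr

def GG (z v vz F Fz w : ℝ) : ℝ := 27*(vz^2+Fz^2) + 20 * v^2 + 2 * (v^2 * (w^2/(1+z^2))) + 15 * (F^2/(1+z^2))
theorem GG0 (z v vz F Fz w : ℝ) : 0 ≤ GG z v vz F Fz w := by unfold GG; positivity

set_option maxHeartbeats 1000000 in
theorem rest_pt {c z : ℝ} (hc : 0 ≤ c) (hc1 : c ≤ 1) (hz : 0 ≤ z) (hy : c * z^2 ≤ 1)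
    {v vx vz vzz F Fz u w Ψ p pz pxz W a δ β : ℝ} (ha : 0 < a) (hδ : 0 ≤ δ) (hβ : 0 ≤ β)
    (bu : |u| ≤ 2 * a) (bp : |p| ≤ 2 * a) (bΨ : |Ψ| ≤ jz z * a) (bW : |W| ≤ 2 * δ) (bvz : |vz| ≤ 2 * β) :
    Rest2 (ph c z) (ph1 c z) (ph2 c z) (th c z) (th1 c z) (th2 c z) v vx vz vzz F Fz u w Ψ p pz pxz W ≤
    c * (1 + z^2) * GG z v vz F Fz w + (1 + z^2) * |vz * v * pxz| +
     a * (67 * ((1 + z^2) * vx^2) + 71 * vz^2 + 8 * ((1+z^2) * vzz^2) + 3 * (v^2/(1+z^2)))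
     + 16 * (δ^2 + β^2) / a * ((1+z^2) * pz^2) := by
  obtain ⟨⟨t0, t1⟩, ⟨p0, p1⟩, a1, a2, a3, a4, a5⟩ := wt_bounds hc hc1 hz hy
  have J := jz_pos z
  have J2 := jz_sq z
  rw [← J2] at a5 p1
  have zJ : z ≤ jz z := abs_le_of_sq_le_sq' (by linarith) J.le |>.2
  set Z := jz z
  have J1 : 1 ≤ Z := by by_contra! hh; nlinarith [sq_nonneg z]
  have Z0 : Z ≠ 0 := J.ne'
  set X1 := Z * |vx| with hX1
  set X2 := |vz| with hX2
  set X3 := Z * |vzz| with hX3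
  set X4 := |v| / Z with hX4
  set X5 := Z * |pz| with hX5
  have n1 : 0 ≤ X1 := by positivity
  have n2 : 0 ≤ X2 := by positivity
  have n3 : 0 ≤ X3 := by positivity
  have n4 : 0 ≤ X4 := by positivity
  have n5 : 0 ≤ X5 := by positivity
  have s1 : Z^2 * vx^2 = X1^2 := by rw [hX1, mul_pow, sq_abs]
  have s2 : vz^2 = X2^2 := by rw [hX2, sq_abs]
  have s3 : Z^2 * vzz^2 = X3^2 := by rw [hX3, mul_pow, sq_abs]
  have s4 : v^2 / Z^2 = X4^2 := by rw [hX4, div_pow, sq_abs]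
  have s5 : Z^2 * pz^2 = X5^2 := by rw [hX5, mul_pow, sq_abs]
  have av : |v| = X4 * Z := by rw [hX4]; field_simp
  have b3 : |ph1 c z| ≤ 14 * Z := a3.trans (by linarith)
  have pa : |ph c z| ≤ Z^2 := by rw [abs_of_nonneg p0]; exact p1
  have ta : |th c z| ≤ 1 := by rw [abs_of_nonneg t0]; exact t1
  have E1 : (1/2*ph2 c z-th c z)*(vz^2+Fz^2) ≤ c * Z^2 * (27 * (vz^2+Fz^2)) := by
    have := (abs_le.1 a5).2
    have h2 : 0 ≤ vz^2+Fz^2 := by positivity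
    have h9 := mul_le_mul_of_nonneg_right this h2
    linarith only [h9]
  have E2 : 1/2*th2 c z*(v^2+F^2) ≤ c * Z^2 * (15 * v^2 + 15 * (F^2/Z^2)) := by
    have h := (abs_le.1 a2).2
    have e : c * Z^2 * (15 * v^2 + 15 * (F^2/Z^2)) = 15 * (c * v^2) * Z^2 + 15 * (c * F^2) := by field_simp
    rw [e]
    have h2 : 0 ≤ v^2 + F^2 := by positivity
    have h8 : c * v^2 * 1 ≤ c * v^2 * Z^2 := by gcongr; rw [J2]; linarith only [sq_nonneg z]
    have h9 := mul_le_mul_of_nonneg_right h h2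
    linarith only [h8, h9]
  have E3 : 1/2*th1 c z*w*v^2 ≤ c * Z^2 * (5 * v^2 + 2 * (v^2 * (w^2/Z^2))) := by
    have h : |th1 c z * w| ≤ 6 * c * z * |w| := by rw [abs_mul]; gcongr
    have h' := (abs_le.1 h).2
    have e : c * Z^2 * (5 * v^2 + 2 * (v^2 * (w^2/Z^2))) = c * v^2 * (5 * Z^2 + 2 * |w|^2) := by
      rw [sq_abs]; field_simp
    rw [e]
    have h2 : z * |w| ≤ Z * |w| := by gcongr
    have : 3 * (z * |w|) ≤ 5 * Z^2 + 2 * |w|^2 := by linarith only [sq_nonneg (Z - |w|), sq_nonneg Z, sq_nonneg |w|, h2]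
    have : c * v^2 * (3 * (z * |w|)) ≤ c * v^2 * (5 * Z^2 + 2 * |w|^2) := by gcongr
    have h9 := mul_le_mul_of_nonneg_right h' (sq_nonneg v)
    linarith only [this, h9]
  have T4 : -(ph c z*vz*v*pxz) ≤ Z^2 * |vz * v * pxz| := by
    have : ph c z*vz*v*pxz = ph c z*(vz*v*pxz) := by ring
    rw [this]
    refine (neg_le_abs _).trans ?_
    rw [abs_mul]; gcongr
  have A1 : ph2 c z * Ψ * vz * vx ≤ (86 * a) / 2 * (X1^2 + X2^2) := by
    apply amg (by positivity)
    refine (abs4 a4 bΨ le_rfl le_rfl).trans (le_of_eq ?_); rw [hX1]; ring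
  have A2 : -(ph1 c z * u * vz * vx) ≤ (28 * a) / 2 * (X1^2 + X2^2) := by
    apply amg (by positivity)
    rw [abs_neg]
    refine (abs4 b3 bu le_rfl le_rfl).trans (le_of_eq ?_); rw [hX1]; ring
  have A3 : ph1 c z * Ψ * vzz * vx ≤ (14 * a) / 2 * (X1^2 + X3^2) := by
    apply amg (by positivity)
    refine (abs4 b3 bΨ le_rfl le_rfl).trans (le_of_eq ?_); rw [hX1, hX3]; ring
  have A4 : ph1 c z * vz * W * pz ≤ 14 * (a * X2^2 + X5^2 * δ^2 / a) := by
    apply amga ha (by positivity)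
    refine (abs4 b3 le_rfl bW le_rfl).trans (le_of_eq ?_); rw [hX5]; ring
  have A5 : ph c z * vzz * W * pz ≤ 1 * (a * X3^2 + X5^2 * δ^2 / a) := by
    apply amga ha (by positivity)
    refine (abs4 pa le_rfl bW le_rfl).trans (le_of_eq ?_); rw [hX5, hX3]; ring
  have A6 : -(ph c z * vx * vz * pz) ≤ 1 * (a * X1^2 + X5^2 * β^2 / a) := by
    apply amga ha (by positivity)
    rw [abs_neg]
    refine (abs4 pa le_rfl bvz le_rfl).trans (le_of_eq ?_); rw [hX5, hX1]; ring
  have A7 : th c z * v * vx * p ≤ (2 * a) / 2 * (X4^2 + X1^2) := by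
    apply amg (by positivity)
    refine (abs4 ta le_rfl le_rfl bp).trans (le_of_eq ?_); rw [av, hX1]; ring
  have A8 : -(th c z * v * W * pz) ≤ 1 * (a * X4^2 + X5^2 * δ^2 / a) := by
    apply amga ha (by positivity)
    rw [abs_neg]
    refine (abs4 ta le_rfl bW le_rfl).trans (le_of_eq ?_); rw [av, hX5]; ring
  have e9 : 16 * (δ^2 + β^2) / a * X5^2 = 16 * (X5^2 * δ^2 / a) + 16 * (X5^2 * β^2 / a) := by field_simp
  have p9 : 0 ≤ X5^2 * β^2 / a := by positivity
  have p10 : 0 ≤ a * X1^2 := by positivity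
  have p11 : 0 ≤ a * X2^2 := by positivity
  unfold Rest2 GG
  rw [← J2]
  rw [s1, s3, s4, s5, e9]
  rw [s2] at E1 ⊢
  linarith only [E1, E2, E3, T4, A1, A2, A3, A4, A5, A6, A7, A8, p9, p10, p11]

theorem th_S {S : ℝ} (hS : 0 < S) : th (1/S^2) S = 0 ∧ th1 (1/S^2) S = 0 := by
  have : 1 - 1/S^2 * S^2 = 0 := by field_simp; ring
  simp only [th, th1, this]; simp

theorem Bint {S : ℝ} (hS : 0 < S) {v vx vz vzz vzzz vxz F Fz Fzz u w wz Ψ pz pzz W Wz : ℝ → ℝ}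
    (dv : ∀ z, HasDerivAt v (vz z) z) (dvz : ∀ z, HasDerivAt vz (vzz z) z) (dvzz : ∀ z, HasDerivAt vzz (vzzz z) z)
    (dvx : ∀ z, HasDerivAt vx (vxz z) z) (dF : ∀ z, HasDerivAt F (Fz z) z) (dFz : ∀ z, HasDerivAt Fz (Fzz z) z)
    (dw : ∀ z, HasDerivAt w (wz z) z) (dΨ : ∀ z, HasDerivAt Ψ (-u z) z) (dpz : ∀ z, HasDerivAt pz (pzz z) z)
    (dW : ∀ z, HasDerivAt W (Wz z) z)
    (c1 : Continuous vzzz) (c2 : Continuous vxz) (c3 : Continuous Fzz) (c4 : Continuous wz) (c5 : Continuous u)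
    (c6 : Continuous pzz) (c7 : Continuous Wz)
    (v0 : v 0 = 0) (vx0 : vx 0 = 0) (vzz0 : vzz 0 = 0) (F0 : F 0 = 0) (w0 : w 0 = 0) (Ψ0 : Ψ 0 = 0) (W0 : W 0 = 0) :
    (∫ z in (0:ℝ)..S, Bp2 (ph (1/S^2) z) (ph1 (1/S^2) z) (ph2 (1/S^2) z) (th (1/S^2) z) (th1 (1/S^2) z) (th2 (1/S^2) z)
      (v z) (vx z) (vz z) (vzz z) (vzzz z) (vxz z) (F z) (Fz z) (Fzz z) (u z) (w z) (wz z) (Ψ z) (pz z) (pzz z) (W z) (Wz z)) = 0 := by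
  set c := 1/S^2 with hc
  have cc : ∀ {g g' : ℝ → ℝ}, (∀ z, HasDerivAt g (g' z) z) → Continuous g := fun h =>
    continuous_iff_continuousAt.2 fun z => (h z).continuousAt
  have k1 := cc dv
  have k2 := cc dvz
  have k3 := cc dvzz
  have k4 := cc dvx
  have k5 := cc dF
  have k6 := cc dFz
  have k7 := cc dw
  have k8 := cc dΨ
  have k9 := cc dpz
  have k10 := cc dW
  have key : ∀ z, HasDerivAt (fun z => ph c z * (vz z * vzz z) - 1/2 * (ph1 c z * vz z ^ 2) + th c z * (v z * vz z) - 1/2 * (th1 c z * v z ^ 2)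
      - ph c z * (vx z * Fz z) - 1/2 * (ph1 c z * Fz z ^ 2) + th c z * (F z * Fz z) - 1/2 * (th1 c z * F z ^ 2)
      - 1/2 * (ph c z * (w z * vz z ^ 2)) - ph1 c z * (Ψ z * (vz z * vx z)) - ph c z * (vz z * (W z * pz z)) - 1/2 * (th c z * (w z * v z ^ 2)))
      (Bp2 (ph c z) (ph1 c z) (ph2 c z) (th c z) (th1 c z) (th2 c z)
      (v z) (vx z) (vz z) (vzz z) (vzzz z) (vxz z) (F z) (Fz z) (Fzz z) (u z) (w z) (wz z) (Ψ z) (pz z) (pzz z) (W z) (Wz z)) z := by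
    intro z
    have P := ph_d c z
    have P1 := ph1_d c z
    have T := th_d c z
    have T1 := th1_d c z
    have := (P.mul ((dvz z).mul (dvzz z))).sub ((P1.mul ((dvz z).pow 2)).const_mul (1/2)) |>.add (T.mul ((dv z).mul (dvz z)))
      |>.sub ((T1.mul ((dv z).pow 2)).const_mul (1/2)) |>.sub (P.mul ((dvx z).mul (dFz z))) |>.sub ((P1.mul ((dFz z).pow 2)).const_mul (1/2))
      |>.add (T.mul ((dF z).mul (dFz z))) |>.sub ((T1.mul ((dF z).pow 2)).const_mul (1/2))
      |>.sub ((P.mul ((dw z).mul ((dvz z).pow 2))).const_mul (1/2)) |>.sub (P1.mul ((dΨ z).mul ((dvz z).mul (dvx z))))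
      |>.sub (P.mul ((dvz z).mul ((dW z).mul (dpz z)))) |>.sub ((T.mul ((dw z).mul ((dv z).pow 2))).const_mul (1/2))
    refine HasDerivAt.congr_deriv this ?_
    simp [Bp2]; ring
  have cB : Continuous fun z => (Bp2 (ph c z) (ph1 c z) (ph2 c z) (th c z) (th1 c z) (th2 c z)
      (v z) (vx z) (vz z) (vzz z) (vzzz z) (vxz z) (F z) (Fz z) (Fzz z) (u z) (w z) (wz z) (Ψ z) (pz z) (pzz z) (W z) (Wz z)) := by
    unfold Bp2; fun_prop
  rw [intervalIntegral.integral_eq_sub_of_hasDerivAt (fun z _ => key z) (cB.intervalIntegrable _ _)]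
  obtain ⟨t0, t1⟩ := th_S hS
  rw [← hc] at t0 t1
  have p0 : ph c S = 0 := by simp [ph, t0]
  have p1 : ph1 c S = 0 := by simp [ph1, t0, t1]
  have q1 : ph1 c 0 = 0 := by simp [ph1, th1]
  rw [t0, t1, p0, p1, q1, v0, vx0, vzz0, F0, w0, Ψ0, W0]; simp

def mS (S z : ℝ) : ENNReal := if z ≤ S then ofReal (1/S^2 * (1 + z^2)) else 0

theorem sup_abs {g g' : ℝ → ℝ} (hd : ∀ z, HasDerivAt g (g' z) z) (hc : Continuous g') (hs : FS g) {B : ℝ} (hB0 : 0 ≤ B)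
    (hB : (∫⁻ z in Ioi (0:ℝ), ofReal ((1+z^2) * g' z ^ 2)) ≤ ofReal (B^2)) {z : ℝ} (hz : 0 ≤ z) : |g z| ≤ 2 * B := by
  have := sup_bd hd hc hs ((Bd_iff (by fun_prop) (fun z _ => by positivity) (sq_nonneg B)).1 hB) hz
  apply abs_le_of_sq_le_sq _ (by positivity)
  nlinarith

theorem lint_mulc {r : ℝ} (hr : 0 ≤ r) (g : ℝ → ℝ) (μ : Measure ℝ) :
    ∫⁻ z, ofReal (r * g z) ∂μ = ofReal r * ∫⁻ z, ofReal (g z) ∂μ := by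
  simp_rw [ofReal_mul hr]
  exact lintegral_const_mul' _ _ ofReal_ne_top

theorem Rint {S : ℝ} (hS : 1 ≤ S) {v vx vz vzz F Fz u uz w Ψ p pz pxz W : ℝ → ℝ} {a : ℝ} (ha : 0 < a)
    (dv : ∀ z, HasDerivAt v (vz z) z) (dvz : ∀ z, HasDerivAt vz (vzz z) z)
    (du : ∀ z, HasDerivAt u (uz z) z) (dp : ∀ z, HasDerivAt p (pz z) z)
    (hΨ : ∀ z, Ψ z = - ∫ y in (0:ℝ)..z, u y) (hW : ∀ z ≥ 0, W z = - ∫ y in (0:ℝ)..z, vx y)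
    (c1 : Continuous vzz) (c2 : Continuous vx) (c3 : Continuous F) (c4 : Continuous Fz) (c5 : Continuous uz) (c6 : Continuous pz)
    (c7 : Continuous pxz) (c8 : Continuous W) (c9 : Continuous w)
    (v0 : v 0 = 0) (fu : FS u) (fp : FS p) (fvz : FS vz)
    (bu : (∫⁻ z in Ioi (0:ℝ), ofReal (u z ^ 2)) ≤ ofReal (a^2))
    (buz : (∫⁻ z in Ioi (0:ℝ), ofReal ((1+z^2) * uz z ^ 2)) ≤ ofReal (a^2))
    (bpz : (∫⁻ z in Ioi (0:ℝ), ofReal ((1+z^2) * pz z ^ 2)) ≤ ofReal (a^2)) :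
    ofReal (∫ z in (0:ℝ)..S, Rest2 (ph (1/S^2) z) (ph1 (1/S^2) z) (ph2 (1/S^2) z) (th (1/S^2) z) (th1 (1/S^2) z) (th2 (1/S^2) z)
      (v z) (vx z) (vz z) (vzz z) (F z) (Fz z) (u z) (w z) (Ψ z) (p z) (pz z) (pxz z) (W z)) ≤
    ofReal (600 * a) * ((∫⁻ z in Ioi (0:ℝ), ofReal ((1+z^2) * vx z ^ 2)) + (∫⁻ z in Ioi (0:ℝ), ofReal ((1+z^2) * vzz z ^ 2)))
    + (∫⁻ z in Ioi (0:ℝ), ofReal ((1+z^2) * |vz z * v z * pxz z|))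
    + ∫⁻ z in Ioi (0:ℝ), mS S z * ofReal (GG z (v z) (vz z) (F z) (Fz z) (w z)) := by
  have cc : ∀ {g g' : ℝ → ℝ}, (∀ z, HasDerivAt g (g' z) z) → Continuous g := fun h =>
    continuous_iff_continuousAt.2 fun z => (h z).continuousAt
  have k1 := cc dv
  have k2 := cc dvz
  have k3 := cc du
  have k4 := cc dp
  set Δ := ∫⁻ z in Ioi (0:ℝ), ofReal ((1+z^2) * vx z ^ 2) with hΔ
  set Β := ∫⁻ z in Ioi (0:ℝ), ofReal ((1+z^2) * vzz z ^ 2) with hΒ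
  have a0 : ofReal (600 * a) ≠ 0 := by simp [ha]
  by_cases hfin : Δ + Β = ⊤
  · rw [hfin, ENNReal.mul_top a0]; simp
  have fΔ : Δ ≠ ⊤ := fun h => hfin (by rw [h]; simp)
  have fΒ : Β ≠ ⊤ := fun h => hfin (by rw [h]; simp)
  set δ := Real.sqrt Δ.toReal with hδ
  set β := Real.sqrt Β.toReal with hβ
  have δ0 : 0 ≤ δ := Real.sqrt_nonneg _
  have β0 : 0 ≤ β := Real.sqrt_nonneg _
  have δ2 : ofReal (δ^2) = Δ := by rw [hδ, Real.sq_sqrt ENNReal.toReal_nonneg, ENNReal.ofReal_toReal fΔ]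
  have β2 : ofReal (β^2) = Β := by rw [hβ, Real.sq_sqrt ENNReal.toReal_nonneg, ENNReal.ofReal_toReal fΒ]
  have S0 : 0 < S := by linarith
  have bΨ : ∀ z ≥ 0, |Ψ z| ≤ jz z * a := by
    intro z hz
    have h1 := int_sq k3 hz
    have h2 := (Bd_iff (by fun_prop) (fun z _ => by positivity) (sq_nonneg a)).1 bu z hz
    apply abs_le_of_sq_le_sq _ (by have := jz_pos z; positivity)
    rw [hΨ, neg_sq, mul_pow, jz_sq]
    have : z ≤ 1 + z^2 := by nlinarith [sq_nonneg (z-1)]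
    calc _ ≤ z * a^2 := h1.trans (by gcongr)
      _ ≤ _ := by gcongr
  have bW : ∀ z ≥ 0, |W z| ≤ 2 * δ := by
    intro z hz
    rw [hW z hz, abs_neg]
    have hB := (Bd_iff (by fun_prop) (fun z _ => by positivity) (sq_nonneg δ)).1 (hΔ.symm.trans δ2.symm).le
    have h1 := int_abs_sq c2 le_rfl hz (bd_sub c2 hB le_rfl hz)
    have h2 : |∫ y in (0:ℝ)..z, vx y| ≤ ∫ y in (0:ℝ)..z, |vx y| := intervalIntegral.abs_integral_le_integral_abs hz
    have : (∫ y in (0:ℝ)..z, |vx y|) ≤ 2 * δ := by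
      apply le_of_sq_le_sq _ (by positivity)
      nlinarith
    linarith
  have bvz : ∀ z ≥ 0, |vz z| ≤ 2 * β := fun z hz => sup_abs dvz c1 fvz β0 (hΒ.symm.trans β2.symm).le hz
  have pt : ∀ z ∈ Ioc 0 S, ofReal (Rest2 (ph (1/S^2) z) (ph1 (1/S^2) z) (ph2 (1/S^2) z) (th (1/S^2) z) (th1 (1/S^2) z) (th2 (1/S^2) z)
      (v z) (vx z) (vz z) (vzz z) (F z) (Fz z) (u z) (w z) (Ψ z) (p z) (pz z) (pxz z) (W z)) ≤
      ((((((mS S z * ofReal (GG z (v z) (vz z) (F z) (Fz z) (w z)) + ofReal ((1+z^2) * |vz z * v z * pxz z|))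
      + ofReal ((67 * a) * ((1+z^2) * vx z ^ 2))) + ofReal ((71 * a) * (vz z ^ 2))) + ofReal ((8 * a) * ((1+z^2) * vzz z^2)))
      + ofReal ((3 * a) * (v z ^ 2 / (1+z^2)))) + ofReal ((16 * (δ^2+β^2) / a) * ((1+z^2) * pz z^2))) := by
    intro z hz
    have hz0 := hz.1.le
    have S2 : 1 ≤ S^2 := by nlinarith
    have := rest_pt (c := 1/S^2) (v := v z) (vx := vx z) (vz := vz z) (vzz := vzz z) (F := F z) (Fz := Fz z) (u := u z) (w := w z)
      (Ψ := Ψ z) (p := p z) (pz := pz z) (pxz := pxz z) (W := W z) (by positivity) (by rw [div_le_one (by positivity)]; exact S2) hz0 (by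
        rw [div_mul_eq_mul_div, one_mul, div_le_one (by positivity)]; nlinarith [hz.2]) ha δ0 β0 (sup_abs du c5 fu ha.le buz hz0)
        (sup_abs dp c6 fp ha.le bpz hz0) (bΨ z hz0) (bW z hz0) (bvz z hz0)
    refine (ofReal_le_ofReal this).trans ?_
    have G0 := GG0 z (v z) (vz z) (F z) (Fz z) (w z)
    rw [mS, if_pos hz.2, ← ofReal_mul (by positivity)]
    iterate 6 rw [← ofReal_add (by positivity) (by positivity)]
    exact ofReal_le_ofReal (by linarith)
  refine (ofReal_ii_le S0.le _).trans ((setLIntegral_mono_ae' measurableSet_Ioc (Eventually.of_forall pt)).trans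
    ((lintegral_mono_set (Ioc_subset_Ioi_self)).trans ?_))
  have M : ∀ {g : ℝ → ℝ}, Continuous g → Measurable fun z => ofReal (g z) := fun h => ENNReal.measurable_ofReal.comp h.measurable
  have cv : Continuous fun z => v z ^ 2 / (1 + z^2) := inv_sq_cont k1
  rw [lintegral_add_right _ (M (by fun_prop)), lintegral_add_right _ (M (cv.const_mul _)), lintegral_add_right _ (M (by fun_prop)), lintegral_add_right _ (M (by fun_prop)),
    lintegral_add_right _ (M (by fun_prop)), lintegral_add_right _ (M (by fun_prop))]
  rw [lint_mulc (by positivity), lint_mulc (by positivity), lint_mulc (by positivity), lint_mulc (by positivity), lint_mulc (by positivity), ← hΔ, ← hΒ]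
  have H1 := hardyB_E dvz c1 fvz
  have H2 := hardyA_E dv k2 v0
  rw [← hΒ] at H1
  have H3 : (∫⁻ z in Ioi (0:ℝ), ofReal (v z ^ 2 / (1 + z^2))) ≤ 48 * Β := by
    refine H2.trans ((mul_le_mul_right H1 8).trans (le_of_eq ?_)); ring
  have H4 : ofReal (16 * (δ^2+β^2) / a) * (∫⁻ z in Ioi (0:ℝ), ofReal ((1+z^2) * pz z ^ 2)) ≤ ofReal (16 * a) * (Δ + Β) := by
    refine (mul_le_mul_right bpz _).trans (le_of_eq ?_)
    rw [← δ2, ← β2, ← ofReal_add (by positivity) (by positivity), ← ofReal_mul (by positivity), ← ofReal_mul (by positivity)]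
    congr 1; field_simp
  set I1 := ∫⁻ z in Ioi (0:ℝ), mS S z * ofReal (GG z (v z) (vz z) (F z) (Fz z) (w z))
  set I2 := ∫⁻ z in Ioi (0:ℝ), ofReal ((1+z^2) * |vz z * v z * pxz z|)
  set A := ofReal a
  have eA : ∀ k : ℝ, 0 ≤ k → ofReal (k * a) = ofReal k * A := fun k hk => ofReal_mul hk
  rw [eA _ (by norm_num)] at H4
  rw [eA _ (by norm_num), eA _ (by norm_num), eA _ (by norm_num), eA _ (by norm_num), eA _ (by norm_num)]
  calc _ ≤ I1 + I2 + ofReal 67 * A * Δ + ofReal 71 * A * (6 * Β) + ofReal 8 * A * Β + ofReal 3 * A * (48 * Β)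
        + ofReal 16 * A * (Δ + Β) := by gcongr
    _ = I1 + I2 + (83 * (A * Δ) + 594 * (A * Β)) := by
        simp only [ENNReal.ofReal_ofNat]; ring
    _ ≤ I1 + I2 + (600 * (A * Δ) + 600 * (A * Β)) := by gcongr <;> norm_num
    _ = _ := by simp only [ENNReal.ofReal_ofNat]; ring

theorem dx_sub {g h} (a : Sm g) (b : Sm h) (t x z : ℝ) : dx (fun t x z => g t x z - h t x z) t x z = dx g t x z - dx h t x z :=
  ((a.Hx t x z).sub (b.Hx t x z)).deriv
theorem dz_sub {g h} (a : Sm g) (b : Sm h) (t x z : ℝ) : dz (fun t x z => g t x z - h t x z) t x z = dz g t x z - dz h t x z :=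
  ((a.Hz t x z).sub (b.Hz t x z)).deriv
theorem dt_sub {g h} (a : Sm g) (b : Sm h) (t x z : ℝ) : pdt (fun t x z => g t x z - h t x z) t x z = pdt g t x z - pdt h t x z :=
  ((a.Ht t x z).sub (b.Ht t x z)).deriv
theorem dx_subF {g h} (a : Sm g) (b : Sm h) : dx (fun t x z => g t x z - h t x z) = fun t x z => dx g t x z - dx h t x z := by
  funext t x z; exact dx_sub a b t x z
theorem dz_subF {g h} (a : Sm g) (b : Sm h) : dz (fun t x z => g t x z - h t x z) = fun t x z => dz g t x z - dz h t x z := by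
  funext t x z; exact dz_sub a b t x z

structure Pair (v W F u w p : ℝ → ℝ → ℝ → ℝ) : Prop where
  sv : Sm v
  sW : Sm W
  sF : Sm F
  su : Sm u
  sw : Sm w
  sp : Sm p
  vt : ∀ t ≥ 0, ∀ x, ∀ z ≥ 0, pdt v t x z = dz (dz v) t x z + dx F t x z
      - (u t x z * dx v t x z + w t x z * dz v t x z + v t x z * dx p t x z + W t x z * dz p t x z)
  vtz : ∀ t ≥ 0, ∀ x, ∀ z ≥ 0, pdt (dz v) t x z = dz (dz (dz v)) t x z + dx (dz F) t x z
      - (u t x z * dx (dz v) t x z + w t x z * dz (dz v) t x z + v t x z * dx (dz p) t x z + W t x z * dz (dz p) t x z)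
  Fzz : ∀ t ≥ 0, ∀ x, ∀ z ≥ 0, dz (dz F) t x z = - dx v t x z
  Wz : ∀ t ≥ 0, ∀ x, ∀ z ≥ 0, dz W t x z = - dx v t x z
  wz : ∀ t ≥ 0, ∀ x, ∀ z ≥ 0, dz w t x z = - dx u t x z
  v0 : ∀ t ≥ 0, ∀ x, v t x 0 = 0
  W0 : ∀ t ≥ 0, ∀ x, W t x 0 = 0
  w0 : ∀ t ≥ 0, ∀ x, w t x 0 = 0
  F0 : ∀ t ≥ 0, ∀ x, F t x 0 = 0
  vx0 : ∀ t ≥ 0, ∀ x, dx v t x 0 = 0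
  vzz0 : ∀ t ≥ 0, ∀ x, dz (dz v) t x 0 = 0
  lv : ∀ t ≥ 0, ∀ x, Tendsto (fun z => v t x z) atTop (nhds 0)
  lu : ∀ t ≥ 0, ∀ x, Tendsto (fun z => u t x z) atTop (nhds 0)
  lp : ∀ t ≥ 0, ∀ x, Tendsto (fun z => p t x z) atTop (nhds 0)
  lF : ∀ t ≥ 0, ∀ x, Tendsto (fun z => F t x z) atTop (nhds 0)

theorem mkPair {u w f p q g} (A : Sol u w f) (B : Sol p q g) :
    Pair (fun t x z => u t x z - p t x z) (fun t x z => w t x z - q t x z) (fun t x z => f t x z - g t x z) u w p where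
  sv := A.su.sub B.su
  sW := A.sw.sub B.sw
  sF := A.sf.sub B.sf
  su := A.su
  sw := A.sw
  sp := B.su
  vt t ht x z hz := by
    rw [dz_subF A.su B.su, dz_sub A.su.dz B.su.dz, dx_sub A.sf B.sf, dt_sub A.su B.su, dx_sub A.su B.su, A.ut t ht x z hz, B.ut t ht x z hz]; ring
  vtz t ht x z hz := by
    rw [dz_subF A.su B.su, dt_sub A.su.dz B.su.dz, dx_sub A.su.dz B.su.dz, dz_subF A.su.dz B.su.dz, dz_sub A.su.dz.dz B.su.dz.dz,
     dz_subF A.sf B.sf, dx_sub A.sf.dz B.sf.dz, A.utz t ht x z hz, B.utz t ht x z hz]; ring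
  Fzz t ht x z hz := by
    rw [dz_subF A.sf B.sf, dz_sub A.sf.dz B.sf.dz, dx_sub A.su B.su, A.fzz t ht x z hz, B.fzz t ht x z hz]; ring
  Wz t ht x z hz := by
    rw [dz_sub A.sw B.sw, dx_sub A.su B.su, A.wz t ht x z hz, B.wz t ht x z hz]; ring
  wz := A.wz
  v0 t ht x := by simp [A.u0 t ht x, B.u0 t ht x]
  W0 t ht x := by simp [A.w0 t ht x, B.w0 t ht x]
  w0 := A.w0
  F0 t ht x := by simp [A.f0 t ht x, B.f0 t ht x]
  vx0 t ht x := by rw [dx_sub A.su B.su, A.ux0 t ht x, B.ux0 t ht x]; simp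
  vzz0 t ht x := by rw [dz_subF A.su B.su, dz_sub A.su.dz B.su.dz, A.uzz0 t ht x, B.uzz0 t ht x]; simp
  lv t ht x := by simpa using (A.lu t ht x).sub (B.lu t ht x)
  lu := A.lu
  lp := B.lu
  lF t ht x := by simpa using (A.lf t ht x).sub (B.lf t ht x)

theorem cii {g : ℝ → ℝ → ℝ → ℝ} (h : Continuous (unc g)) (a b : ℝ) :
    Continuous (Function.uncurry fun t x => ∫ z in a..b, g t x z) :=
  intervalIntegral.continuous_parametric_intervalIntegral_of_continuous' (f := fun (q : ℝ × ℝ) z => g q.1 q.2 z) (μ := volume)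
    (h.comp (by fun_prop : Continuous fun p : (ℝ × ℝ) × ℝ => (p.1.1, p.1.2, p.2))) a b

def Pr (u : ℝ → ℝ → ℝ → ℝ) : ℝ → ℝ → ℝ → ℝ := fun t x z => - ∫ y in (0:ℝ)..z, u t x y
theorem Pr_c {u} (h : Sm u) : Continuous (unc (Pr u)) := by
  apply Continuous.neg
  exact intervalIntegral.continuous_parametric_intervalIntegral_of_continuous (f := fun (q : ℝ × ℝ × ℝ) z => u q.1 q.2.1 z) (μ := volume)
    (h.cont.comp (by fun_prop : Continuous fun p : (ℝ × ℝ × ℝ) × ℝ => (p.1.1, p.1.2.1, p.2))) (by fun_prop)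
theorem Pr_x {u} (h : Sm u) (t x z : ℝ) : HasDerivAt (fun y => Pr u t y z) (Pr (dx u) t x z) x :=
  (hasDeriv_ii (h.cxz t) (h.dx.cxz t) 0 z (fun y z => h.Hx t y z) x).neg
theorem Pr_z {u} (h : Sm u) (t x z : ℝ) : HasDerivAt (fun y => Pr u t x y) (-u t x z) z :=
  (intervalIntegral.integral_hasDerivAt_right ((h.c1 t x).intervalIntegrable _ _)
    ((h.c1 t x).stronglyMeasurableAtFilter _ _) (h.c1 t x).continuousAt).neg
theorem prim_eq {W v : ℝ → ℝ → ℝ → ℝ} (sW : Sm W) (sv : Sm v) {t x : ℝ} (h : ∀ z ≥ 0, dz W t x z = - v t x z) (h0 : W t x 0 = 0)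
    {z : ℝ} (hz : 0 ≤ z) : W t x z = Pr v t x z := by
  have := intervalIntegral.integral_eq_sub_of_hasDerivAt (a := 0) (b := z) (fun y _ => sW.Hz t x y) ((sW.dz.c1 t x).intervalIntegrable _ _)
  rw [h0, sub_zero] at this
  rw [← this, Pr, ← intervalIntegral.integral_neg]
  apply intervalIntegral.integral_congr
  intro y hy
  rw [uIcc_of_le hz] at hy
  exact h y hy.1

def KK (S z : ℝ) : ENNReal := if z ≤ S then ofReal (th (1/S^2) z) else 0

theorem th_KK {S : ℝ} (hS : 1 ≤ S) {h : ℝ → ℝ} (hc : Continuous h) (h0 : ∀ z, 0 ≤ h z) :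
    ofReal (∫ z in (0:ℝ)..S, th (1/S^2) z * h z) = ∫⁻ z in Ioi (0:ℝ), KK S z * ofReal (h z) := by
  have S0 : 0 < S := by linarith
  have tp : ∀ z ∈ Icc 0 S, 0 ≤ th (1/S^2) z := by
    intro z hz
    have : 1/S^2 * z^2 ≤ 1 := by rw [div_mul_eq_mul_div, one_mul, div_le_one (by positivity)]; nlinarith [hz.2, hz.1]
    unfold th; apply pow_nonneg; linarith
  rw [ofReal_ii_eq S0.le (by fun_prop) (fun z hz => mul_nonneg (tp z hz) (h0 z))]
  have : Ioc 0 S = Iic S ∩ Ioi 0 := by ext z; simp [and_comm]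
  rw [this, ← Measure.restrict_restrict measurableSet_Iic, ← lintegral_indicator measurableSet_Iic]
  apply setLIntegral_congr_fun measurableSet_Ioi
  intro z hz
  simp only [indicator, KK, mem_Iic]
  split_ifs with h
  · rw [ofReal_mul (tp z ⟨le_of_lt hz, h⟩)]
  · simp

def Err (p v : ℝ → ℝ → ℝ → ℝ) (t x : ℝ) : ENNReal :=
  ∫⁻ z in Ioi (0:ℝ), ofReal ((1+z^2) * |dz v t x z * v t x z * dx (dz p) t x z|)
def GGf (v F w : ℝ → ℝ → ℝ → ℝ) : ℝ → ℝ → ℝ → ℝ := fun t x z => GG z (v t x z) (dz v t x z) (F t x z) (dz F t x z) (w t x z)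
theorem GGf_c {v F w} (sv : Sm v) (sF : Sm F) (sw : Sm w) : Continuous (unc (GGf v F w)) := by
  unfold GGf GG unc
  have := sv.c3; have := sv.dz.c3; have := sF.c3; have := sF.dz.c3; have := sw.c3
  have : ∀ q : ℝ × ℝ × ℝ, 1 + q.2.2^2 ≠ 0 := fun q => by positivity
  fun_prop (disch := assumption)

set_option maxHeartbeats 1000000 in
theorem flux_pt {c z S : ℝ} (hc : 0 ≤ c) (hc1 : c ≤ 1) (hz : 0 ≤ z) (hzS : z ≤ S) (hy : c * z^2 ≤ 1)
    {v vz F Fz u w Ψ p a : ℝ} (ha : 0 < a)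
    (bu : |u| ≤ 2 * a) (bp : |p| ≤ 2 * a) (bΨ : |Ψ| ≤ jz z * a) :
    |ph c z * (vz * Fz) + th c z * (v * F) - 1/2 * (ph c z * (u * vz^2)) + 1/2 * (ph1 c z * (Ψ * vz^2)) - 1/2 * (th c z * (u * v^2)) - th c z * (v^2 * p)|
    ≤ (1 + S^2) * (1 + 8 * a) * GG z v vz F Fz w := by
  obtain ⟨⟨t0, t1⟩, ⟨p0, p1⟩, a1, a2, a3, a4, a5⟩ := wt_bounds hc hc1 hz hy
  have J := jz_pos z
  have J2 := jz_sq z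
  have zJ : z ≤ jz z := abs_le_of_sq_le_sq' (by linarith) J.le |>.2
  have hS2 : 1 + z^2 ≤ 1 + S^2 := by nlinarith
  have hR : 1 ≤ 1 + z^2 := by nlinarith
  have eF : F^2 = (1+z^2) * (F^2/(1+z^2)) := by field_simp
  set R := 1 + S^2
  set FF := F^2/(1+z^2) with hFF
  have FF0 : 0 ≤ FF := by positivity
  have R1 : 1 ≤ R := hR.trans hS2
  have q1 : |ph c z * (vz * Fz)| ≤ R * (vz^2 + Fz^2) := by
    rw [abs_mul, abs_of_nonneg p0]
    have : |vz * Fz| ≤ vz^2 + Fz^2 := by rw [abs_le]; constructor <;> linarith only [sq_nonneg (vz+Fz), sq_nonneg (vz-Fz), sq_nonneg vz, sq_nonneg Fz]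
    gcongr; linarith
  have q2 : |th c z * (v * F)| ≤ R * (v^2 + FF) := by
    rw [abs_mul, abs_of_nonneg t0]
    have h1 : |v * F| ≤ v^2 + F^2 := by rw [abs_le]; constructor <;> linarith only [sq_nonneg (v+F), sq_nonneg (v-F), sq_nonneg v, sq_nonneg F]
    have h2 : v^2 ≤ R * v^2 := le_mul_of_one_le_left (sq_nonneg v) R1
    have h3 : F^2 ≤ R * FF := by rw [eF]; gcongr
    have h4 : th c z * |v * F| ≤ 1 * |v * F| := by gcongr
    linarith
  have q3 : |ph c z * (u * vz^2)| ≤ R * (2 * a * vz^2) := by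
    rw [abs_mul, abs_of_nonneg p0, abs_mul, abs_of_nonneg (sq_nonneg vz)]
    gcongr; linarith
  have q4 : |ph1 c z * (Ψ * vz^2)| ≤ R * (14 * a * vz^2) := by
    rw [abs_mul, abs_mul, abs_of_nonneg (sq_nonneg vz)]
    calc |ph1 c z| * (|Ψ| * vz^2) ≤ (14 * jz z) * (jz z * a * vz^2) := by
          gcongr; exact a3.trans (by linarith)
      _ = jz z ^ 2 * (14 * a * vz^2) := by ring
      _ ≤ _ := by rw [J2]; gcongr
  have q5 : |th c z * (u * v^2)| ≤ R * (2 * a * v^2) := by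
    rw [abs_mul, abs_of_nonneg t0, abs_mul, abs_of_nonneg (sq_nonneg v)]
    gcongr; linarith
  have q6 : |th c z * (v^2 * p)| ≤ R * (2 * a * v^2) := by
    rw [mul_comm (v^2), abs_mul, abs_of_nonneg t0, abs_mul, abs_of_nonneg (sq_nonneg v)]
    gcongr; linarith
  have e : R * (1 + 8 * a) * GG z v vz F Fz w = R * (GG z v vz F Fz w) + 8 * (R * (a * GG z v vz F Fz w)) := by ring
  rw [e]
  have g1 : vz^2 + Fz^2 + v^2 + FF ≤ GG z v vz F Fz w := by
    have h : 0 ≤ v^2 * (w^2/(1+z^2)) := by positivity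
    unfold GG; rw [← hFF]; linarith only [sq_nonneg v, sq_nonneg vz, sq_nonneg Fz, h, FF0]
  have g2 : vz^2 + v^2 ≤ GG z v vz F Fz w := by linarith only [sq_nonneg Fz, FF0, g1]
  have g3 : R * (vz^2 + Fz^2 + v^2 + FF) ≤ R * GG z v vz F Fz w := by gcongr
  have g4 : R * (a * (vz^2 + v^2)) ≤ R * (a * GG z v vz F Fz w) := by gcongr
  rw [abs_le] at *
  have n1 : 0 ≤ R * (a * vz^2) := by positivity
  have n2 : 0 ≤ R * (a * v^2) := by positivity
  constructor <;> linarith only [q1, q2, q3, q4, q5, q6, g3, g4, n1, n2]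

theorem QQ0 (h : ℝ → ℝ → ℝ) (x : ℝ) : QQ r0 h x = ∫⁻ z in Ioi (0:ℝ), ofReal (h x z ^ 2) := by
  unfold QQ r0; simp
theorem QQ2 (h : ℝ → ℝ → ℝ) (x : ℝ) : QQ r2 h x = ∫⁻ z in Ioi (0:ℝ), ofReal ((1+z^2) * h x z ^ 2) := rfl

def D0 (v : ℝ → ℝ → ℝ → ℝ) (t : ℝ) : ENNReal := NN r2 (dx v t) + NN r2 (dz (dz v) t)
def E0 (v : ℝ → ℝ → ℝ → ℝ) (t : ℝ) : ENNReal := NN r0 (v t) + NN r2 (dz v t)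

def gS (a S : ℝ) (v F w p : ℝ → ℝ → ℝ → ℝ) (t x : ℝ) : ENNReal :=
  ofReal (600 * a) * (QQ r2 (dx v t) x + QQ r2 (dz (dz v) t) x) + Err p v t x
    + ∫⁻ z in Ioi (0:ℝ), mS S z * ofReal (GGf v F w t x z)

theorem slice_main {v W F u w p : ℝ → ℝ → ℝ → ℝ} (P : Pair v W F u w p) {S : ℝ} (hS : 1 ≤ S) {a : ℝ} (ha : 0 < a) {t : ℝ} (ht : 0 ≤ t) (x : ℝ)
    (bu : QQ r0 (u t) x ≤ ofReal (a^2)) (buz : QQ r2 (dz u t) x ≤ ofReal (a^2)) (bpz : QQ r2 (dz p t) x ≤ ofReal (a^2)) :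
    ofReal ((∫ z in (0:ℝ)..S, (ph (1/S^2) z * (dz v t x z * pdt (dz v) t x z) + th (1/S^2) z * (v t x z * pdt v t x z)))
      + (∫ z in (0:ℝ)..S, th (1/S^2) z * ((1 + z^2) * (dz (dz v) t x z ^ 2 + dx v t x z ^ 2)))
      - ∫ z in (0:ℝ)..S, (ph (1/S^2) z * (dx (dz v) t x z * dz F t x z + dz v t x z * dx (dz F) t x z)
          + th (1/S^2) z * (dx v t x z * F t x z + v t x z * dx F t x z)
          - 1/2 * (ph (1/S^2) z * (dx u t x z * dz v t x z ^ 2 + u t x z * (2 * dz v t x z * dx (dz v) t x z)))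
          + 1/2 * (ph1 (1/S^2) z * (Pr (dx u) t x z * dz v t x z ^ 2 + Pr u t x z * (2 * dz v t x z * dx (dz v) t x z)))
          - 1/2 * (th (1/S^2) z * (dx u t x z * v t x z ^ 2 + u t x z * (2 * v t x z * dx v t x z)))
          - th (1/S^2) z * (2 * v t x z * dx v t x z * p t x z + v t x z ^ 2 * dx p t x z))) ≤ gS a S v F w p t x := by
  set c := 1/S^2 with hc
  have S0 : 0 < S := by linarith
  have e0 := P.sv.xz
  have k1 := P.sv.c1 t x
  have k2 := P.sv.dz.c1 t x
  have k3 := P.sv.dz.dz.c1 t x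
  have k4 := P.sv.dz.dz.dz.c1 t x
  have k5 := P.sv.dx.c1 t x
  have k6 := P.sv.dz.dx.c1 t x
  have k7 := P.sF.c1 t x
  have k8 := P.sF.dz.c1 t x
  have k9 := P.sF.dz.dz.c1 t x
  have k10 := P.sF.dz.dx.c1 t x
  have k11 := P.sF.dx.c1 t x
  have k12 := P.su.c1 t x
  have k13 := P.su.dx.c1 t x
  have k14 := P.sp.c1 t x
  have k15 := P.sp.dz.c1 t x
  have k16 := P.sp.dz.dz.c1 t x
  have k17 := P.sp.dx.c1 t x
  have k18 := P.sp.dz.dx.c1 t x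
  have k19 := P.sv.dt.c1 t x
  have k20 := P.sv.dz.dt.c1 t x
  have k21 := P.sw.c1 t x
  have k22 := P.sw.dz.c1 t x
  have k23 := P.sW.c1 t x
  have k24 := P.sW.dz.c1 t x
  have k25 : Continuous fun z => Pr u t x z := (Pr_c P.su).comp (by fun_prop : Continuous fun z : ℝ => (t, x, z))
  have k26 : Continuous fun z => Pr (dx u) t x z := (Pr_c P.su.dx).comp (by fun_prop : Continuous fun z : ℝ => (t, x, z))
  have FSv := FS_deriv (fun z => P.sv.Hz t x z) (P.lv t ht x)
  rw [← intervalIntegral.integral_add (Continuous.intervalIntegrable (by fun_prop) _ _) (Continuous.intervalIntegrable (by fun_prop) _ _),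
    ← intervalIntegral.integral_sub (Continuous.intervalIntegrable (by fun_prop) _ _) (Continuous.intervalIntegrable (by fun_prop) _ _)]
  have cR : Continuous fun z => Rest2 (ph c z) (ph1 c z) (ph2 c z) (th c z) (th1 c z) (th2 c z)
      (v t x z) (dx v t x z) (dz v t x z) (dz (dz v) t x z) (F t x z) (dz F t x z) (u t x z) (w t x z) (Pr u t x z) (p t x z) (dz p t x z) (dx (dz p) t x z) (W t x z) := by
    unfold Rest2; fun_prop
  have cB : Continuous fun z => Bp2 (ph c z) (ph1 c z) (ph2 c z) (th c z) (th1 c z) (th2 c z)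
      (v t x z) (dx v t x z) (dz v t x z) (dz (dz v) t x z) (dz (dz (dz v)) t x z) (dx (dz v) t x z) (F t x z) (dz F t x z) (dz (dz F) t x z) (u t x z) (w t x z)
      (dz w t x z) (Pr u t x z) (dz p t x z) (dz (dz p) t x z) (W t x z) (dz W t x z) := by
    unfold Bp2; fun_prop
  have B0 := Bint S0 (fun z => P.sv.Hz t x z) (fun z => P.sv.dz.Hz t x z) (fun z => P.sv.dz.dz.Hz t x z) (vx := dx v t x) (vxz := dx (dz v) t x)
    (fun z => by rw [e0]; exact P.sv.dx.Hz t x z) (fun z => P.sF.Hz t x z) (fun z => P.sF.dz.Hz t x z)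
    (fun z => P.sw.Hz t x z) (fun z => Pr_z P.su t x z) (fun z => P.sp.dz.Hz t x z) (fun z => P.sW.Hz t x z) k4 k6 k9 k22 k12 k16 k24
    (P.v0 t ht x) (P.vx0 t ht x) (P.vzz0 t ht x) (P.F0 t ht x) (P.w0 t ht x) (by simp [Pr]) (P.W0 t ht x)
  have R0 := Rint hS ha (fun z => P.sv.Hz t x z) (fun z => P.sv.dz.Hz t x z) (fun z => P.su.Hz t x z) (fun z => P.sp.Hz t x z)
    (Ψ := Pr u t x) (W := W t x) (vx := dx v t x) (w := w t x) (F := F t x) (Fz := dz F t x) (pxz := dx (dz p) t x) (fun z => rfl) (fun z hz => prim_eq P.sW P.sv.dx (P.Wz t ht x) (P.W0 t ht x) hz) k3 k5 k7 k8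
    (P.su.dz.c1 t x) k15 k18 k23 k21 (P.v0 t ht x) (FS_of_tendsto (P.lu t ht x)) (FS_of_tendsto (P.lp t ht x))
    FSv (by rw [← QQ0]; exact bu) buz bpz
  refine le_trans (le_of_eq ?_) R0
  congr 1
  rw [← hc] at B0
  have key := intervalIntegral.integral_add (cB.intervalIntegrable (μ := volume) 0 S) (cR.intervalIntegrable 0 S)
  rw [B0, zero_add] at key
  refine Eq.trans ?_ key
  apply intervalIntegral.integral_congr
  intro z hz
  rw [uIcc_of_le S0.le] at hz
  have := alg2 (ph c z) (ph1 c z) (ph2 c z) (th c z) (th1 c z) (th2 c z)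
      (v t x z) (dx v t x z) (dz v t x z) (dz (dz v) t x z) (dz (dz (dz v)) t x z) (dx (dz v) t x z) (pdt v t x z) (pdt (dz v) t x z)
      (F t x z) (dz F t x z) (dz (dz F) t x z) (dx F t x z) (dx (dz F) t x z) (u t x z) (dx u t x z) (w t x z)
      (dz w t x z) (Pr u t x z) (p t x z) (dx p t x z) (dz p t x z) (dx (dz p) t x z) (dz (dz p) t x z) (W t x z) (dz W t x z)
      (P.vt t ht x z hz.1) (P.vtz t ht x z hz.1) (P.Fzz t ht x z hz.1) (P.Wz t ht x z hz.1) (P.wz t ht x z hz.1)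
  simp only
  rw [← this, ← prim_eq P.sw P.su.dx (P.wz t ht x) (P.w0 t ht x) hz.1]
  simp only [ph]; ring

theorem GG_fin {v W F u w p : ℝ → ℝ → ℝ → ℝ} (P : Pair v W F u w p) {t : ℝ} (ht : 0 ≤ t) (x : ℝ) :
    ∫⁻ z in Ioi (0:ℝ), ofReal (GGf v F w t x z) ≤
      900 * (QQ r2 (dx v t) x + QQ r2 (dz (dz v) t) x) + 20 * QQ r0 (v t) x + 2 * (QQ r0 (v t) x * QQ r0 (dx u t) x) := by
  have k1 := P.sv.c1 t x
  have k2 := P.sv.dz.c1 t x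
  have k7 := P.sF.c1 t x
  have k8 := P.sF.dz.c1 t x
  have H1 := hardyB_E (fun z => P.sv.dz.Hz t x z) (P.sv.dz.dz.c1 t x) (FS_deriv (fun z => P.sv.Hz t x z) (P.lv t ht x))
  have H2 := hardyB_E (fun z => P.sF.dz.Hz t x z) (P.sF.dz.dz.c1 t x) (FS_deriv (fun z => P.sF.Hz t x z) (P.lF t ht x))
  have H3 := hardyA_E (fun z => P.sF.Hz t x z) k8 (P.F0 t ht x)
  have e2 : (∫⁻ z in Ioi (0:ℝ), ofReal ((1 + z^2) * dz (dz F) t x z ^ 2)) = QQ r2 (dx v t) x := by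
    apply setLIntegral_congr_fun measurableSet_Ioi
    intro z hz
    simp only [r2]
    rw [P.Fzz t ht x z (le_of_lt hz), neg_sq]
  rw [e2] at H2
  change _ ≤ 6 * QQ r2 (dz (dz v) t) x at H1
  have H4 : (∫⁻ z in Ioi (0:ℝ), ofReal (v t x z ^ 2 * (w t x z ^ 2 / (1+z^2)))) ≤ QQ r0 (v t) x * QQ r0 (dx u t) x := by
    rw [QQ0 (v t), ← lintegral_mul_const _ (by fun_prop)]
    apply setLIntegral_mono_ae' measurableSet_Ioi
    refine Eventually.of_forall fun z hz => ?_
    have hz0 : (0:ℝ) ≤ z := le_of_lt hz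
    rw [ofReal_mul (by positivity)]
    apply mul_le_mul_right
    have k := P.su.dx.c1 t x
    by_cases hf : QQ r0 (dx u t) x = ⊤
    · rw [hf]; exact le_top
    rw [QQ0] at hf ⊢
    have hb := Bd_toReal (h := fun z => dx u t x z ^ 2) (by fun_prop) (fun z _ => by positivity) hf z hz0
    have h1 := int_sq k hz0
    rw [← ENNReal.ofReal_toReal hf]
    apply ofReal_le_ofReal
    rw [prim_eq P.sw P.su.dx (P.wz t ht x) (P.w0 t ht x) hz0, Pr, neg_sq, div_le_iff₀ (by positivity)]
    set B := (∫⁻ z in Ioi (0:ℝ), ofReal (dx u t x z ^ 2)).toReal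
    have B0 : 0 ≤ B := ENNReal.toReal_nonneg
    have : z ≤ 1 + z^2 := by nlinarith [sq_nonneg (z-1)]
    calc _ ≤ z * B := h1.trans (by gcongr)
      _ ≤ (1 + z^2) * B := by gcongr
      _ = _ := by ring
  have M : ∀ {g : ℝ → ℝ}, Continuous g → Measurable fun z => ofReal (g z) := fun h => ENNReal.measurable_ofReal.comp h.measurable
  have cF : Continuous fun z => F t x z ^ 2 / (1+z^2) := inv_sq_cont k7
  have cw : Continuous fun z => v t x z ^ 2 * (w t x z ^ 2 / (1+z^2)) := (k1.pow 2).mul (inv_sq_cont (P.sw.c1 t x))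
  have e : ∀ z, ofReal (GGf v F w t x z) = (((ofReal (27 * dz v t x z ^ 2) + ofReal (27 * dz F t x z ^ 2)) + ofReal (20 * v t x z ^ 2)) +
      ofReal (2 * (v t x z ^ 2 * (w t x z ^ 2 / (1+z^2))))) + ofReal (15 * (F t x z ^ 2 / (1+z^2))) := by
    intro z
    iterate 4 rw [← ofReal_add (by positivity) (by positivity)]
    congr 1; unfold GGf GG; ring
  simp_rw [e]
  rw [lintegral_add_right _ (M (cF.const_mul _)), lintegral_add_right _ (M (cw.const_mul _)), lintegral_add_right _ (M (by fun_prop)), lintegral_add_right _ (M (by fun_prop))]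
  rw [lint_mulc (by positivity), lint_mulc (by positivity), lint_mulc (by positivity), lint_mulc (by positivity), lint_mulc (by positivity), ← QQ0 (v t)]
  simp only [ENNReal.ofReal_ofNat]
  set A := QQ r2 (dx v t) x
  set B := QQ r2 (dz (dz v) t) x
  have H5 := H3.trans (mul_le_mul_right H2 8)
  calc _ ≤ 27 * (6 * B) + 27 * (6 * A) + 20 * QQ r0 (v t) x + 2 * (QQ r0 (v t) x * QQ r0 (dx u t) x) + 15 * (8 * (6 * A)) := by gcongr
    _ = (162 * B + 882 * A) + 20 * QQ r0 (v t) x + 2 * (QQ r0 (v t) x * QQ r0 (dx u t) x) := by ring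
    _ ≤ (900 * B + 900 * A) + 20 * QQ r0 (v t) x + 2 * (QQ r0 (v t) x * QQ r0 (dx u t) x) := by gcongr <;> norm_num
    _ = _ := by ring

def eD (v : ℝ → ℝ → ℝ → ℝ) (t x z : ℝ) : ℝ := 1/2 * ((1 + z^2) * dz v t x z ^ 2 + v t x z ^ 2)
def dD (v : ℝ → ℝ → ℝ → ℝ) (t x z : ℝ) : ℝ := (1 + z^2) * (dz (dz v) t x z ^ 2 + dx v t x z ^ 2)
theorem eD0 (v : ℝ → ℝ → ℝ → ℝ) (t x z : ℝ) : 0 ≤ eD v t x z := by unfold eD; positivity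
theorem dD0 (v : ℝ → ℝ → ℝ → ℝ) (t x z : ℝ) : 0 ≤ dD v t x z := by unfold dD; positivity
theorem eDc {v} (h : Sm v) : Continuous (unc (eD v)) := by
  unfold unc eD; have := h.c3; have := h.dz.c3; fun_prop
theorem dDc {v} (h : Sm v) : Continuous (unc (dD v)) := by
  unfold unc dD; have := h.dz.dz.c3; have := h.dx.c3; fun_prop
theorem cix {g : ℝ → ℝ → ℝ} (h : Continuous (Function.uncurry g)) (t : ℝ) : Continuous fun x => g t x :=
  h.comp (by fun_prop : Continuous fun x : ℝ => (t, x))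
theorem unc1 {g : ℝ → ℝ → ℝ → ℝ} (h : Continuous (unc g)) (t x : ℝ) : Continuous (g t x) :=
  h.comp (by fun_prop : Continuous fun z : ℝ => (t, x, z))

theorem th_pos {S z : ℝ} (hS : 0 < S) (hz : z ∈ Icc 0 S) : 0 ≤ 1/S^2 ∧ 1/S^2 * z^2 ≤ 1 ∧ 0 ≤ th (1/S^2) z := by
  have : 1/S^2 * z^2 ≤ 1 := by rw [div_mul_eq_mul_div, one_mul, div_le_one (by positivity)]; nlinarith [hz.2, hz.1]
  exact ⟨by positivity, this, by unfold th; apply pow_nonneg; linarith⟩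

set_option maxHeartbeats 1000000 in
theorem stage2S {v W F u w p : ℝ → ℝ → ℝ → ℝ} (P : Pair v W F u w p) {S : ℝ} (hS : 1 ≤ S) {a : ℝ} (ha : 0 < a) {s T : ℝ} (hs : 0 ≤ s) (hsT : s ≤ T)
    (bu : ∀ t ∈ Ioc s T, ∀ x, QQ r0 (u t) x ≤ ofReal (a^2)) (buz : ∀ t ∈ Ioc s T, ∀ x, QQ r2 (dz u t) x ≤ ofReal (a^2))
    (bpz : ∀ t ∈ Ioc s T, ∀ x, QQ r2 (dz p t) x ≤ ofReal (a^2))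
    (hG : ∫⁻ t in Ioc s T, ∫⁻ x, ∫⁻ z in Ioi (0:ℝ), ofReal (GGf v F w t x z) ≠ ⊤) :
    (∫⁻ x, ∫⁻ z in Ioi (0:ℝ), KK S z * ofReal (eD v T x z)) + (∫⁻ t in Ioc s T, ∫⁻ x, ∫⁻ z in Ioi (0:ℝ), KK S z * ofReal (dD v t x z))
    ≤ (∫⁻ x, ∫⁻ z in Ioi (0:ℝ), KK S z * ofReal (eD v s x z)) + ∫⁻ t in Ioc s T, ∫⁻ x, gS a S v F w p t x := by
  have S0 : 0 < S := by linarith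
  have c1 := P.sv.c3
  have c2 := P.sv.dz.c3
  have c3 := P.sv.dz.dz.c3
  have c4 := P.sv.dx.c3
  have c5 := P.sv.dz.dx.c3
  have c6 := P.sv.dt.c3
  have c7 := P.sv.dz.dt.c3
  have c8 := P.sF.c3
  have c9 := P.sF.dz.c3
  have c10 := P.sF.dx.c3
  have c11 := P.sF.dz.dx.c3
  have c12 := P.su.c3
  have c13 := P.su.dx.c3
  have c14 := P.sp.c3
  have c15 := P.sp.dx.c3
  have c16 : Continuous fun p : ℝ × ℝ × ℝ => Pr u p.1 p.2.1 p.2.2 := Pr_c P.su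
  have c17 : Continuous fun p : ℝ × ℝ × ℝ => Pr (dx u) p.1 p.2.1 p.2.2 := Pr_c P.su.dx
  simp_rw [← th_KK hS (unc1 (eDc P.sv) _ _) (eD0 v _ _), ← th_KK hS (unc1 (dDc P.sv) _ _) (dD0 v _ _)]
  set c := 1/S^2 with hc
  have ce : Continuous (unc fun t x z => th c z * eD v t x z) := by unfold unc eD; fun_prop
  have cet : Continuous (unc fun t x z => ph c z * (dz v t x z * pdt (dz v) t x z) + th c z * (v t x z * pdt v t x z)) := by unfold unc; fun_prop
  have cd : Continuous (unc fun t x z => th c z * dD v t x z) := by unfold unc dD; fun_prop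
  have cΦ : Continuous (unc fun t x z => ph c z * (dz v t x z * dz F t x z) + th c z * (v t x z * F t x z) - 1/2 * (ph c z * (u t x z * dz v t x z^2))
    + 1/2 * (ph1 c z * (Pr u t x z * dz v t x z^2)) - 1/2 * (th c z * (u t x z * v t x z^2)) - th c z * (v t x z^2 * p t x z)) := by unfold unc; fun_prop
  have cΦx : Continuous (unc fun t x z => (ph c z * (dx (dz v) t x z * dz F t x z + dz v t x z * dx (dz F) t x z)
          + th c z * (dx v t x z * F t x z + v t x z * dx F t x z)
          - 1/2 * (ph c z * (dx u t x z * dz v t x z ^ 2 + u t x z * (2 * dz v t x z * dx (dz v) t x z)))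
          + 1/2 * (ph1 c z * (Pr (dx u) t x z * dz v t x z ^ 2 + Pr u t x z * (2 * dz v t x z * dx (dz v) t x z)))
          - 1/2 * (th c z * (dx u t x z * v t x z ^ 2 + u t x z * (2 * v t x z * dx v t x z)))
          - th c z * (2 * v t x z * dx v t x z * p t x z + v t x z ^ 2 * dx p t x z))) := by unfold unc; fun_prop
  have sl : ∀ {g : ℝ → ℝ → ℝ → ℝ}, Continuous (unc g) → ∀ t, Continuous (Function.uncurry (g t)) := fun h t =>
    h.comp (by fun_prop : Continuous fun q : ℝ × ℝ => (t, q.1, q.2))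
  have st : ∀ {g : ℝ → ℝ → ℝ → ℝ}, Continuous (unc g) → ∀ x, Continuous (Function.uncurry fun t z => g t x z) := fun h x =>
    h.comp (by fun_prop : Continuous fun q : ℝ × ℝ => (q.1, x, q.2))
  have e0 : ∀ t x, 0 ≤ ∫ z in (0:ℝ)..S, th c z * eD v t x z := fun t x =>
    intervalIntegral.integral_nonneg S0.le fun z hz => mul_nonneg (th_pos S0 hz).2.2 (eD0 v t x z)
  refine lemmaB hsT (cii ce 0 S) (cii cet 0 S) (cii cd 0 S) (cii cΦ 0 S) (cii cΦx 0 S) (a := fun x => ∫ z in (0:ℝ)..S, th c z * eD v T x z)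
    (b := fun x => ∫ z in (0:ℝ)..S, th c z * eD v s x z)
    (cix (cii ce 0 S) T) (cix (cii ce 0 S) s)
    (fun x => e0 T x) (fun x => e0 s x) (fun t x => intervalIntegral.integral_nonneg S0.le fun z hz => mul_nonneg (th_pos S0 hz).2.2 (dD0 v t x z))
    (fun x => le_of_eq (add_comm _ _)) ?_ ?_ ?_ ?_
  · intro x t
    refine hasDeriv_ii (st ce x) (st cet x) 0 S ?_ t
    intro t z
    have := ((((P.sv.dz.Ht t x z).pow 2).const_mul (1 + z^2)).add ((P.sv.Ht t x z).pow 2)).const_mul (1/2) |>.const_mul (th c z)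
    refine HasDerivAt.congr_deriv this ?_
    simp [ph]; ring
  · intro t x
    refine hasDeriv_ii (sl cΦ t) (sl cΦx t) 0 S ?_ x
    intro x z
    have V := P.sv.Hx t x z
    have Vz := P.sv.dz.Hx t x z
    have U := P.su.Hx t x z
    have := ((Vz.mul (P.sF.dz.Hx t x z)).const_mul (ph c z)).add ((V.mul (P.sF.Hx t x z)).const_mul (th c z))
      |>.sub (((U.mul (Vz.pow 2)).const_mul (ph c z)).const_mul (1/2)) |>.add ((((Pr_x P.su t x z).mul (Vz.pow 2)).const_mul (ph1 c z)).const_mul (1/2))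
      |>.sub (((U.mul (V.pow 2)).const_mul (th c z)).const_mul (1/2)) |>.sub (((V.pow 2).mul (P.sp.Hx t x z)).const_mul (th c z))
    refine HasDerivAt.congr_deriv this ?_
    simp
  · intro t ht x
    exact slice_main P hS ha (hs.trans ht.1.le) x (bu t ht x) (buz t ht x) (bpz t ht x)
  · have key : ∀ t ∈ Ioc s T, ∀ x, ofReal |∫ z in (0:ℝ)..S, ph c z * (dz v t x z * dz F t x z) + th c z * (v t x z * F t x z) - 1/2 * (ph c z * (u t x z * dz v t x z^2))
        + 1/2 * (ph1 c z * (Pr u t x z * dz v t x z^2)) - 1/2 * (th c z * (u t x z * v t x z^2)) - th c z * (v t x z^2 * p t x z)| ≤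
        ofReal ((1+S^2) * (1 + 8 * a)) * ∫⁻ z in Ioi (0:ℝ), ofReal (GGf v F w t x z) := by
      intro t ht x
      have ht0 := hs.trans ht.1.le
      refine (ofReal_le_ofReal (intervalIntegral.abs_integral_le_integral_abs S0.le)).trans ((ofReal_ii_le S0.le _).trans ?_)
      rw [← lint_mulc (by positivity)]
      refine (setLIntegral_mono_ae' measurableSet_Ioc (Eventually.of_forall fun z hz => ofReal_le_ofReal ?_)).trans (lintegral_mono_set Ioc_subset_Ioi_self)
      have hz0 := hz.1.le
      obtain ⟨b1, b2, b3⟩ := th_pos S0 (Ioc_subset_Icc_self hz)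
      have S2 : 1 ≤ S^2 := by nlinarith
      refine flux_pt b1 (by rw [div_le_one (by positivity)]; exact S2) hz0 hz.2 b2 ha (sup_abs (fun z => P.su.Hz t x z) (P.su.dz.c1 t x) (FS_of_tendsto (P.lu t ht0 x)) ha.le (buz t ht x) hz0)
        (sup_abs (fun z => P.sp.Hz t x z) (P.sp.dz.c1 t x) (FS_of_tendsto (P.lp t ht0 x)) ha.le (bpz t ht x) hz0) ?_
      have k3 := P.su.c1 t x
      have h1 := int_sq k3 hz0
      have h2 := (Bd_iff (h := fun z => u t x z ^ 2) (by fun_prop) (fun z _ => by positivity) (sq_nonneg a)).1 (by rw [← QQ0]; exact bu t ht x) z hz0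
      apply abs_le_of_sq_le_sq _ (by have := jz_pos z; positivity)
      rw [Pr, neg_sq, mul_pow, jz_sq]
      have : z ≤ 1 + z^2 := by nlinarith [sq_nonneg (z-1)]
      calc _ ≤ z * a^2 := h1.trans (by gcongr)
        _ ≤ _ := by gcongr
    refine ne_top_of_le_ne_top ?_ (setLIntegral_mono_ae' measurableSet_Ioc (Eventually.of_forall fun t ht => lintegral_mono (key t ht)))
    simp_rw [lintegral_const_mul' _ _ ofReal_ne_top]
    exact ENNReal.mul_ne_top ofReal_ne_top hG

theorem KK_mono (z : ℝ) (hz : 0 < z) : Monotone fun n : ℕ => KK (n + 1) z := by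
  intro n m h
  have h' : (n:ℝ) + 1 ≤ m + 1 := by exact_mod_cast Nat.succ_le_succ h
  simp only [KK]
  by_cases h1 : z ≤ (n:ℝ) + 1
  · rw [if_pos h1, if_pos (h1.trans h')]
    apply ofReal_le_ofReal
    have := th_pos (S := (n:ℝ) + 1) (by positivity) ⟨hz.le, h1⟩
    unfold th
    apply pow_le_pow_left₀
    · linarith [this.2.1]
    · gcongr
  · rw [if_neg h1]; simp
theorem inv_tend (k : ℝ) : Tendsto (fun n : ℕ => 1/((n:ℝ)+1)^2 * k) atTop (nhds 0) := by
  have := (tendsto_one_div_add_atTop_nhds_zero_nat (𝕜 := ℝ)).pow 2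
  simpa using this.mul_const k
theorem ev_le (z : ℝ) : ∀ᶠ n : ℕ in atTop, z ≤ (n:ℝ) + 1 := by
  obtain ⟨N, hN⟩ := exists_nat_ge z
  filter_upwards [eventually_ge_atTop N] with n hn
  have : (N:ℝ) ≤ n := by exact_mod_cast hn
  linarith
theorem KK_tend (z : ℝ) : Tendsto (fun n : ℕ => KK (n + 1) z) atTop (nhds 1) := by
  have h1 : Tendsto (fun n : ℕ => ofReal (th (1/((n:ℝ)+1)^2) z)) atTop (nhds (ofReal 1)) := by
    apply (ENNReal.continuous_ofReal.tendsto _).comp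
    have := ((tendsto_const_nhds (x := (1:ℝ))).sub (inv_tend (z^2))).pow 3
    simpa [th] using this
  rw [ENNReal.ofReal_one] at h1
  refine h1.congr' ?_
  filter_upwards [ev_le z] with n hn
  rw [KK, if_pos hn]
theorem mS_tend (z : ℝ) : Tendsto (fun n : ℕ => mS (n + 1) z) atTop (nhds 0) := by
  have h1 : Tendsto (fun n : ℕ => ofReal ((1/((n:ℝ)+1)^2) * (1 + z^2))) atTop (nhds (ofReal 0)) :=
    (ENNReal.continuous_ofReal.tendsto _).comp (inv_tend (1 + z^2))
  rw [ENNReal.ofReal_zero] at h1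
  refine h1.congr' ?_
  filter_upwards [ev_le z] with n hn
  rw [mS, if_pos hn]
theorem mS_meas (S : ℝ) : Measurable (mS S) := by
  unfold mS
  exact Measurable.ite measurableSet_Iic (by fun_prop) measurable_const
theorem KK_meas (S : ℝ) : Measurable (KK S) := by
  unfold KK
  exact Measurable.ite measurableSet_Iic (ENNReal.measurable_ofReal.comp (th_c _).measurable) measurable_const
theorem mS_le (n : ℕ) (z : ℝ) : (indicator (Ioi (0:ℝ)) (mS (n+1)) z) ≤ 2 := by
  by_cases hz : z ∈ Ioi (0:ℝ)
  · rw [indicator_of_mem hz, mS]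
    split_ifs with h
    · have : (2:ENNReal) = ofReal 2 := by simp
      rw [this]; apply ofReal_le_ofReal
      have n0 : (0:ℝ) ≤ n := n.cast_nonneg
      have z0 : 0 < z := hz
      rw [div_mul_eq_mul_div, div_le_iff₀ (by positivity)]
      nlinarith
    · simp
  · rw [indicator_of_notMem hz]; simp
theorem KK_lim2 {h : ℝ → ℝ → ℝ} (hc : C2 h) :
    Tendsto (fun n : ℕ => ∫⁻ x, ∫⁻ z in Ioi (0:ℝ), KK (n+1) z * ofReal (h x z)) atTop (nhds (∫⁻ x, ∫⁻ z in Ioi (0:ℝ), ofReal (h x z))) ∧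
    Monotone (fun n : ℕ => ∫⁻ x, ∫⁻ z in Ioi (0:ℝ), KK (n+1) z * ofReal (h x z)) := by
  have mono1 : ∀ x, Monotone fun n : ℕ => ∫⁻ z in Ioi (0:ℝ), KK (n+1) z * ofReal (h x z) := fun x n m hnm =>
    setLIntegral_mono_ae' measurableSet_Ioi (Eventually.of_forall fun z hz => mul_le_mul_left (KK_mono z hz hnm) _)
  have m2 : ∀ n : ℕ, Measurable (Function.uncurry fun x z => KK (n+1) z * ofReal (h x z)) := fun n =>
    ((KK_meas _).comp measurable_snd).mul (ofReal_meas2 hc)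
  refine ⟨?_, fun n m hnm => lintegral_mono fun x => mono1 x hnm⟩
  refine lintegral_tendsto_of_tendsto_of_monotone (fun n => (meas_lint (m2 n) _).aemeasurable) (Eventually.of_forall mono1) (Eventually.of_forall fun x => ?_)
  refine lintegral_tendsto_of_tendsto_of_monotone (fun n => ((m2 n).comp (by fun_prop : Measurable fun z : ℝ => (x, z))).aemeasurable) ?_ ?_
  · exact (ae_restrict_iff' measurableSet_Ioi).2 (Eventually.of_forall fun z hz n m hnm => mul_le_mul_left (KK_mono z hz hnm) _)
  · refine Eventually.of_forall fun z => ?_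
    simpa using ENNReal.Tendsto.mul_const (b := ofReal (h x z)) (KK_tend z) (Or.inl one_ne_zero)

theorem meas3 {G : ℝ → ℝ → ℝ → ENNReal} (hG : Measurable fun p : ℝ × ℝ × ℝ => G p.1 p.2.1 p.2.2) :
    Measurable (Function.uncurry fun t x => ∫⁻ z in Ioi (0:ℝ), G t x z) :=
  Measurable.lintegral_prod_right' (f := fun q : (ℝ × ℝ) × ℝ => G q.1.1 q.1.2 q.2)
    (hG.comp (by fun_prop : Measurable fun q : (ℝ × ℝ) × ℝ => (q.1.1, q.1.2, q.2)))
theorem ofReal_meas3 {h : ℝ → ℝ → ℝ → ℝ} (hc : Continuous (unc h)) :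
    Measurable fun p : ℝ × ℝ × ℝ => ofReal (h p.1 p.2.1 p.2.2) := ENNReal.measurable_ofReal.comp hc.measurable
theorem Sm.mQ {g} (h : Sm g) {ρ : ℝ → ℝ} (cρ : Continuous ρ) : Measurable (Function.uncurry fun t x => QQ ρ (g t) x) :=
  meas3 (ofReal_meas3 (h := fun t x z => ρ z * g t x z ^ 2) (by unfold unc; have := h.c3; fun_prop))
theorem Sm.mN {g} (h : Sm g) {ρ : ℝ → ℝ} (cρ : Continuous ρ) : Measurable (fun t => NN ρ (g t)) :=
  meas_lint (h.mQ cρ) _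
theorem Sm.mD0 {g} (h : Sm g) : Measurable (D0 g) := (h.dx.mN r2c).add (h.dz.dz.mN r2c)
theorem KK_lim3 {h : ℝ → ℝ → ℝ → ℝ} (hc : Continuous (unc h)) (s T : ℝ) :
    Tendsto (fun n : ℕ => ∫⁻ t in Ioc s T, ∫⁻ x, ∫⁻ z in Ioi (0:ℝ), KK (n+1) z * ofReal (h t x z)) atTop
      (nhds (∫⁻ t in Ioc s T, ∫⁻ x, ∫⁻ z in Ioi (0:ℝ), ofReal (h t x z))) := by
  have c2 : ∀ t, C2 (h t) := fun t => hc.comp (by fun_prop : Continuous fun q : ℝ × ℝ => (t, q.1, q.2))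
  refine lintegral_tendsto_of_tendsto_of_monotone (fun n => ?_) (Eventually.of_forall fun t => (KK_lim2 (c2 t)).2) (Eventually.of_forall fun t => (KK_lim2 (c2 t)).1)
  exact (meas_lint (meas3 (G := fun t x z => KK (n+1) z * ofReal (h t x z))
    (((KK_meas _).comp (by fun_prop : Measurable fun q : ℝ × ℝ × ℝ => q.2.2)).mul (ofReal_meas3 hc))) _).aemeasurable

theorem eD_E0 {v} (h : Sm v) (t : ℝ) : ∫⁻ x, ∫⁻ z in Ioi (0:ℝ), ofReal (eD v t x z) = ofReal (1/2) * E0 v t := by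
  have : ∀ x, ∫⁻ z in Ioi (0:ℝ), ofReal (eD v t x z) = ofReal (1/2) * (QQ r0 (v t) x + QQ r2 (dz v t) x) := by
    intro x
    unfold eD
    rw [QQ, QQ, ← lintegral_add_left (by have := h.c1 t x; unfold r0; fun_prop), ← lintegral_const_mul' _ _ ofReal_ne_top]
    congr 2; funext z
    rw [← ofReal_add (mul_nonneg (r0p z) (sq_nonneg _)) (mul_nonneg (r2p z) (sq_nonneg _)), ← ofReal_mul (by norm_num)]
    congr 1; unfold r0 r2; ring
  simp_rw [this]
  rw [lintegral_const_mul' _ _ ofReal_ne_top, lintegral_add_left ((h.C2 t).mQ r0c)]; rfl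
theorem dD_D0 {v} (h : Sm v) (t : ℝ) : ∫⁻ x, ∫⁻ z in Ioi (0:ℝ), ofReal (dD v t x z) = D0 v t := by
  have : ∀ x, ∫⁻ z in Ioi (0:ℝ), ofReal (dD v t x z) = (QQ r2 (dx v t) x + QQ r2 (dz (dz v) t) x) := by
    intro x
    unfold dD
    rw [QQ, QQ, ← lintegral_add_left (by have := h.dx.c1 t x; unfold r2; fun_prop)]
    congr 2; funext z
    rw [← ofReal_add (mul_nonneg (r2p z) (sq_nonneg _)) (mul_nonneg (r2p z) (sq_nonneg _))]
    congr 1; unfold r2; ring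
  simp_rw [this]
  rw [lintegral_add_left ((h.dx.C2 t).mQ r2c)]; rfl

theorem mSG {G : ℝ → ℝ → ℝ → ENNReal} (mG : Measurable fun p : ℝ × ℝ × ℝ => G p.1 p.2.1 p.2.2) (n : ℕ) :
    Measurable (Function.uncurry fun t x => ∫⁻ z in Ioi (0:ℝ), mS (n+1) z * G t x z) :=
  meas3 (((mS_meas _).comp (by fun_prop : Measurable fun q : ℝ × ℝ × ℝ => q.2.2)).mul mG)
theorem gS_split {v F w p : ℝ → ℝ → ℝ → ℝ} (sv : Sm v) (cG : Continuous (unc (GGf v F w))) (a s T : ℝ) (n : ℕ) :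
    ∫⁻ t in Ioc s T, ∫⁻ x, gS a (n+1) v F w p t x = (ofReal (600*a) * (∫⁻ t in Ioc s T, D0 v t) + ∫⁻ t in Ioc s T, ∫⁻ x, Err p v t x)
      + ∫⁻ t in Ioc s T, ∫⁻ x, ∫⁻ z in Ioi (0:ℝ), mS (n+1) z * ofReal (GGf v F w t x z) := by
    have mS3 := mSG (G := fun t x z => ofReal (GGf v F w t x z)) (ofReal_meas3 cG) n
    have mD := sv.mD0
    have e : ∀ t, ∫⁻ x, gS a (n+1) v F w p t x = (ofReal (600*a) * D0 v t + ∫⁻ x, Err p v t x) + ∫⁻ x, ∫⁻ z in Ioi (0:ℝ), mS (n+1) z * ofReal (GGf v F w t x z) := by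
      intro t
      have m1 := (sv.dx.C2 t).mQ r2c
      have m2 := (sv.dz.dz.C2 t).mQ r2c
      have m3 : Measurable fun x => ∫⁻ z in Ioi (0:ℝ), mS (n+1) z * ofReal (GGf v F w t x z) := mS3.of_uncurry_left
      have m4 : Measurable fun x => ofReal (600*a) * (QQ r2 (dx v t) x + QQ r2 (dz (dz v) t) x) := (m1.add m2).const_mul _
      unfold gS
      rw [lintegral_add_right _ m3, lintegral_add_left m4,
        lintegral_const_mul' _ _ ofReal_ne_top, lintegral_add_left m1]
      rfl
    simp_rw [e]
    rw [lintegral_add_right _ (meas_lint (mS3) _), lintegral_add_left (mD.const_mul _), lintegral_const_mul' _ _ ofReal_ne_top]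

theorem stage2 {v W F u w p : ℝ → ℝ → ℝ → ℝ} (P : Pair v W F u w p) {a : ℝ} (ha : 0 < a) {s T : ℝ} (hs : 0 ≤ s) (hsT : s ≤ T)
    (bu : ∀ t ∈ Ioc s T, ∀ x, QQ r0 (u t) x ≤ ofReal (a^2)) (buz : ∀ t ∈ Ioc s T, ∀ x, QQ r2 (dz u t) x ≤ ofReal (a^2))
    (bpz : ∀ t ∈ Ioc s T, ∀ x, QQ r2 (dz p t) x ≤ ofReal (a^2))
    (fD : ∫⁻ t in Ioc s T, D0 v t ≠ ⊤) (fv : ∫⁻ t in Ioc s T, NN r0 (v t) ≠ ⊤) {Vm : ENNReal} (hVm : Vm ≠ ⊤)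
    (hV : ∀ t ∈ Ioc s T, ∀ x, QQ r0 (v t) x ≤ Vm) (fu : ∫⁻ t in Ioc s T, NN r0 (dx u t) ≠ ⊤) :
    ofReal (1/2) * E0 v T + ∫⁻ t in Ioc s T, D0 v t ≤
      ofReal (1/2) * E0 v s + (ofReal (600*a) * (∫⁻ t in Ioc s T, D0 v t) + ∫⁻ t in Ioc s T, ∫⁻ x, Err p v t x) := by
  have mD := P.sv.mD0
  have cG := GGf_c P.sv P.sF P.sw
  have hG : ∫⁻ t in Ioc s T, ∫⁻ x, ∫⁻ z in Ioi (0:ℝ), ofReal (GGf v F w t x z) ≠ ⊤ := by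
    refine ne_top_of_le_ne_top (b := ∫⁻ t in Ioc s T, (900 * D0 v t + 20 * NN r0 (v t) + 2 * (Vm * NN r0 (dx u t)))) ?_ ?_
    · have m1 : Measurable fun t => 900 * D0 v t := mD.const_mul _
      have m2 : Measurable fun t => 20 * NN r0 (v t) := (P.sv.mN r0c).const_mul _
      rw [lintegral_add_left (f := fun t => 900 * D0 v t + 20 * NN r0 (v t)) (m1.add m2), lintegral_add_left m1, lintegral_const_mul' _ _ (by norm_num),
        lintegral_const_mul' _ _ (by norm_num), lintegral_const_mul' _ _ (by norm_num), lintegral_const_mul' _ _ hVm]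
      finiteness
    · refine setLIntegral_mono_ae' measurableSet_Ioc (Eventually.of_forall fun t ht => ?_)
      refine (lintegral_mono (g := fun x => 900 * (QQ r2 (dx v t) x + QQ r2 (dz (dz v) t) x) + 20 * QQ r0 (v t) x + 2 * (Vm * QQ r0 (dx u t) x)) fun x => ?_).trans (le_of_eq ?_)
      · refine (GG_fin P (hs.trans ht.1.le) x).trans ?_
        exact add_le_add le_rfl (mul_le_mul_right (mul_le_mul_left (hV t ht x) _) _)
      · have m1 := (P.sv.dx.C2 t).mQ r2c
        have m2 := (P.sv.dz.dz.C2 t).mQ r2c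
        have m3 := (P.sv.C2 t).mQ r0c
        have m4 : Measurable fun x => 900 * (QQ r2 (dx v t) x + QQ r2 (dz (dz v) t) x) := (m1.add m2).const_mul _
        rw [lintegral_add_left (f := fun x => 900 * (QQ r2 (dx v t) x + QQ r2 (dz (dz v) t) x) + 20 * QQ r0 (v t) x) (m4.add (m3.const_mul _)), lintegral_add_left m4, lintegral_const_mul' _ _ (by norm_num),
          lintegral_const_mul' _ _ (by norm_num), lintegral_const_mul' _ _ (by norm_num), lintegral_const_mul' _ _ hVm, lintegral_add_left m1]
        rfl
  have mG := ofReal_meas3 cG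
  have L := lemmaD (G := fun t x z => ofReal (GGf v F w t x z)) mG hG (m := fun n => indicator (Ioi (0:ℝ)) (mS (n+1))) (fun n => (mS_meas _).indicator measurableSet_Ioi) (C := 2) (by norm_num) mS_le (by
    intro z
    by_cases hz : z ∈ Ioi (0:ℝ)
    · simp_rw [indicator_of_mem hz]; exact mS_tend z
    · simp_rw [indicator_of_notMem hz]; exact tendsto_const_nhds)
  have L' : Tendsto (fun n : ℕ => ∫⁻ t in Ioc s T, ∫⁻ x, ∫⁻ z in Ioi (0:ℝ), mS (n+1) z * ofReal (GGf v F w t x z)) atTop (nhds 0) := by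
    refine L.congr fun n => ?_
    refine lintegral_congr fun t => lintegral_congr fun x => setLIntegral_congr_fun measurableSet_Ioi fun z hz => ?_
    simp only [indicator_of_mem hz]
  have R := (KK_lim2 (h := eD v s) ((eDc P.sv).comp (by fun_prop : Continuous fun q : ℝ × ℝ => (s, q.1, q.2)))).1
  have R' := (KK_lim2 (h := eD v T) ((eDc P.sv).comp (by fun_prop : Continuous fun q : ℝ × ℝ => (T, q.1, q.2)))).1
  have R3 := KK_lim3 (dDc P.sv) s T
  rw [eD_E0 P.sv] at R R'
  simp_rw [dD_D0 P.sv] at R3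
  have fin := le_of_tendsto_of_tendsto' (R'.add R3) (R.add (L'.const_add (ofReal (600*a) * (∫⁻ t in Ioc s T, D0 v t) + ∫⁻ t in Ioc s T, ∫⁻ x, Err p v t x))) (fun n => by
    rw [← gS_split P.sv cG]
    exact stage2S P (by have : (0:ℝ) ≤ n := n.cast_nonneg
                        linarith) ha hs hsT bu buz bpz hG)
  rwa [add_zero] at fin

theorem errB {p v : ℝ → ℝ → ℝ → ℝ} (sv : Sm v) (sp : Sm p) {t x V : ℝ} (lv : Tendsto (v t x) atTop (nhds 0)) (hV : 0 < V)
    (hQ : QQ r2 (v t) x ≤ ofReal V) :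
    Err p v t x ≤ ofReal (1/8) * QQ r2 (dz (dz v) t) x + ofReal (8*V) * QQ r2 (dx (dz p) t) x := by
  by_cases hβ : QQ r2 (dz (dz v) t) x = ⊤
  · rw [hβ, ENNReal.mul_top (by simp)]; simp
  set β := Real.sqrt (QQ r2 (dz (dz v) t) x).toReal with hb
  have β0 : 0 ≤ β := Real.sqrt_nonneg _
  have hβ2 : QQ r2 (dz (dz v) t) x = ofReal (β^2) := by rw [hb, Real.sq_sqrt ENNReal.toReal_nonneg, ENNReal.ofReal_toReal hβ]
  have c0 := sv.c1 t x
  have c1 := sp.dz.dx.c1 t x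
  have S : ∀ z ≥ 0, |dz v t x z| ≤ 2 * β := fun z hz =>
    sup_abs (fun z => sv.dz.Hz t x z) (sv.dz.dz.c1 t x) (FS_deriv (fun z => sv.Hz t x z) lv) β0 (by rw [← QQ2, hβ2]) hz
  calc Err p v t x ≤ ∫⁻ z in Ioi (0:ℝ), (ofReal (β^2/8/V * (r2 z * v t x z ^ 2)) + ofReal (8*V * (r2 z * dx (dz p) t x z ^ 2))) := by
        refine setLIntegral_mono_ae' measurableSet_Ioi (Eventually.of_forall fun z hz => ?_)
        have r := r2p z
        rw [← ofReal_add (by positivity) (by positivity)]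
        apply ofReal_le_ofReal
        have e : (1 + z^2) = r2 z := rfl
        rw [e, abs_mul, abs_mul]
        have h1 : |dz v t x z| * |v t x z| * |dx (dz p) t x z| ≤ β^2/8/V * v t x z ^ 2 + 8*V * dx (dz p) t x z ^ 2 := by
          calc _ ≤ 2 * β * |v t x z| * |dx (dz p) t x z| := by gcongr; exact S z (le_of_lt hz)
            _ ≤ _ := by
              rw [← sq_abs (v t x z), ← sq_abs (dx (dz p) t x z)]
              have : β^2/8/V * |v t x z|^2 + 8*V*|dx (dz p) t x z|^2 - 2 * β * |v t x z| * |dx (dz p) t x z| = (β * |v t x z| - 8*V*|dx (dz p) t x z|)^2/(8*V) := by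
                field_simp; ring
              have : 0 ≤ (β * |v t x z| - 8*V*|dx (dz p) t x z|)^2/(8*V) := by positivity
              linarith
        nlinarith
    _ = ofReal (β^2/8/V) * QQ r2 (v t) x + ofReal (8*V) * QQ r2 (dx (dz p) t) x := by
        rw [lintegral_add_left (by unfold r2; fun_prop), lint_mulc (by positivity), lint_mulc (by positivity)]; rfl
    _ ≤ _ := by
        refine add_le_add ?_ le_rfl
        refine (mul_le_mul_right hQ _).trans (le_of_eq ?_)
        rw [hβ2, ← ofReal_mul (by positivity), ← ofReal_mul (by positivity)]
        congr 1; field_simp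

theorem errI {p v : ℝ → ℝ → ℝ → ℝ} (sv : Sm v) (sp : Sm p) {t m : ℝ} (lv : ∀ x, Tendsto (v t x) atTop (nhds 0)) (hm0 : 0 < m)
    (hm : NN r2 (dx (dz p) t) ≤ ofReal (m^2)) :
    ∫⁻ x, Err p v t x ≤ ofReal (1/8) * D0 v t + ofReal (1024*m^4) * NN r2 (v t) := by
  by_cases h1 : D0 v t = ⊤
  · rw [h1, ENNReal.mul_top (by simp)]; simp
  by_cases h2 : NN r2 (v t) = ⊤
  · rw [h2, ENNReal.mul_top (by simp; positivity)]; simp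
  have h3 : NN r2 (dx v t) ≠ ⊤ := ne_top_of_le_ne_top h1 le_self_add
  set A := 128*m^2 * (NN r2 (v t)).toReal + 1/(64*m^2) * (NN r2 (dx v t)).toReal with hA
  have A0 : 0 ≤ A := by positivity
  have hQ : ∀ x, QQ r2 (v t) x ≤ ofReal A := by
    intro x
    refine (agmon r2c r2p (sv.C2 t) (sv.dx.C2 t) (fun x z => sv.Hx t x z) (l := 64*m^2) (by positivity) x).trans (le_of_eq ?_)
    rw [hA, ← ENNReal.ofReal_toReal h2, ← ENNReal.ofReal_toReal h3, ← ofReal_mul (by positivity), ← ofReal_mul (by positivity), ← ofReal_add (by positivity) (by positivity)]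
    simp only [ENNReal.toReal_ofReal ENNReal.toReal_nonneg]
    congr 1; ring
  have key : ∀ δ ∈ Ioi (0:ℝ), ∫⁻ x, Err p v t x ≤ ofReal (1/8) * NN r2 (dz (dz v) t) + ofReal (8*(A+δ)) * ofReal (m^2) := by
    intro δ hδ
    have hδ' : 0 < δ := hδ
    refine (lintegral_mono fun x => errB sv sp (lv x) (V := A + δ) (by positivity) ((hQ x).trans (ofReal_le_ofReal (by linarith)))).trans ?_
    rw [lintegral_add_left (((sv.dz.dz.C2 t).mQ r2c).const_mul _), lintegral_const_mul' _ _ ofReal_ne_top, lintegral_const_mul' _ _ ofReal_ne_top]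
    gcongr
    · exact le_rfl
    · exact hm
  have lim : Tendsto (fun δ : ℝ => ofReal (1/8) * NN r2 (dz (dz v) t) + ofReal (8*(A+δ)) * ofReal (m^2)) (nhdsWithin 0 (Ioi 0))
      (nhds (ofReal (1/8) * NN r2 (dz (dz v) t) + ofReal (8*(A+0)) * ofReal (m^2))) := by
    refine Tendsto.mono_left ?_ nhdsWithin_le_nhds
    refine Tendsto.const_add _ (ENNReal.Tendsto.mul_const ?_ (Or.inr ofReal_ne_top))
    exact (ENNReal.continuous_ofReal.comp (by fun_prop : Continuous fun δ : ℝ => 8*(A+δ))).tendsto 0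
  refine (ge_of_tendsto lim (eventually_nhdsWithin_of_forall key)).trans (le_of_eq ?_)
  rw [← ofReal_mul (by positivity), D0]
  have e : ofReal (8*(A+0)*m^2) = ofReal (1/8) * NN r2 (dx v t) + ofReal (1024*m^4) * NN r2 (v t) := by
    rw [← ENNReal.ofReal_toReal h2, ← ENNReal.ofReal_toReal h3, ← ofReal_mul (by positivity), ← ofReal_mul (by positivity), ← ofReal_add (by positivity) (by positivity)]
    congr 1; rw [hA]; field_simp; ring
  rw [e]; ring

theorem fatou2 {h : ℕ → ℝ → ℝ → ℝ} {g : ℝ → ℝ → ℝ} (hc : ∀ n, C2 (h n)) (ht : ∀ x z, Tendsto (fun n => h n x z) atTop (nhds (g x z))) :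
    ∫⁻ x, ∫⁻ z in Ioi (0:ℝ), ofReal (g x z) ≤ liminf (fun n => ∫⁻ x, ∫⁻ z in Ioi (0:ℝ), ofReal (h n x z)) atTop := by
  refine le_trans (lintegral_mono fun x => ?_) (lintegral_liminf_le fun n => meas_lint (ofReal_meas2 (hc n)) _)
  refine le_trans (lintegral_mono fun z => ?_) (lintegral_liminf_le fun n => ENNReal.measurable_ofReal.comp ((hc n).sl x).measurable)
  exact ((ENNReal.continuous_ofReal.tendsto _).comp (ht x z)).liminf_eq.ge
theorem fatou3 {h : ℕ → ℝ → ℝ → ℝ → ℝ} {g : ℝ → ℝ → ℝ → ℝ} (hc : ∀ n, Continuous (unc (h n))) (ht : ∀ t x z, Tendsto (fun n => h n t x z) atTop (nhds (g t x z))) (s T : ℝ) :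
    ∫⁻ t in Ioc s T, ∫⁻ x, ∫⁻ z in Ioi (0:ℝ), ofReal (g t x z) ≤ liminf (fun n => ∫⁻ t in Ioc s T, ∫⁻ x, ∫⁻ z in Ioi (0:ℝ), ofReal (h n t x z)) atTop := by
  refine le_trans (lintegral_mono fun t => ?_) (lintegral_liminf_le fun n => meas_lint (meas3 (ofReal_meas3 (hc n))) _)
  exact fatou2 (fun n => (hc n).comp (by fun_prop : Continuous fun q : ℝ × ℝ => (t, q.1, q.2))) (ht t)

theorem lsum {A B X : ENNReal} {a b : ℕ → ENNReal} (hA : A ≤ liminf a atTop) (hB : B ≤ liminf b atTop) (h : ∀ n, a n + b n ≤ X) : A + B ≤ X := by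
  have e : ∀ a : ℕ → ENNReal, Tendsto (fun n => ⨅ i ≥ n, a i) atTop (nhds (liminf a atTop)) := fun a => by
    rw [liminf_eq_iSup_iInf_of_nat]
    exact tendsto_atTop_iSup fun n m hnm => le_iInf₂ fun i hi => iInf₂_le i (hnm.trans hi)
  refine (add_le_add hA hB).trans (le_of_tendsto' ((e a).add (e b)) fun n => le_trans ?_ (h n))
  exact add_le_add (iInf₂_le n le_rfl) (iInf₂_le n le_rfl)

theorem star0 {u w f : ℝ → ℝ → ℝ → ℝ} (H : IsPS2D u w f) {a : ℝ} (ha : 0 < a) {s T : ℝ} (hs : 0 ≤ s) (hsT : s ≤ T)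
    (bu : ∀ t ∈ Ioc s T, ∀ x, QQ r0 (u t) x ≤ ofReal (a^2)) (buz : ∀ t ∈ Ioc s T, ∀ x, QQ r2 (dz u t) x ≤ ofReal (a^2))
    (fD : ∫⁻ t in Ioc s T, D0 u t ≠ ⊤) (fv : ∫⁻ t in Ioc s T, NN r0 (u t) ≠ ⊤) :
    ofReal (1/2) * E0 u T + ∫⁻ t in Ioc s T, D0 u t ≤ ofReal (1/2) * E0 u s + ofReal (600*a) * ∫⁻ t in Ioc s T, D0 u t := by
  have P := mkPair H.sol IsPS2D.zero.sol
  simp only [sub_zero] at P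
  have z1 : ∀ t x z, dz (fun _ _ _ => (0:ℝ)) t x z = 0 := fun t x z => by simp [dz, pdz]
  have z2 : ∀ t x z, dx (dz (fun _ _ _ => (0:ℝ))) t x z = 0 := fun t x z => by simp [dx, pdx, z1]
  refine (stage2 P ha hs hsT bu buz ?_ fD fv ofReal_ne_top bu ?_).trans ?_
  · intro t _ x; simp [QQ, z1]
  · exact ne_top_of_le_ne_top fD (lintegral_mono fun t => (NN_mono_r _).trans le_self_add)
  · simp [Err, z2]

theorem dx_sh (u : ℝ → ℝ → ℝ → ℝ) (h : ℝ) : dx (fun t x z => u t (x + h) z) = fun t x z => dx u t (x + h) z := by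
  funext t x z
  exact deriv_comp_add_const (f := fun x' => u t x' z) h x
theorem Sm.sh {u} (su : Sm u) (h : ℝ) : Sm (fun t x z => u t (x + h) z) :=
  ContDiff.comp su (by fun_prop : ContDiff ℝ (⊤ : ℕ∞) (fun p : ℝ × ℝ × ℝ => ((p.1, p.2.1 + h, p.2.2) : ℝ × ℝ × ℝ)))
def dq (u : ℝ → ℝ → ℝ → ℝ) (h : ℝ) : ℝ → ℝ → ℝ → ℝ := fun t x z => u t (x + h) z - u t x z
theorem Sm.dq {u} (su : Sm u) (h : ℝ) : Sm (dq u h) := (su.sh h).sub su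
theorem dq_x {u} (su : Sm u) (h : ℝ) : dx (dq u h) = dq (dx u) h := by
  unfold dq; rw [dx_subF (su.sh h) su, dx_sh]
theorem dq_z {u} (su : Sm u) (h : ℝ) : dz (dq u h) = dq (dz u) h := by
  unfold dq; rw [dz_subF (su.sh h) su]; rfl
theorem NN_dq {u} (su : Sm u) {ρ : ℝ → ℝ} (cρ : Continuous ρ) (ρ0 : ∀ z, 0 ≤ ρ z) (h t : ℝ) : NN ρ (dq u h t) ≤ 4 * NN ρ (u t) := by
  refine (NN_sub (g := fun x z => u t (x + h) z) (h := u t) cρ ρ0 ((su.sh h).C2 t)).trans (le_of_eq ?_)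
  rw [NN_shift]; ring
theorem NN_dq2 {u} (su : Sm u) {ρ : ℝ → ℝ} (cρ : Continuous ρ) (ρ0 : ∀ z, 0 ≤ ρ z) {h : ℝ} (hh : 0 < h) (t : ℝ) : NN ρ (dq u h t) ≤ ofReal (h^2) * NN ρ (dx u t) :=
  diffq cρ ρ0 (su.dx.C2 t) (fun x z => su.Hx t x z) hh
theorem dq_lim {u} (su : Sm u) (t x z : ℝ) : Tendsto (fun n : ℕ => dq u (1/((n:ℝ)+1)) t x z * ((n:ℝ)+1)) atTop (nhds (dx u t x z)) := by
  have h1 := (su.Hx t x z).tendsto_slope_zero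
  have h2 : Tendsto (fun n : ℕ => 1/((n:ℝ)+1)) atTop (nhdsWithin 0 {0}ᶜ) :=
    tendsto_nhdsWithin_iff.2 ⟨tendsto_one_div_add_atTop_nhds_zero_nat, Eventually.of_forall fun n => by simp; positivity⟩
  refine (h1.comp h2).congr fun n => ?_
  simp [dq]; ring

theorem absorb {a b c X : ENNReal} {k : ℝ} (hX : X ≠ ⊤) (hk : k ≤ 1/4) (h : a + X ≤ b + (ofReal k * X + c)) : a + ofReal (3/4) * X ≤ b + c := by
  have e : X = ofReal (3/4) * X + ofReal (1/4) * X := by rw [← add_mul, ← ofReal_add (by norm_num) (by norm_num)]; norm_num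
  have f : ofReal (1/4) * X ≠ ⊤ := by finiteness
  have g : ofReal k * X ≤ ofReal (1/4) * X := by gcongr
  refine (ENNReal.add_le_add_iff_right f).1 ?_
  calc _ = a + X := by rw [add_assoc, ← e]
    _ ≤ b + (ofReal k * X + c) := h
    _ ≤ b + (ofReal (1/4) * X + c) := by gcongr
    _ = _ := by ring

theorem star_h {u w f : ℝ → ℝ → ℝ → ℝ} (H : IsPS2D u w f) {a : ℝ} (ha : 0 < a) (ha2 : 600 * a ≤ 1/8) {s T : ℝ} (hs : 0 ≤ s) (hsT : s ≤ T)
    (bu : ∀ t ∈ Ioc s T, ∀ x, QQ r0 (u t) x ≤ ofReal (a^2)) (buz : ∀ t ∈ Ioc s T, ∀ x, QQ r2 (dz u t) x ≤ ofReal (a^2))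
    (fD : ∫⁻ t in Ioc s T, D0 u t ≠ ⊤) (fv : ∫⁻ t in Ioc s T, NN r0 (u t) ≠ ⊤) {m : ℝ} (hm0 : 0 < m)
    (hm : ∀ t ∈ Ioc s T, NN r2 (dx (dz u) t) ≤ ofReal (m^2)) {h : ℝ} (hh : 0 < h) :
    ofReal (1/2) * E0 (dq u h) T + ofReal (3/4) * ∫⁻ t in Ioc s T, D0 (dq u h) t ≤
      ofReal (h^2) * (ofReal (1/2) * E0 (dx u) s + ofReal (1024*m^4) * ∫⁻ t in Ioc s T, D0 u t) := by
  have A := H.sol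
  have su := A.su
  have P : Pair (dq u h) _ _ _ _ _ := mkPair (H.shift h).sol A
  have sv := P.sv
  have hD : ∀ t, D0 (dq u h) t ≤ 4 * D0 u t := fun t => by
    unfold D0
    rw [dq_x su, dq_z su, dq_z su.dz, mul_add]
    exact add_le_add (NN_dq su.dx r2c r2p h t) (NN_dq su.dz.dz r2c r2p h t)
  have fX : ∫⁻ t in Ioc s T, D0 (dq u h) t ≠ ⊤ := by
    refine ne_top_of_le_ne_top ?_ (lintegral_mono hD)
    rw [lintegral_const_mul' _ _ (by norm_num)]; finiteness
  have S2 := stage2 P ha hs hsT (fun t ht x => bu t ht (x + h)) (fun t ht x => buz t ht (x + h)) buz fX (Vm := 2 * ofReal (a^2) + 2 * ofReal (a^2))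
    (by
      refine ne_top_of_le_ne_top ?_ (lintegral_mono fun t => NN_dq su r0c r0p h t)
      rw [lintegral_const_mul' _ _ (by norm_num)]; finiteness)
    (by finiteness)
    (by
      intro t ht x
      refine (QQ_sub (g := fun x z => u t (x + h) z) (h := u t) r0c r0p ((su.sh h).C2 t) x).trans ?_
      gcongr
      · exact bu t ht (x + h)
      · exact bu t ht x)
    (by
      rw [dx_sh]
      refine ne_top_of_le_ne_top fD (lintegral_mono fun t => ?_)
      rw [NN_shift]
      exact (NN_mono_r _).trans le_self_add)
  have S3 : ∫⁻ t in Ioc s T, ∫⁻ x, Err u (dq u h) t x ≤ ofReal (1/8) * (∫⁻ t in Ioc s T, D0 (dq u h) t)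
      + ofReal (1024*m^4) * (ofReal (h^2) * ∫⁻ t in Ioc s T, D0 u t) := by
    refine (setLIntegral_mono_ae' (g := fun t => ofReal (1/8) * D0 (dq u h) t + ofReal (1024*m^4) * (ofReal (h^2) * D0 u t)) measurableSet_Ioc (Eventually.of_forall fun t ht => ?_)).trans (le_of_eq ?_)
    · refine (errI sv su (P.lv t (hs.trans ht.1.le)) hm0 (hm t ht)).trans ?_
      refine add_le_add le_rfl (mul_le_mul_right ((NN_dq2 su r2c r2p hh t).trans (mul_le_mul_right le_self_add _)) _)
    · rw [lintegral_add_left (sv.mD0.const_mul _), lintegral_const_mul' _ _ ofReal_ne_top, lintegral_const_mul' _ _ ofReal_ne_top, lintegral_const_mul' _ _ ofReal_ne_top]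
  have hE : E0 (dq u h) s ≤ ofReal (h^2) * E0 (dx u) s := by
    unfold E0
    rw [dq_z su, ← su.xz, mul_add]
    exact add_le_add (NN_dq2 su r0c r0p hh s) (NN_dq2 su.dz r2c r2p hh s)
  have S4 := absorb (k := 600 * a + 1/8) (c := ofReal (1024*m^4) * (ofReal (h^2) * ∫⁻ t in Ioc s T, D0 u t)) fX (by linarith) (S2.trans (by
    refine add_le_add le_rfl ?_
    rw [ofReal_add (by positivity) (by norm_num), add_mul, add_assoc]
    exact add_le_add le_rfl S3))
  refine S4.trans ((add_le_add (mul_le_mul_right hE _) le_rfl).trans (le_of_eq ?_))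
  ring

theorem star {u w f : ℝ → ℝ → ℝ → ℝ} (H : IsPS2D u w f) {a : ℝ} (ha : 0 < a) (ha2 : 600 * a ≤ 1/8) {s T : ℝ} (hs : 0 ≤ s) (hsT : s ≤ T)
    (bu : ∀ t ∈ Ioc s T, ∀ x, QQ r0 (u t) x ≤ ofReal (a^2)) (buz : ∀ t ∈ Ioc s T, ∀ x, QQ r2 (dz u t) x ≤ ofReal (a^2))
    (fD : ∫⁻ t in Ioc s T, D0 u t ≠ ⊤) (fv : ∫⁻ t in Ioc s T, NN r0 (u t) ≠ ⊤) {m : ℝ} (hm0 : 0 < m)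
    (hm : ∀ t ∈ Ioc s T, NN r2 (dx (dz u) t) ≤ ofReal (m^2)) :
    ofReal (1/2) * E0 (dx u) T + ofReal (3/4) * ∫⁻ t in Ioc s T, D0 (dx u) t ≤
      ofReal (1/2) * E0 (dx u) s + ofReal (1024*m^4) * ∫⁻ t in Ioc s T, D0 u t := by
  have su := H.sol.su
  have L1 := fatou2 (h := fun n : ℕ => fun x z => ((n:ℝ)+1)^2 * eD (dq u (1/((n:ℝ)+1))) T x z) (g := eD (dx u) T)
    (fun n => by
      have := (eDc (su.dq (1/((n:ℝ)+1)))).comp (by fun_prop : Continuous fun q : ℝ × ℝ => (T, q.1, q.2))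
      exact this.const_smul (((n:ℝ)+1)^2))
    (fun x z => by
      have h1 := ((((dq_lim su.dz T x z).pow 2).const_mul (1+z^2)).add ((dq_lim su T x z).pow 2)).const_mul (1/2)
      rw [su.xz] at h1
      refine h1.congr fun n => ?_
      simp only [eD, dq_z su]; ring)
  have L2 := fatou3 (h := fun n : ℕ => fun t x z => 3/4 * (((n:ℝ)+1)^2 * dD (dq u (1/((n:ℝ)+1))) t x z)) (g := fun t x z => 3/4 * dD (dx u) t x z)
    (fun n => by
      exact ((dDc (su.dq (1/((n:ℝ)+1)))).const_smul (((n:ℝ)+1)^2)).const_smul (3/4:ℝ))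
    (fun t x z => by
      have h1 := (((dq_lim su.dz.dz t x z).pow 2).add ((dq_lim su.dx t x z).pow 2)).const_mul (3/4*(1+z^2))
      rw [su.dz.xz, su.xz] at h1
      refine (h1.congr fun n => ?_).trans (le_of_eq ?_)
      · simp only [dD, dq_z su, dq_z su.dz, dq_x su]; ring
      · congr 1; simp only [dD]; ring) s T
  have e1 : ∀ (k : ℝ) (_ : 0 ≤ k) (g : ℝ → ℝ → ℝ), ∫⁻ x, ∫⁻ z in Ioi (0:ℝ), ofReal (k * g x z) = ofReal k * ∫⁻ x, ∫⁻ z in Ioi (0:ℝ), ofReal (g x z) := by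
    intro k hk g
    simp_rw [lint_mulc hk]
    exact lintegral_const_mul' _ _ ofReal_ne_top
  have p1 : ∀ n : ℕ, (0:ℝ) ≤ ((n:ℝ)+1)^2 := fun n => by positivity
  simp_rw [e1 _ (p1 _), eD_E0 su.dx, fun n : ℕ => eD_E0 (su.dq (1/((n:ℝ)+1)))] at L1
  simp_rw [e1 (3/4) (by norm_num), e1 _ (p1 _), lintegral_const_mul' _ _ ofReal_ne_top, dD_D0 su.dx, fun n : ℕ => dD_D0 (su.dq (1/((n:ℝ)+1)))] at L2
  refine lsum L1 L2 fun n => ?_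
  have n1 : (0:ℝ) < 1/((n:ℝ)+1) := by positivity
  have := mul_le_mul_right (star_h H ha ha2 hs hsT bu buz fD fv hm0 hm n1) (ofReal (((n:ℝ)+1)^2))
  rw [← mul_assoc (ofReal (((n:ℝ)+1)^2)) (ofReal ((1/((n:ℝ)+1))^2)), ← ofReal_mul (p1 n)] at this
  have e : ((n:ℝ)+1)^2 * (1/((n:ℝ)+1))^2 = 1 := by field_simp
  rw [e, ENNReal.ofReal_one, one_mul] at this
  refine le_trans (le_of_eq ?_) this
  ring

def jc (c z : ℝ) : ℝ := (1 + (c * z)^2)⁻¹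
theorem jc_ne (c z : ℝ) : 1 + (c * z)^2 ≠ 0 := by positivity
theorem jc_mul (c z : ℝ) : jc c z * (1 + (c * z)^2) = 1 := inv_mul_cancel₀ (jc_ne c z)
theorem jc_pos (c z : ℝ) : 0 < jc c z := by unfold jc; positivity
@[fun_prop] theorem jc_c (c : ℝ) : Continuous (jc c) := by
  unfold jc; exact Continuous.inv₀ (by fun_prop) (jc_ne c)
theorem jc_d (c z : ℝ) : HasDerivAt (jc c) (-(2 * c^2 * z * jc c z ^ 2)) z := by
  have := (((hasDerivAt_id z).const_mul c).pow 2).const_add 1 |>.inv (jc_ne c z)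
  refine HasDerivAt.congr_deriv this ?_
  simp [jc]; field_simp

def AA (c z : ℝ) : ℝ := 1 + z^2 * jc c z
def BA (c z : ℝ) : ℝ := 2 * jc c z ^ 2
def BA1 (c z : ℝ) : ℝ := -(8 * c^2 * z * jc c z ^ 3)
def tb (k z : ℝ) : ℝ := -6 * k * (1 - k * z^2)^2
def tb1 (k z : ℝ) : ℝ := 24 * k^2 * z * (1 - k * z^2)
def fi (c k z : ℝ) : ℝ := AA c z * th k z
def bb (c k z : ℝ) : ℝ := BA c z * th k z + AA c z * tb k z
def bb1 (c k z : ℝ) : ℝ := BA1 c z * th k z + BA c z * (z * tb k z) + z * BA c z * tb k z + AA c z * tb1 k z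
def be (c k z : ℝ) : ℝ := BA c z * th k z
def be1 (c k z : ℝ) : ℝ := BA1 c z * th k z + BA c z * (z * tb k z)

theorem AA_d (c z : ℝ) : HasDerivAt (AA c) (z * BA c z) z := by
  have := (((hasDerivAt_id z).pow 2).mul (jc_d c z)).const_add 1
  refine HasDerivAt.congr_deriv this ?_
  have h := jc_mul c z
  simp [BA]
  linear_combination (-(2 * z * jc c z)) * h
theorem BA_d (c z : ℝ) : HasDerivAt (BA c) (BA1 c z) z := by
  have := ((jc_d c z).pow 2).const_mul 2
  refine HasDerivAt.congr_deriv this ?_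
  simp [BA1]; ring
theorem tb_d (k z : ℝ) : HasDerivAt (tb k) (tb1 k z) z := by
  have := (((((hasDerivAt_id z).pow 2).const_mul k).const_sub 1).pow 2).const_mul (-6*k)
  refine HasDerivAt.congr_deriv this ?_
  simp [tb1]; ring
theorem th_d' (k z : ℝ) : HasDerivAt (th k) (z * tb k z) z := (th_d k z).congr_deriv (by unfold th1 tb; ring)
theorem fi_d (c k z : ℝ) : HasDerivAt (fi c k) (z * bb c k z) z :=
  ((AA_d c z).mul (th_d' k z)).congr_deriv (by unfold bb; ring)
theorem be_d (c k z : ℝ) : HasDerivAt (be c k) (be1 c k z) z :=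
  ((BA_d c z).mul (th_d' k z)).congr_deriv (by unfold be1; ring)
theorem bb_d (c k z : ℝ) : HasDerivAt (bb c k) (bb1 c k z) z :=
  (((BA_d c z).mul (th_d' k z)).add ((AA_d c z).mul (tb_d k z))).congr_deriv (by unfold bb1; ring)
@[fun_prop] theorem AA_c (c : ℝ) : Continuous (AA c) := by unfold AA; fun_prop
@[fun_prop] theorem BA_c (c : ℝ) : Continuous (BA c) := by unfold BA; fun_prop
@[fun_prop] theorem BA1_c (c : ℝ) : Continuous (BA1 c) := by unfold BA1; fun_prop
@[fun_prop] theorem tb_c (c : ℝ) : Continuous (tb c) := by unfold tb; fun_prop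
@[fun_prop] theorem tb1_c (c : ℝ) : Continuous (tb1 c) := by unfold tb1; fun_prop
@[fun_prop] theorem fi_c (c k : ℝ) : Continuous (fi c k) := by unfold fi; fun_prop
@[fun_prop] theorem bb_c (c k : ℝ) : Continuous (bb c k) := by unfold bb; fun_prop
@[fun_prop] theorem bb1_c (c k : ℝ) : Continuous (bb1 c k) := by unfold bb1; fun_prop
@[fun_prop] theorem be_c (c k : ℝ) : Continuous (be c k) := by unfold be; fun_prop
@[fun_prop] theorem be1_c (c k : ℝ) : Continuous (be1 c k) := by unfold be1; fun_prop

theorem jc_le (c z : ℝ) : jc c z ≤ 1 := by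
  have := jc_mul c z; have := jc_pos c z; nlinarith [sq_nonneg (c*z)]
theorem AA_b (c z : ℝ) : 1 ≤ AA c z ∧ AA c z ≤ 1 + z^2 := by
  have := jc_pos c z; have := jc_le c z
  unfold AA; constructor <;> nlinarith [sq_nonneg z]
theorem AA_c2 {c : ℝ} (hc : 0 < c) (z : ℝ) : AA c z ≤ 1 + 1/c^2 := by
  have h1 := jc_pos c z; have h2 := jc_mul c z
  unfold AA
  have : z^2 * jc c z ≤ 1/c^2 := by
    rw [le_div_iff₀ (by positivity)]
    nlinarith
  linarith

set_option maxHeartbeats 1000000 in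
theorem wtb {c k z : ℝ} (hc : 0 ≤ c) (hc1 : c ≤ 1) (hk : 0 ≤ k) (hk1 : k ≤ 1) (hz : 0 ≤ z) (hy : k * z^2 ≤ 1) :
    0 ≤ fi c k z ∧ fi c k z ≤ 1 + z^2 ∧ |bb c k z| ≤ 14 ∧ |bb1 c k z| ≤ 80 ∧ |z * bb1 c k z| ≤ 80 ∧ |AA c z * tb k z| ≤ 6 * k * AA c z ∧ be1 c k z ≤ 0 := by
  obtain ⟨a1, a2⟩ := AA_b c z
  have j0 := jc_pos c z
  have j1 := jc_le c z
  have jm := jc_mul c z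
  have kz : 0 ≤ k * z^2 := by positivity
  have y0 : 0 ≤ 1 - k * z^2 := by linarith
  have y1 : 1 - k * z^2 ≤ 1 := by linarith
  have t0 : 0 ≤ th k z := by unfold th; positivity
  have t1 : th k z ≤ 1 := by unfold th; exact pow_le_one₀ y0 y1
  have y2 : (1 - k * z^2)^2 ≤ 1 := pow_le_one₀ y0 y1
  have tbn : tb k z ≤ 0 := by unfold tb; nlinarith [mul_nonneg hk (sq_nonneg (1 - k*z^2))]
  have tbl : -(6 * k) ≤ tb k z := by unfold tb; nlinarith
  have B0 : 0 ≤ BA c z := by unfold BA; positivity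
  have B2 : BA c z ≤ 2 := by unfold BA; nlinarith [pow_le_one₀ j0.le j1 (n := 2)]
  have At : |AA c z * tb k z| ≤ 6 * k * AA c z := by
    rw [abs_mul, abs_of_nonneg (by linarith : 0 ≤ AA c z), abs_of_nonpos tbn]; linarith [mul_le_mul_of_nonneg_left tbl (by linarith : 0 ≤ AA c z)]
  have X : (c*z)^2 * jc c z ≤ 1 := by nlinarith
  have n1 : BA1 c z ≤ 0 := by unfold BA1; have : 0 ≤ 8 * c^2 * z * jc c z ^ 3 := by positivity
                              linarith
  have j3 : jc c z ^ 3 ≤ 1 := pow_le_one₀ j0.le j1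
  have j2 : jc c z ^ 2 ≤ 1 := pow_le_one₀ j0.le j1
  have n2 : -BA1 c z ≤ 8 * z := by
    unfold BA1
    have : c^2 ≤ 1 := pow_le_one₀ hc hc1
    calc _ = 8 * z * (c^2 * jc c z ^ 3) := by ring
      _ ≤ 8 * z * (1 * 1) := by gcongr
      _ = _ := by ring
  have n3 : z * (-BA1 c z) ≤ 8 := by
    unfold BA1
    calc _ = 8 * (((c*z)^2 * jc c z) * jc c z ^ 2) := by ring
      _ ≤ 8 * (1 * 1) := by gcongr
      _ = _ := by ring
  have e1 : z * (-tb k z) ≤ 6 * z := by linarith [mul_le_mul_of_nonneg_left (by linarith : -tb k z ≤ 6) hz]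
  have e2 : z * (z * (-tb k z)) ≤ 6 := by linarith [mul_le_mul_of_nonneg_left tbl (sq_nonneg z)]
  have q0 : 0 ≤ tb1 k z := by unfold tb1; positivity
  have q1 : AA c z * tb1 k z ≤ 48 * z := by
    unfold tb1
    calc _ ≤ (1 + z^2) * (24 * k^2 * z * 1) := by gcongr
      _ = 24 * z * (k * k + k * (k * z^2)) := by ring
      _ ≤ 24 * z * (1 * 1 + 1 * 1) := by gcongr
      _ = _ := by ring
  have q2 : z * (AA c z * tb1 k z) ≤ 48 := by
    unfold tb1
    calc _ ≤ z * ((1 + z^2) * (24 * k^2 * z * 1)) := by gcongr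
      _ = 24 * (k * (k * z^2) + (k * z^2) * (k * z^2)) := by ring
      _ ≤ 24 * (1 * 1 + 1 * 1) := by gcongr
      _ = _ := by ring
  have A0 : 0 ≤ AA c z := by linarith
  have tbp : 0 ≤ -tb k z := by linarith
  have f1 : BA c z * (z * (-tb k z)) ≤ 2 * (6 * z) := by gcongr
  have f2 : z * (BA c z * (z * (-tb k z))) ≤ 2 * 6 := by
    calc _ = BA c z * (z * (z * (-tb k z))) := by ring
      _ ≤ _ := by gcongr
  have f0 : 0 ≤ BA c z * (z * (-tb k z)) := by positivity
  have g0 : 0 ≤ (-BA1 c z) * th k z := mul_nonneg (by linarith) t0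
  have g1 : (-BA1 c z) * th k z ≤ 8 * z * 1 := mul_le_mul n2 t1 t0 (by positivity)
  have g2 : z * ((-BA1 c z) * th k z) ≤ 8 := by
    calc _ = (z * (-BA1 c z)) * th k z := by ring
      _ ≤ 8 * 1 := mul_le_mul n3 t1 t0 (by norm_num)
      _ = 8 := by ring
  have h0 : 0 ≤ AA c z * tb1 k z := by positivity
  have F : bb1 c k z = -((-BA1 c z) * th k z) - 2 * (BA c z * (z * (-tb k z))) + AA c z * tb1 k z := by unfold bb1; ring
  have F1 : |bb1 c k z| ≤ 80 * z := by rw [F, abs_le]; constructor <;> linarith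
  have F2 : |z * bb1 c k z| ≤ 80 := by
    have z1 := mul_nonneg hz f0
    have z2 := mul_nonneg hz g0
    have z3 := mul_nonneg hz h0
    have F' : z * bb1 c k z = -(z * ((-BA1 c z) * th k z)) - 2 * (z * (BA c z * (z * (-tb k z)))) + z * (AA c z * tb1 k z) := by rw [F]; ring
    rw [F', abs_le]; constructor <;> linarith
  refine ⟨by unfold fi; positivity, ?_, ?_, ?_, F2, At, ?_⟩
  · exact (mul_le_of_le_one_right A0 t1).trans a2
  · have : 6 * k * AA c z ≤ 12 := by linarith [mul_le_mul_of_nonneg_left a2 hk]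
    have h := abs_le.1 At
    have h5 : BA c z * th k z ≤ 2 * 1 := by gcongr
    have h6 : 0 ≤ BA c z * th k z := by positivity
    unfold bb; rw [abs_le]; constructor <;> linarith [h.1, h.2]
  · rcases le_total z 1 with h | h
    · linarith
    · rw [abs_mul, abs_of_nonneg hz] at F2
      exact (le_mul_of_one_le_left (abs_nonneg _) h).trans F2
  · unfold be1; nlinarith

theorem G_nonneg {p q : ℝ → ℝ} (cq : Continuous q) (hp : ∀ z, HasDerivAt p (z * q z) z) (p0 : p 0 = 0) {z : ℝ} (hz : 0 ≤ z) :
    0 ≤ ∫ s in (0:ℝ)..z, q s * p s := by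
  have cp : Continuous p := continuous_iff_continuousAt.2 fun z => (hp z).continuousAt
  set G := ∫ s in (0:ℝ)..z, q s * p s
  set J := ∫ s in (0:ℝ)..z, q s ^ 2
  have J0 : 0 ≤ J := intervalIntegral.integral_nonneg hz fun _ _ => sq_nonneg _
  have key : ∀ ε > 0, 0 ≤ G + ε^2/2 * J := by
    intro ε he
    have hd : ∀ s ∈ uIcc 0 z, HasDerivAt (fun s => 1/2 * (p s ^ 2 * (s + ε)⁻¹)) (p s * (s * q s) * (s+ε)⁻¹ - 1/2 * (p s ^ 2 * ((s+ε)⁻¹)^2)) s := by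
      intro s hs
      rw [uIcc_of_le hz] at hs
      have ne : s + ε ≠ 0 := by have := hs.1; positivity
      have := (((hp s).pow 2).mul (((hasDerivAt_id s).add_const ε).inv ne)).const_mul (1/2)
      refine HasDerivAt.congr_deriv this ?_
      simp; field_simp; ring
    have ci : ContinuousOn (fun s : ℝ => (s+ε)⁻¹) (Icc 0 z) := by
      apply ContinuousOn.inv₀ (by fun_prop)
      intro s hs; have := hs.1; positivity
    have c1 : ContinuousOn (fun s => p s * (s * q s) * (s+ε)⁻¹ - 1/2 * (p s ^ 2 * ((s+ε)⁻¹)^2)) (Icc 0 z) := by fun_prop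
    have ft := intervalIntegral.integral_eq_sub_of_hasDerivAt hd (ContinuousOn.intervalIntegrable (by rwa [uIcc_of_le hz]))
    have mono : (∫ s in (0:ℝ)..z, p s * (s * q s) * (s+ε)⁻¹ - 1/2 * (p s ^ 2 * ((s+ε)⁻¹)^2)) ≤ ∫ s in (0:ℝ)..z, (q s * p s + ε^2/2 * q s^2) := by
      apply intervalIntegral.integral_mono_on hz (ContinuousOn.intervalIntegrable (by rwa [uIcc_of_le hz])) (Continuous.intervalIntegrable (by fun_prop) _ _)
      intro s hs
      have ne : 0 < s + ε := by have := hs.1; positivity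
      have h : (s+ε) * (s+ε)⁻¹ = 1 := mul_inv_cancel₀ ne.ne'
      have : q s * p s + ε^2/2 * q s^2 - (p s * (s * q s) * (s+ε)⁻¹ - 1/2 * (p s ^ 2 * ((s+ε)⁻¹)^2)) = 1/2 * (ε * q s + p s * (s+ε)⁻¹)^2 := by
        linear_combination (-(q s * p s)) * h
      nlinarith [sq_nonneg (ε * q s + p s * (s+ε)⁻¹)]
    rw [intervalIntegral.integral_add (Continuous.intervalIntegrable (by fun_prop) _ _) (Continuous.intervalIntegrable (by fun_prop) _ _),
      intervalIntegral.integral_const_mul, ft, p0] at mono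
    have : 0 ≤ p z ^ 2 * (z+ε)⁻¹ := by positivity
    simp only [G, J]
    nlinarith
  have lim : Tendsto (fun ε : ℝ => G + ε^2/2 * J) (nhdsWithin 0 (Ioi 0)) (nhds (G + 0^2/2 * J)) := by
    apply Tendsto.mono_left _ nhdsWithin_le_nhds
    exact Continuous.tendsto (by fun_prop) 0
  have := ge_of_tendsto lim (eventually_nhdsWithin_of_forall fun ε he => key ε he)
  simpa using this

def Bp1 (z φ b b1 β β1 U q y y2 y3 g gz p G w wz : ℝ) : ℝ :=
  z * b * U * g + φ * y * g + φ * U * gz - β1 * G - β * q * p + z * b * y * y2 + φ * (y2^2 + y * y3) - 1/2 * (b + z * b1) * y^2 - z * b * y * y2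
  + b1 * U * y + b * y^2 + b * U * y2 - 1/2 * (z * b * w * y^2 + φ * wz * y^2 + 2 * φ * w * y * y2) - 1/2 * (b1 * w * U^2 + b * wz * U^2 + 2 * b * w * U * y)

def Rest1 (z b b1 β1 β2 U q y p G w : ℝ) : ℝ :=
  β1 * G - β2 * q * p + 1/2 * (b + z * b1) * y^2 - b * y^2 - b1 * U * y + 1/2 * z * b * w * y^2 + 1/2 * b1 * w * U^2

theorem ident1 {z φ b b1 β β1 β2 U q y y2 y3 g gz p px G w wz fx uxx uxz ut utz : ℝ} (hut : ut = -(U * q) - w * y + y2 + fx)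
    (hutz : utz = -(U * uxz) - w * y2 + y3 + g) (hgz : gz = -uxx) (hwz : wz = -q) (hpx : px = fx - z * g) (hb : b = β + β2) :
    (φ * (y * utz) + b * (U * ut)) + φ * (q^2 + y2^2) - (φ * (q^2 + U * uxx) + b * (q * p + U * px) - 1/2 * (φ * (q * y^2 + U * (2 * y * uxz))) - 1/2 * (b * (3 * U^2 * q)))
    = Bp1 z φ b b1 β β1 U q y y2 y3 g gz p G w wz + Rest1 z b b1 β1 β2 U q y p G w := by
  subst hut hutz hgz hwz hpx hb; unfold Bp1 Rest1; ring

theorem tbS {S : ℝ} (hS : 0 < S) : tb (1/S^2) S = 0 := by unfold tb; field_simp; simp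

theorem Bint1 {c S : ℝ} (hS : 0 < S) {U y y2 y3 g gz p q G w wz : ℝ → ℝ}
    (hU : ∀ z, HasDerivAt U (y z) z) (hy : ∀ z, HasDerivAt y (y2 z) z) (hy2 : ∀ z, HasDerivAt y2 (y3 z) z)
    (hg : ∀ z, HasDerivAt g (gz z) z) (hG : ∀ z, HasDerivAt G (q z * p z) z) (hw : ∀ z, HasDerivAt w (wz z) z)
    (cy3 : Continuous y3) (cgz : Continuous gz) (cq : Continuous q) (cp : Continuous p) (cwz : Continuous wz)
    (U0 : U 0 = 0) (y20 : y2 0 = 0) (w0 : w 0 = 0) (G0 : G 0 = 0) :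
    ∫ z in (0:ℝ)..S, Bp1 z (fi c (1/S^2) z) (bb c (1/S^2) z) (bb1 c (1/S^2) z) (be c (1/S^2) z) (be1 c (1/S^2) z)
      (U z) (q z) (y z) (y2 z) (y3 z) (g z) (gz z) (p z) (G z) (w z) (wz z) = 0 := by
  set k := 1/S^2 with hk
  have cU : Continuous U := continuous_iff_continuousAt.2 fun z => (hU z).continuousAt
  have cy : Continuous y := continuous_iff_continuousAt.2 fun z => (hy z).continuousAt
  have cy2 : Continuous y2 := continuous_iff_continuousAt.2 fun z => (hy2 z).continuousAt
  have cg : Continuous g := continuous_iff_continuousAt.2 fun z => (hg z).continuousAt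
  have cG : Continuous G := continuous_iff_continuousAt.2 fun z => (hG z).continuousAt
  have cw : Continuous w := continuous_iff_continuousAt.2 fun z => (hw z).continuousAt
  have hd : ∀ z, HasDerivAt (fun z => fi c k z * (U z * g z) - be c k z * G z + fi c k z * (y z * y2 z) - 1/2 * (z * bb c k z * y z ^ 2)
      + bb c k z * (U z * y z) - 1/2 * (fi c k z * (w z * y z ^ 2)) - 1/2 * (bb c k z * (w z * U z ^ 2)))
      (Bp1 z (fi c k z) (bb c k z) (bb1 c k z) (be c k z) (be1 c k z)
      (U z) (q z) (y z) (y2 z) (y3 z) (g z) (gz z) (p z) (G z) (w z) (wz z)) z := by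
    intro z
    have a1 := (fi_d c k z).mul ((hU z).mul (hg z))
    have a2 := (be_d c k z).mul (hG z)
    have a3 := (fi_d c k z).mul ((hy z).mul (hy2 z))
    have a4 := (((hasDerivAt_id z).mul (bb_d c k z)).mul ((hy z).pow 2)).const_mul (1/2)
    have a5 := (bb_d c k z).mul ((hU z).mul (hy z))
    have a6 := ((fi_d c k z).mul ((hw z).mul ((hy z).pow 2))).const_mul (1/2)
    have a7 := ((bb_d c k z).mul ((hw z).mul ((hU z).pow 2))).const_mul (1/2)
    refine HasDerivAt.congr_deriv (((((((a1.sub a2).add a3).sub a4).add a5).sub a6).sub a7)) ?_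
    simp [Bp1]; ring
  rw [intervalIntegral.integral_eq_sub_of_hasDerivAt (fun z _ => hd z) (Continuous.intervalIntegrable (by unfold Bp1; fun_prop) _ _)]
  have t1 := (th_S hS).1
  have t2 := tbS hS
  rw [← hk] at t1 t2
  have f1 : fi c k S = 0 := by unfold fi; rw [t1, mul_zero]
  have f2 : bb c k S = 0 := by unfold bb; rw [t1, t2]; ring
  have f3 : be c k S = 0 := by unfold be; rw [t1, mul_zero]
  simp [f1, f2, f3, U0, y20, w0, G0]

theorem p_sq {p q : ℝ → ℝ} (cq : Continuous q) (hp : ∀ z, HasDerivAt p (z * q z) z) (p0 : p 0 = 0) {z : ℝ} (hz : 0 ≤ z) :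
    p z ^ 2 ≤ z^2/2 * ∫ s in (0:ℝ)..z, s * q s ^ 2 := by
  have e : p z = ∫ s in (0:ℝ)..z, s * q s := by
    rw [intervalIntegral.integral_eq_sub_of_hasDerivAt (fun z _ => hp z) (Continuous.intervalIntegrable (by fun_prop) _ _), p0, sub_zero]
  have cs := cs_ii hz (f := fun s => Real.sqrt s) (g := fun s => Real.sqrt s * q s) (by fun_prop) (by fun_prop)
  have e1 : (∫ s in (0:ℝ)..z, Real.sqrt s * (Real.sqrt s * q s)) = p z := by
    rw [e]; apply intervalIntegral.integral_congr
    intro s hs; rw [uIcc_of_le hz] at hs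
    simp only [← mul_assoc, Real.mul_self_sqrt hs.1]
  have e2 : (∫ s in (0:ℝ)..z, Real.sqrt s ^ 2) = z^2/2 := by
    rw [intervalIntegral.integral_congr (g := fun s => s)]
    · simp
    · intro s hs; rw [uIcc_of_le hz] at hs; exact Real.sq_sqrt hs.1
  have e3 : (∫ s in (0:ℝ)..z, (Real.sqrt s * q s) ^ 2) = ∫ s in (0:ℝ)..z, s * q s^2 := by
    apply intervalIntegral.integral_congr
    intro s hs; rw [uIcc_of_le hz] at hs
    simp only [mul_pow, Real.sq_sqrt hs.1]
  rw [e1, e2, e3] at cs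
  exact cs

theorem ii_sub_r {f : ℝ → ℝ} {a b c : ℝ} (hac : a ≤ c) (hcb : c ≤ b) (hf : Continuous f)
    (h0 : ∀ x ∈ Icc a b, 0 ≤ f x) : (∫ x in a..c, f x) ≤ ∫ x in a..b, f x := by
  rw [← intervalIntegral.integral_add_adjacent_intervals (hf.intervalIntegrable a c) (hf.intervalIntegrable c b)]
  have : 0 ≤ ∫ x in c..b, f x := intervalIntegral.integral_nonneg hcb fun x hx => h0 x ⟨hac.trans hx.1, hx.2⟩
  linarith

theorem rest_pt1 {z b b1 U y w J : ℝ} (hz : 0 ≤ z) (hb : |b| ≤ 14) (hb1 : |b1| ≤ 80) (hzb : |z * b1| ≤ 80) (hw : w^2 ≤ z * J) (hJ : 0 ≤ J) :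
    1/2 * (b + z * b1) * y^2 - b * y^2 - b1 * U * y + 1/2 * z * b * w * y^2 + 1/2 * b1 * w * U^2 ≤ 200 * (1 + J) * (U^2 + (1+z^2) * y^2) := by
  have h1 : 1/2 * (b + z * b1) * y^2 - b * y^2 ≤ 61 * y^2 := by
    have := abs_le.1 hb; have := abs_le.1 hzb; nlinarith [sq_nonneg y]
  have h2 : -(b1 * U * y) ≤ 40 * (U^2 + y^2) := by
    have := abs_le.1 hb1
    nlinarith [mul_nonneg (by linarith : 0 ≤ 80 - b1) (sq_nonneg (U - y)), mul_nonneg (by linarith : 0 ≤ 80 + b1) (sq_nonneg (U + y)), mul_nonneg (by linarith : 0 ≤ 80 - b1) (sq_nonneg (U + y)), mul_nonneg (by linarith : 0 ≤ 80 + b1) (sq_nonneg (U - y))]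
  have h3 : |z * w| ≤ (1 + J) * (1 + z^2) := by
    apply abs_le_of_sq_le_sq _ (by positivity)
    have a1 : z^3 ≤ (1+z^2)^2 := by nlinarith [sq_nonneg (z-1), sq_nonneg (z^2), mul_nonneg hz (sq_nonneg (z-1)), sq_nonneg (z^2-z)]
    have a2 : J ≤ (1+J)^2 := by nlinarith
    calc _ = z^2 * w^2 := by ring
      _ ≤ z^2 * (z * J) := by gcongr
      _ = J * z^3 := by ring
      _ ≤ (1+J)^2 * (1+z^2)^2 := by gcongr
      _ = _ := by ring
  have h4 : |b1 * w| ≤ 80 * (1 + J) := by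
    apply abs_le_of_sq_le_sq _ (by positivity)
    have a2 : J ≤ (1+J)^2 := by nlinarith
    calc _ = b1^2 * w^2 := by ring
      _ ≤ b1^2 * (z * J) := by gcongr
      _ = b1 * (z * b1) * J := by ring
      _ ≤ |b1 * (z * b1)| * J := by gcongr; exact le_abs_self _
      _ ≤ (80 * 80) * J := by rw [abs_mul]; gcongr
      _ ≤ (80 * 80) * (1 + J)^2 := by gcongr
      _ = _ := by ring
  have h5 : 1/2 * z * b * w * y^2 ≤ 7 * ((1 + J) * (1 + z^2)) * y^2 := by
    have : b * (z * w) ≤ 14 * ((1 + J) * (1 + z^2)) := (le_abs_self _).trans (by rw [abs_mul]; gcongr)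
    nlinarith [sq_nonneg y]
  have h6 : 1/2 * b1 * w * U^2 ≤ 40 * (1 + J) * U^2 := by
    have := abs_le.1 h4; nlinarith [sq_nonneg U]
  have k1 : 0 ≤ J * U^2 := by positivity
  have k2 : 0 ≤ J * ((1 + z^2) * y^2) := by positivity
  have k3 : 0 ≤ z^2 * y^2 := by positivity
  nlinarith [sq_nonneg U, sq_nonneg y]

set_option maxHeartbeats 1000000 in
theorem Rint1 {c S : ℝ} (hc : 0 < c) (hc1 : c ≤ 1) (hS : 1 ≤ S) {U y p q w : ℝ → ℝ}
    (cU : Continuous U) (cy : Continuous y) (cq : Continuous q) (hp : ∀ z, HasDerivAt p (z * q z) z) (p0 : p 0 = 0)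
    (cw : Continuous w) (hw : ∀ z ∈ Icc 0 S, w z ^ 2 ≤ z * ∫ s in (0:ℝ)..z, q s ^ 2) :
    ∫ z in (0:ℝ)..S, Rest1 z (bb c (1/S^2) z) (bb1 c (1/S^2) z) (be1 c (1/S^2) z) (AA c z * tb (1/S^2) z) (U z) (q z) (y z) (p z) (∫ s in (0:ℝ)..z, q s * p s) (w z)
    ≤ 200 * (1 + ∫ s in (0:ℝ)..S, q s ^ 2) * (∫ s in (0:ℝ)..S, (U s^2 + (1+s^2) * y s^2)) + 3 * (1 + 1/c^2) * ∫ s in (0:ℝ)..S, s / S * q s^2 := by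
  have S0 : 0 < S := by linarith
  have cp : Continuous p := continuous_iff_continuousAt.2 fun z => (hp z).continuousAt
  set J := ∫ s in (0:ℝ)..S, q s ^ 2 with hJ
  set I := ∫ s in (0:ℝ)..S, s * q s ^ 2 with hI
  set k := 1/S^2 with hk
  set L := ∫ s in (0:ℝ)..S, (U s^2 + (1+s^2) * y s^2) with hL
  have J0 : 0 ≤ J := intervalIntegral.integral_nonneg S0.le fun _ _ => sq_nonneg _
  have I0 : 0 ≤ I := intervalIntegral.integral_nonneg S0.le fun s hs => mul_nonneg hs.1 (sq_nonneg _)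
  have k1 : k ≤ 1 := by rw [hk, div_le_one (by positivity)]; nlinarith
  have k0 : 0 < k := by positivity
  have cG : Continuous fun z => ∫ s in (0:ℝ)..z, q s * p s := intervalIntegral.continuous_primitive (fun a b => Continuous.intervalIntegrable (by fun_prop) _ _) 0
  have mono : ∀ z ∈ Icc 0 S, Rest1 z (bb c k z) (bb1 c k z) (be1 c k z) (AA c z * tb k z) (U z) (q z) (y z) (p z) (∫ s in (0:ℝ)..z, q s * p s) (w z)
      ≤ 200 * (1 + J) * (U z^2 + (1+z^2) * y z^2) + 6 * k * (1 + 1/c^2) * (S/4 * (z * q z^2) + I/(2*S) * z) := by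
    intro z hz
    obtain ⟨_, b2, _⟩ := th_pos S0 hz
    obtain ⟨_, _, w3, w4, w5, w6, w7⟩ := wtb hc.le hc1 k0.le k1 hz.1 b2
    have g0 := G_nonneg cq hp p0 hz.1
    have r := rest_pt1 (U := U z) (y := y z) (w := w z) (J := J) hz.1 w3 w4 w5 ((hw z hz).trans (mul_le_mul_of_nonneg_left (ii_sub_r (f := fun s => q s^2) hz.1 hz.2 (by fun_prop) (fun _ _ => sq_nonneg _)) hz.1)) J0
    have hq : |q z * p z| ≤ S/4 * (z * q z^2) + I/(2*S) * z := by
      have pq : p z ^ 2 ≤ z^2/2 * I := by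
        refine (p_sq cq hp p0 hz.1).trans ?_
        have := ii_sub_r (f := fun s => s * q s^2) hz.1 hz.2 (by fun_prop) (fun s hs => mul_nonneg hs.1 (sq_nonneg _))
        gcongr
      rcases hz.1.eq_or_lt with h | h
      · rw [← h, p0]; simp
      · have : p z^2 / (S * z) ≤ I/(2*S) * z := by
          rw [div_le_iff₀ (by positivity)]
          refine pq.trans (le_of_eq ?_); field_simp
        refine le_trans ?_ (add_le_add_right this _)
        have e1 : S/4 * (z * q z^2) + p z^2/(S*z) - q z * p z = (S * z * q z / 2 - p z)^2 / (S * z) := by field_simp; ring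
        have e2 : S/4 * (z * q z^2) + p z^2/(S*z) + q z * p z = (S * z * q z / 2 + p z)^2 / (S * z) := by field_simp; ring
        have n1 : 0 ≤ (S * z * q z / 2 - p z)^2 / (S * z) := by positivity
        have n2 : 0 ≤ (S * z * q z / 2 + p z)^2 / (S * z) := by positivity
        rw [abs_le]; constructor <;> linarith
    have h3 : -(AA c z * tb k z * q z * p z) ≤ 6 * k * (1 + 1/c^2) * (S/4 * (z * q z^2) + I/(2*S) * z) := by
      calc _ ≤ |AA c z * tb k z * q z * p z| := neg_le_abs _
        _ = |AA c z * tb k z| * |q z * p z| := by rw [← abs_mul]; ring_nf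
        _ ≤ (6 * k * AA c z) * (S/4 * (z * q z^2) + I/(2*S) * z) := mul_le_mul w6 hq (abs_nonneg _) (mul_nonneg (by positivity) (by linarith [(AA_b c z).1]))
        _ ≤ _ := by
          have := AA_c2 hc z
          have hz0 := hz.1
          gcongr
    have h4 : be1 c k z * (∫ s in (0:ℝ)..z, q s * p s) ≤ 0 := mul_nonpos_of_nonpos_of_nonneg w7 g0
    unfold Rest1
    linarith
  refine (intervalIntegral.integral_mono_on S0.le (Continuous.intervalIntegrable (by unfold Rest1; fun_prop) _ _) (Continuous.intervalIntegrable (by fun_prop) _ _) mono).trans (le_of_eq ?_)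
  rw [intervalIntegral.integral_add (Continuous.intervalIntegrable (by fun_prop) _ _) (Continuous.intervalIntegrable (by fun_prop) _ _),
    intervalIntegral.integral_const_mul, intervalIntegral.integral_const_mul, ← hL,
    intervalIntegral.integral_add (Continuous.intervalIntegrable (by fun_prop) _ _) (Continuous.intervalIntegrable (by fun_prop) _ _),
    intervalIntegral.integral_const_mul, intervalIntegral.integral_const_mul, ← hI, integral_id]
  have : (∫ s in (0:ℝ)..S, s / S * q s^2) = I / S := by
    rw [hI, ← intervalIntegral.integral_div]; congr 1; ext s; ring
  rw [this, hk]; congr 1; field_simp; ring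

def pp (f : ℝ → ℝ → ℝ → ℝ) (t x z : ℝ) : ℝ := f t x z - z * dz f t x z
def mZ (S z : ℝ) : ENNReal := if z ≤ S then ofReal (z / S) else 0
def g1 (a c S : ℝ) (u : ℝ → ℝ → ℝ → ℝ) (t x : ℝ) : ENNReal :=
  ofReal 200 * (QQ r0 (u t) x + QQ r2 (dz u t) x) + ofReal (400 * a^2) * QQ r0 (dx u t) x
    + ofReal (3 * (1 + 1/c^2)) * ∫⁻ z in Ioi (0:ℝ), mZ S z * ofReal (dx u t x z ^ 2)

theorem mZ_int {S : ℝ} (hS : 1 ≤ S) {h : ℝ → ℝ} (hc : Continuous h) (h0 : ∀ z, 0 ≤ h z) :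
    ofReal (∫ z in (0:ℝ)..S, z / S * h z) = ∫⁻ z in Ioi (0:ℝ), mZ S z * ofReal (h z) := by
  have S0 : 0 < S := by linarith
  rw [ofReal_ii_eq S0.le (by fun_prop) (fun z hz => mul_nonneg (div_nonneg hz.1 S0.le) (h0 z))]
  have : Ioc 0 S = Iic S ∩ Ioi 0 := by ext z; simp [and_comm]
  rw [this, ← Measure.restrict_restrict measurableSet_Iic, ← lintegral_indicator measurableSet_Iic]
  apply setLIntegral_congr_fun measurableSet_Ioi
  intro z hz
  simp only [indicator, mZ, mem_Iic]
  split_ifs with h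
  · rw [ofReal_mul (div_nonneg (le_of_lt hz) S0.le)]
  · simp

set_option maxHeartbeats 1000000 in
theorem slice1 {u w f : ℝ → ℝ → ℝ → ℝ} (P : Sol u w f) {c S : ℝ} (hc : 0 < c) (hc1 : c ≤ 1) (hS : 1 ≤ S) {a : ℝ} (ha : 0 < a) {t : ℝ} (ht : 0 ≤ t) (x : ℝ)
    (bu : QQ r0 (u t) x ≤ ofReal (a^2)) (buz : QQ r2 (dz u t) x ≤ ofReal (a^2)) :
    ofReal ((∫ z in (0:ℝ)..S, (fi c (1/S^2) z * (dz u t x z * pdt (dz u) t x z) + bb c (1/S^2) z * (u t x z * pdt u t x z)))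
      + (∫ z in (0:ℝ)..S, fi c (1/S^2) z * (dx u t x z ^ 2 + dz (dz u) t x z ^ 2))
      - ∫ z in (0:ℝ)..S, (fi c (1/S^2) z * (dx u t x z ^ 2 + u t x z * dx (dx u) t x z)
          + bb c (1/S^2) z * (dx u t x z * pp f t x z + u t x z * (dx f t x z - z * dx (dz f) t x z))
          - 1/2 * (fi c (1/S^2) z * (dx u t x z * dz u t x z ^ 2 + u t x z * (2 * dz u t x z * dx (dz u) t x z)))
          - 1/2 * (bb c (1/S^2) z * (3 * u t x z ^ 2 * dx u t x z)))) ≤ g1 a c S u t x := by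
  set k := 1/S^2 with hk
  have S0 : 0 < S := by linarith
  have k1 := P.su.c1 t x
  have k2 := P.su.dz.c1 t x
  have k3 := P.su.dz.dz.c1 t x
  have k4 := P.su.dz.dz.dz.c1 t x
  have k5 := P.su.dx.c1 t x
  have k6 := P.su.dx.dx.c1 t x
  have k7 := P.sf.c1 t x
  have k8 := P.sf.dz.c1 t x
  have k9 := P.sf.dz.dz.c1 t x
  have k10 := P.sf.dz.dx.c1 t x
  have k11 := P.sf.dx.c1 t x
  have k12 := P.sf.dz.dx.dz.c1 t x
  have k13 := P.su.dz.dx.c1 t x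
  have k19 := P.su.dt.c1 t x
  have k20 := P.su.dz.dt.c1 t x
  have k21 := P.sw.c1 t x
  have k22 := P.sw.dz.c1 t x
  have kp : Continuous (pp f t x) := by unfold pp; fun_prop
  set q : ℝ → ℝ := fun z => - dz (dz f) t x z with hq
  have cq : Continuous q := by fun_prop
  have qe : ∀ z ≥ 0, q z = dx u t x z := fun z hz => by simp only [hq]; rw [P.fzz t ht x z hz, neg_neg]
  have hp : ∀ z, HasDerivAt (pp f t x) (z * q z) z := by
    intro z
    refine HasDerivAt.congr_deriv ((P.sf.Hz t x z).sub ((hasDerivAt_id z).mul (P.sf.dz.Hz t x z))) ?_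
    simp [hq]
  have p0 : pp f t x 0 = 0 := by simp [pp, P.f0 t ht x]
  have hG : ∀ z, HasDerivAt (fun z => ∫ s in (0:ℝ)..z, q s * pp f t x s) (q z * pp f t x z) z := fun z =>
    intervalIntegral.integral_hasDerivAt_right (Continuous.intervalIntegrable (by fun_prop) _ _)
      (Continuous.stronglyMeasurableAtFilter (by fun_prop) _ _) (by fun_prop)
  have B0 := Bint1 (c := c) S0 (fun z => P.su.Hz t x z) (fun z => P.su.dz.Hz t x z) (fun z => P.su.dz.dz.Hz t x z)
    (fun z => P.sf.dz.dx.Hz t x z) hG (fun z => P.sw.Hz t x z) k4 k12 cq kp k22 (P.u0 t ht x) (P.uzz0 t ht x) (P.w0 t ht x) (by simp)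
  have R0 := Rint1 hc hc1 hS (U := u t x) (y := dz u t x) (w := w t x) k1 k2 cq hp p0 k21 (by
    intro z hz
    rw [prim_eq P.sw P.su.dx (P.wz t ht x) (P.w0 t ht x) hz.1, Pr, neg_sq]
    refine (int_sq k5 hz.1).trans (le_of_eq ?_)
    congr 1
    apply intervalIntegral.integral_congr
    intro s hs; rw [uIcc_of_le hz.1] at hs
    simp only; rw [qe s hs.1])
  rw [← hk] at B0 R0
  have eJ : (∫ s in (0:ℝ)..S, q s ^ 2) = ∫ s in (0:ℝ)..S, dx u t x s ^ 2 := by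
    apply intervalIntegral.integral_congr
    intro s hs; rw [uIcc_of_le S0.le] at hs
    simp only; rw [qe s hs.1]
  have eI : (∫ s in (0:ℝ)..S, s / S * q s ^ 2) = ∫ s in (0:ℝ)..S, s / S * dx u t x s ^ 2 := by
    apply intervalIntegral.integral_congr
    intro s hs; rw [uIcc_of_le S0.le] at hs
    simp only; rw [qe s hs.1]
  rw [eJ, eI] at R0
  have hL : (∫ s in (0:ℝ)..S, (u t x s ^ 2 + (1+s^2) * dz u t x s ^ 2)) ≤ 2 * a^2 := by
    rw [intervalIntegral.integral_add (Continuous.intervalIntegrable (by fun_prop) _ _) (Continuous.intervalIntegrable (by fun_prop) _ _)]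
    have h1 := (Bd_iff (h := fun z => u t x z ^ 2) (by fun_prop) (fun z _ => by positivity) (sq_nonneg a)).1 (by rw [← QQ0]; exact bu) S S0.le
    have h2 := (Bd_iff (h := fun z => (1 + z^2) * dz u t x z ^ 2) (by fun_prop) (fun z _ => by positivity) (sq_nonneg a)).1 (by rw [← QQ2]; exact buz) S S0.le
    simp only at h1 h2
    linarith
  have LE : ofReal (∫ s in (0:ℝ)..S, (u t x s ^ 2 + (1+s^2) * dz u t x s ^ 2)) ≤ QQ r0 (u t) x + QQ r2 (dz u t) x := by
    refine (ofReal_ii_le S0.le _).trans ((lintegral_mono_set Ioc_subset_Ioi_self).trans (le_of_eq ?_))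
    rw [QQ0, QQ2, ← lintegral_add_left (by fun_prop)]
    congr 1; ext z
    rw [ofReal_add (by positivity) (by positivity)]
  have JE : ofReal (∫ s in (0:ℝ)..S, dx u t x s ^ 2) ≤ QQ r0 (dx u t) x := by
    rw [QQ0]
    exact (ofReal_ii_le S0.le _).trans (lintegral_mono_set Ioc_subset_Ioi_self)
  have J0 : 0 ≤ ∫ s in (0:ℝ)..S, dx u t x s ^ 2 := intervalIntegral.integral_nonneg S0.le fun _ _ => sq_nonneg _
  have L0 : 0 ≤ ∫ s in (0:ℝ)..S, (u t x s ^ 2 + (1+s^2) * dz u t x s ^ 2) := intervalIntegral.integral_nonneg S0.le fun _ _ => by positivity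
  have I0 : 0 ≤ ∫ s in (0:ℝ)..S, s / S * dx u t x s ^ 2 := intervalIntegral.integral_nonneg S0.le fun s hs => mul_nonneg (div_nonneg hs.1 S0.le) (sq_nonneg _)
  have fin : ∀ X : ℝ, X ≤ 200 * (1 + ∫ s in (0:ℝ)..S, dx u t x s ^ 2) * (∫ s in (0:ℝ)..S, (u t x s ^ 2 + (1+s^2) * dz u t x s ^ 2)) + 3 * (1 + 1/c^2) * ∫ s in (0:ℝ)..S, s / S * dx u t x s ^ 2 →
      ofReal X ≤ g1 a c S u t x := by
    intro X hX
    unfold g1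
    rw [← mZ_int hS (by fun_prop) (fun z => sq_nonneg _)]
    have h1 : X ≤ 200 * (∫ s in (0:ℝ)..S, (u t x s ^ 2 + (1+s^2) * dz u t x s ^ 2)) + 400 * a^2 * (∫ s in (0:ℝ)..S, dx u t x s ^ 2) + 3 * (1 + 1/c^2) * ∫ s in (0:ℝ)..S, s / S * dx u t x s ^ 2 := by
      nlinarith [mul_nonneg J0 (sub_nonneg.2 hL)]
    refine (ofReal_le_ofReal h1).trans ?_
    rw [ofReal_add (by positivity) (by positivity), ofReal_add (by positivity) (by positivity),
        ofReal_mul (by positivity), ofReal_mul (by positivity), ofReal_mul (p := 3 * (1 + 1/c^2)) (by positivity)]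
    exact add_le_add (add_le_add (mul_le_mul_right LE _) (mul_le_mul_right JE _)) le_rfl
  apply fin
  refine le_trans (le_of_eq ?_) R0
  have cB : Continuous fun z => Bp1 z (fi c k z) (bb c k z) (bb1 c k z) (be c k z) (be1 c k z)
      (u t x z) (q z) (dz u t x z) (dz (dz u) t x z) (dz (dz (dz u)) t x z) (dx (dz f) t x z) (dz (dx (dz f)) t x z) (pp f t x z) (∫ s in (0:ℝ)..z, q s * pp f t x s) (w t x z) (dz w t x z) := by
    have cG : Continuous fun z => ∫ s in (0:ℝ)..z, q s * pp f t x s := continuous_iff_continuousAt.2 fun z => (hG z).continuousAt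
    unfold Bp1; fun_prop
  have cR : Continuous fun z => Rest1 z (bb c k z) (bb1 c k z) (be1 c k z) (AA c z * tb k z) (u t x z) (q z) (dz u t x z) (pp f t x z) (∫ s in (0:ℝ)..z, q s * pp f t x s) (w t x z) := by
    have cG : Continuous fun z => ∫ s in (0:ℝ)..z, q s * pp f t x s := continuous_iff_continuousAt.2 fun z => (hG z).continuousAt
    unfold Rest1; fun_prop
  have key := intervalIntegral.integral_add (cB.intervalIntegrable (μ := volume) 0 S) (cR.intervalIntegrable 0 S)
  rw [B0, zero_add] at key
  rw [← key, ← intervalIntegral.integral_add (Continuous.intervalIntegrable (by fun_prop) _ _) (Continuous.intervalIntegrable (by fun_prop) _ _),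
    ← intervalIntegral.integral_sub (Continuous.intervalIntegrable (by fun_prop) _ _) (Continuous.intervalIntegrable (by fun_prop) _ _)]
  apply intervalIntegral.integral_congr
  intro z hz
  rw [uIcc_of_le S0.le] at hz
  simp only [qe z hz.1]
  exact ident1 (P.ut t ht x z hz.1) (P.utz t ht x z hz.1) (P.fxzz t ht x z hz.1) (P.wz t ht x z hz.1) rfl (by unfold bb be; ring)

def n1 (u : ℝ → ℝ → ℝ → ℝ) (t x z : ℝ) : ℝ := u t x z ^ 2 + dx u t x z ^ 2 + (1 + z^2) * dz u t x z ^ 2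

theorem flux1 {φ b U q y p a z S J : ℝ} (ha : 0 < a) (hφ0 : 0 ≤ φ) (hφ : φ ≤ 1 + z^2) (hb : |b| ≤ 14) (hU : |U| ≤ 2 * a) (hp : p^2 ≤ S^3 * J) (hz : z^2 ≤ S^2) :
    |φ * (U * q) + b * (U * p) - 1/2 * (φ * (U * y^2)) - 1/2 * (b * U^3)| ≤ (1 + S^2) * (8 + 15 * a) * (U^2 + q^2 + (1 + z^2) * y^2) + 7 * (S^3 * J) := by
  have hφS : φ ≤ 1 + S^2 := by linarith
  have h1 : |φ * (U * q)| ≤ (1 + S^2) * (U^2 + q^2) := by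
    rw [abs_mul, abs_of_nonneg hφ0]
    have : |U * q| ≤ U^2 + q^2 := by rw [abs_le]; constructor <;> nlinarith [sq_nonneg (U+q), sq_nonneg (U-q)]
    gcongr
  have h2 : |b * (U * p)| ≤ 14 * (1/2 * (U^2 + p^2)) := by
    rw [abs_mul]
    have : |U * p| ≤ 1/2 * (U^2 + p^2) := by rw [abs_le]; constructor <;> nlinarith [sq_nonneg (U+p), sq_nonneg (U-p)]
    gcongr
  have h3 : |1/2 * (φ * (U * y^2))| ≤ 1/2 * ((1+z^2) * (2 * a * y^2)) := by
    rw [abs_mul, abs_mul, abs_mul, abs_of_nonneg hφ0, abs_of_nonneg (sq_nonneg y), abs_of_nonneg (by norm_num : (0:ℝ) ≤ 1/2)]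
    gcongr
  have h4 : |1/2 * (b * U^3)| ≤ 1/2 * (14 * (2 * a * U^2)) := by
    have : U^3 = U * U^2 := by ring
    rw [this, abs_mul, abs_mul, abs_mul, abs_of_nonneg (sq_nonneg U), abs_of_nonneg (by norm_num : (0:ℝ) ≤ 1/2)]
    gcongr
  have tri : |φ * (U * q) + b * (U * p) - 1/2 * (φ * (U * y^2)) - 1/2 * (b * U^3)| ≤ |φ * (U * q)| + |b * (U * p)| + |1/2 * (φ * (U * y^2))| + |1/2 * (b * U^3)| :=
    (abs_sub _ _).trans (add_le_add_left ((abs_sub _ _).trans (add_le_add_left (abs_add_le _ _) _)) _)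
  refine tri.trans ?_
  have s0 := sq_nonneg S
  have e1 : 0 ≤ S^2 * U^2 := by positivity
  have e2 : 0 ≤ S^2 * q^2 := by positivity
  have e3 : 0 ≤ (1+z^2) * y^2 := by positivity
  have e4 : 0 ≤ S^2 * ((1+z^2) * y^2) := by positivity
  have f0 : 0 ≤ a * U^2 := by positivity
  have f1 : 0 ≤ a * (S^2 * U^2) := by positivity
  have f2 : 0 ≤ a * (S^2 * q^2) := by positivity
  have f3 : 0 ≤ a * ((1+z^2) * y^2) := by positivity
  have f4 : 0 ≤ a * (S^2 * ((1+z^2) * y^2)) := by positivity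
  have f5 : 0 ≤ a * q^2 := by positivity
  nlinarith [sq_nonneg U, sq_nonneg q]

theorem Phi_fin {u w f : ℝ → ℝ → ℝ → ℝ} (P : Sol u w f) {c S : ℝ} (hc : 0 < c) (hc1 : c ≤ 1) (hS : 1 ≤ S) {a : ℝ} (ha : 0 < a) {t : ℝ} (ht : 0 ≤ t) (x : ℝ)
    (buz : QQ r2 (dz u t) x ≤ ofReal (a^2)) :
    ofReal |∫ z in (0:ℝ)..S, (fi c (1/S^2) z * (u t x z * dx u t x z) + bb c (1/S^2) z * (u t x z * pp f t x z) - 1/2 * (fi c (1/S^2) z * (u t x z * dz u t x z ^ 2)) - 1/2 * (bb c (1/S^2) z * u t x z ^ 3))| ≤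
    ofReal ((1 + S^2) * (8 + 15 * a) + 7 * S^4) * (QQ r0 (u t) x + QQ r0 (dx u t) x + QQ r2 (dz u t) x) := by
  have S0 : 0 < S := by linarith
  have k1 := P.su.c1 t x
  have k2 := P.su.dz.c1 t x
  have k5 := P.su.dx.c1 t x
  have k7 := P.sf.c1 t x
  have k8 := P.sf.dz.c1 t x
  have k9 := P.sf.dz.dz.c1 t x
  have kp : Continuous (pp f t x) := by unfold pp; fun_prop
  set k := 1/S^2 with hk
  have kk1 : k ≤ 1 := by rw [hk, div_le_one (by positivity)]; nlinarith
  have kk0 : 0 < k := by positivity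
  set J := ∫ s in (0:ℝ)..S, dx u t x s ^ 2 with hJ
  have J0 : 0 ≤ J := intervalIntegral.integral_nonneg S0.le fun _ _ => sq_nonneg _
  have pb : ∀ z ∈ Icc 0 S, pp f t x z ^ 2 ≤ S^3 * J := by
    intro z hz
    have hp : ∀ z, HasDerivAt (pp f t x) (z * (- dz (dz f) t x z)) z := by
      intro z
      refine HasDerivAt.congr_deriv ((P.sf.Hz t x z).sub ((hasDerivAt_id z).mul (P.sf.dz.Hz t x z))) ?_
      simp
    have h1 := p_sq (q := fun z => - dz (dz f) t x z) (by fun_prop) hp (by simp [pp, P.f0 t ht x]) hz.1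
    have h2 : (∫ s in (0:ℝ)..z, s * (- dz (dz f) t x s) ^ 2) ≤ S * J := by
      rw [hJ, ← intervalIntegral.integral_const_mul]
      refine le_trans ?_ (ii_sub_r (f := fun s => S * dx u t x s ^ 2) hz.1 hz.2 (by fun_prop) fun s _ => by positivity)
      apply ii_mono hz.1 (by fun_prop) (by fun_prop)
      intro s hs
      rw [P.fzz t ht x s hs.1, neg_neg]
      have := hs.2.trans hz.2
      gcongr
    have := hz.1
    have := hz.2
    calc _ ≤ z^2/2 * (S * J) := h1.trans (by gcongr)
      _ ≤ S^2/1 * (S * J) := by gcongr; norm_num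
      _ = _ := by ring
  have main : |∫ z in (0:ℝ)..S, (fi c k z * (u t x z * dx u t x z) + bb c k z * (u t x z * pp f t x z) - 1/2 * (fi c k z * (u t x z * dz u t x z ^ 2)) - 1/2 * (bb c k z * u t x z ^ 3))|
      ≤ ((1 + S^2) * (8 + 15 * a) + 7 * S^4) * ∫ z in (0:ℝ)..S, n1 u t x z := by
    have cn : Continuous (n1 u t x) := by unfold n1; fun_prop
    have m2 : (∫ z in (0:ℝ)..S, |fi c k z * (u t x z * dx u t x z) + bb c k z * (u t x z * pp f t x z) - 1/2 * (fi c k z * (u t x z * dz u t x z ^ 2)) - 1/2 * (bb c k z * u t x z ^ 3)|)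
      ≤ ∫ z in (0:ℝ)..S, ((1 + S^2) * (8 + 15 * a) * n1 u t x z + 7 * (S^3 * J)) := by
      apply ii_mono S0.le (by fun_prop) (by fun_prop)
      intro z hz
      obtain ⟨_, b2, _⟩ := th_pos S0 hz
      obtain ⟨w1, w2, w3, _⟩ := wtb hc.le hc1 kk0.le kk1 hz.1 b2
      refine flux1 ha w1 w2 w3 (sup_abs (fun z => P.su.Hz t x z) k2 (FS_of_tendsto (P.lu t ht x)) ha.le buz hz.1) (pb z hz) ?_
      exact pow_le_pow_left₀ hz.1 hz.2 2
    refine (intervalIntegral.abs_integral_le_integral_abs S0.le).trans (m2.trans ?_)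
    rw [intervalIntegral.integral_add (Continuous.intervalIntegrable (by fun_prop) _ _) (Continuous.intervalIntegrable (by fun_prop) _ _), intervalIntegral.integral_const_mul, intervalIntegral.integral_const]
    have jn : J ≤ ∫ z in (0:ℝ)..S, n1 u t x z := by
      apply ii_mono S0.le (by fun_prop) cn
      intro z _
      unfold n1
      nlinarith [sq_nonneg (u t x z), mul_nonneg (by positivity : 0 ≤ 1 + z^2) (sq_nonneg (dz u t x z))]
    rw [smul_eq_mul]
    have : (S - 0) * (7 * (S^3 * J)) = 7 * S^4 * J := by ring
    rw [this]
    have := mul_le_mul_of_nonneg_left jn (by positivity : 0 ≤ 7 * S^4)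
    linarith
  refine (ofReal_le_ofReal main).trans ?_
  rw [ofReal_mul (by positivity)]
  apply mul_le_mul_right
  refine (ofReal_ii_le S0.le _).trans ((lintegral_mono_set Ioc_subset_Ioi_self).trans (le_of_eq ?_))
  rw [QQ0, QQ0, QQ2, ← lintegral_add_left (by fun_prop), ← lintegral_add_left (by fun_prop)]
  congr 1; ext z
  unfold n1
  rw [ofReal_add (by positivity) (by positivity), ofReal_add (by positivity) (by positivity)]

set_option maxHeartbeats 1000000 in
theorem stage1S {u w f : ℝ → ℝ → ℝ → ℝ} (P : Sol u w f) {c S : ℝ} (hc : 0 < c) (hc1 : c ≤ 1) (hS : 1 ≤ S) {a : ℝ} (ha : 0 < a) {s T : ℝ} (hs : 0 ≤ s) (hsT : s ≤ T)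
    (bu : ∀ t ∈ Ioc s T, ∀ x, QQ r0 (u t) x ≤ ofReal (a^2)) (buz : ∀ t ∈ Ioc s T, ∀ x, QQ r2 (dz u t) x ≤ ofReal (a^2))
    (f1 : ∫⁻ t in Ioc s T, NN r0 (u t) ≠ ⊤) (f2 : ∫⁻ t in Ioc s T, NN r0 (dx u t) ≠ ⊤) (f3 : ∫⁻ t in Ioc s T, NN r2 (dz u t) ≠ ⊤) :
    (∫⁻ t in Ioc s T, ∫⁻ x, ∫⁻ z in Ioi (0:ℝ), KK S z * ofReal (AA c z * (dx u t x z ^ 2 + dz (dz u) t x z ^ 2)))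
    ≤ ofReal 14 * (ofReal (1/2) * E0 u s + ofReal (1/2) * E0 u T) + ∫⁻ t in Ioc s T, ∫⁻ x, g1 a c S u t x := by
  have S0 : 0 < S := by linarith
  have c1 := P.su.c3
  have c2 := P.su.dz.c3
  have c3 := P.su.dz.dz.c3
  have c4 := P.su.dx.c3
  have c5 := P.su.dz.dx.c3
  have c6 := P.su.dt.c3
  have c7 := P.su.dz.dt.c3
  have c8 := P.sf.c3
  have c9 := P.sf.dz.c3
  have c10 := P.sf.dx.c3
  have c11 := P.sf.dz.dx.c3
  have c12 := P.su.dx.dx.c3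
  have c13 : Continuous fun p : ℝ × ℝ × ℝ => pp f p.1 p.2.1 p.2.2 := by unfold pp; fun_prop
  have cA : Continuous (unc fun t x z => AA c z * (dx u t x z ^ 2 + dz (dz u) t x z ^ 2)) := by unfold unc; fun_prop
  have ek : ∀ t x, (∫⁻ z in Ioi (0:ℝ), KK S z * ofReal (AA c z * (dx u t x z ^ 2 + dz (dz u) t x z ^ 2))) = _ := fun t x =>
    (th_KK hS (unc1 cA t x) (fun z => mul_nonneg (by linarith [(AA_b c z).1]) (by positivity))).symm
  simp_rw [ek]
  set k := 1/S^2 with hk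
  have kk1 : k ≤ 1 := by rw [hk, div_le_one (by positivity)]; nlinarith
  have kk0 : 0 < k := by positivity
  have ed : ∀ t x, (∫ z in (0:ℝ)..S, th k z * (AA c z * (dx u t x z ^ 2 + dz (dz u) t x z ^ 2))) = ∫ z in (0:ℝ)..S, fi c k z * (dx u t x z ^ 2 + dz (dz u) t x z ^ 2) := by
    intro t x; congr 1; ext z; unfold fi; ring
  simp_rw [ed]
  have ce : Continuous (unc fun t x z => 1/2 * (fi c k z * dz u t x z ^ 2 + bb c k z * u t x z ^ 2)) := by unfold unc; fun_prop
  have cet : Continuous (unc fun t x z => fi c k z * (dz u t x z * pdt (dz u) t x z) + bb c k z * (u t x z * pdt u t x z)) := by unfold unc; fun_prop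
  have cd : Continuous (unc fun t x z => fi c k z * (dx u t x z ^ 2 + dz (dz u) t x z ^ 2)) := by unfold unc; fun_prop
  have cΦ : Continuous (unc fun t x z => fi c k z * (u t x z * dx u t x z) + bb c k z * (u t x z * pp f t x z) - 1/2 * (fi c k z * (u t x z * dz u t x z ^ 2)) - 1/2 * (bb c k z * u t x z ^ 3)) := by unfold unc; fun_prop
  have cΦx : Continuous (unc fun t x z => fi c k z * (dx u t x z ^ 2 + u t x z * dx (dx u) t x z)
          + bb c k z * (dx u t x z * pp f t x z + u t x z * (dx f t x z - z * dx (dz f) t x z))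
          - 1/2 * (fi c k z * (dx u t x z * dz u t x z ^ 2 + u t x z * (2 * dz u t x z * dx (dz u) t x z)))
          - 1/2 * (bb c k z * (3 * u t x z ^ 2 * dx u t x z))) := by unfold unc; fun_prop
  have cE : Continuous (unc fun t x z => 14 * eD u t x z) := by have := eDc P.su; unfold unc at *; fun_prop
  have sl : ∀ {g : ℝ → ℝ → ℝ → ℝ}, Continuous (unc g) → ∀ t, Continuous (Function.uncurry (g t)) := fun h t =>
    h.comp (by fun_prop : Continuous fun q : ℝ × ℝ => (t, q.1, q.2))
  have st : ∀ {g : ℝ → ℝ → ℝ → ℝ}, Continuous (unc g) → ∀ x, Continuous (Function.uncurry fun t z => g t x z) := fun h x =>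
    h.comp (by fun_prop : Continuous fun q : ℝ × ℝ => (q.1, x, q.2))
  have E0' : ∀ t x, 0 ≤ ∫ z in (0:ℝ)..S, 14 * eD u t x z := fun t x =>
    intervalIntegral.integral_nonneg S0.le fun z hz => mul_nonneg (by norm_num) (eD0 u t x z)
  have eb : ∀ t x, |∫ z in (0:ℝ)..S, 1/2 * (fi c k z * dz u t x z ^ 2 + bb c k z * u t x z ^ 2)| ≤ ∫ z in (0:ℝ)..S, 14 * eD u t x z := by
    intro t x
    refine (intervalIntegral.abs_integral_le_integral_abs S0.le).trans (ii_mono S0.le (unc1 ce t x).abs (unc1 cE t x) ?_)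
    intro z hz
    obtain ⟨_, b2, _⟩ := th_pos S0 hz
    obtain ⟨w1, w2, w3, _⟩ := wtb hc.le hc1 kk0.le kk1 hz.1 b2
    have := abs_le.1 w3
    have a1 := mul_le_mul_of_nonneg_right w2 (sq_nonneg (dz u t x z))
    have a2 := mul_nonneg w1 (sq_nonneg (dz u t x z))
    have a3 := mul_le_mul_of_nonneg_right this.1 (sq_nonneg (u t x z))
    have a4 := mul_le_mul_of_nonneg_right this.2 (sq_nonneg (u t x z))
    have a5 : 0 ≤ (1+z^2) * dz u t x z ^ 2 := by positivity
    unfold eD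
    rw [abs_le]; constructor <;> linarith
  have BE : ∫⁻ x, ofReal ((∫ z in (0:ℝ)..S, 14 * eD u s x z) + ∫ z in (0:ℝ)..S, 14 * eD u T x z) ≤
      ofReal 14 * (ofReal (1/2) * E0 u s + ofReal (1/2) * E0 u T) := by
    have cc : ∀ t, Continuous fun x => ∫ z in (0:ℝ)..S, 14 * eD u t x z := cix (cii cE 0 S)
    simp_rw [ofReal_add (E0' _ _) (E0' _ _)]
    have mm : Measurable fun x => ofReal (∫ z in (0:ℝ)..S, 14 * eD u s x z) := ENNReal.measurable_ofReal.comp (cc s).measurable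
    rw [lintegral_add_left mm, mul_add, ← eD_E0 P.su, ← eD_E0 P.su]
    have one : ∀ t, ∫⁻ x, ofReal (∫ z in (0:ℝ)..S, 14 * eD u t x z) ≤ ofReal 14 * ∫⁻ x, ∫⁻ z in Ioi (0:ℝ), ofReal (eD u t x z) := by
      intro t
      rw [← lintegral_const_mul' _ _ ofReal_ne_top]
      refine lintegral_mono fun x => ?_
      rw [← lint_mulc (by norm_num)]
      exact (ofReal_ii_le S0.le _).trans (lintegral_mono_set Ioc_subset_Ioi_self)
    exact add_le_add (one s) (one T)
  have LB := lemmaB hsT (cii ce 0 S) (cii cet 0 S) (cii cd 0 S) (cii cΦ 0 S) (cii cΦx 0 S) (a := fun x => 0)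
    (b := fun x => (∫ z in (0:ℝ)..S, 14 * eD u s x z) + ∫ z in (0:ℝ)..S, 14 * eD u T x z) (g := g1 a c S u)
    continuous_const ((cix (cii cE 0 S) s).add (cix (cii cE 0 S) T))
    (fun x => le_rfl) (fun x => add_nonneg (E0' s x) (E0' T x)) (fun t x => intervalIntegral.integral_nonneg S0.le fun z hz => by
      obtain ⟨_, b2, _⟩ := th_pos S0 hz
      exact mul_nonneg (wtb hc.le hc1 kk0.le kk1 hz.1 b2).1 (by positivity))
    (fun x => by have h1 := abs_le.1 (eb s x); have h2 := abs_le.1 (eb T x); simp only [zero_add]; linarith [h1.2, h2.1]) ?_ ?_ ?_ ?_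
  · simp only [ENNReal.ofReal_zero, lintegral_zero, zero_add] at LB
    exact LB.trans (add_le_add_left BE _)
  · intro x t
    refine hasDeriv_ii (st ce x) (st cet x) 0 S ?_ t
    intro t z
    have := ((((P.su.dz.Ht t x z).pow 2).const_mul (fi c k z)).add (((P.su.Ht t x z).pow 2).const_mul (bb c k z))).const_mul (1/2)
    refine HasDerivAt.congr_deriv this ?_
    simp; ring
  · intro t x
    refine hasDeriv_ii (sl cΦ t) (sl cΦx t) 0 S ?_ x
    intro x z
    have U := P.su.Hx t x z
    have Uz := P.su.dz.Hx t x z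
    have pd : HasDerivAt (fun y => pp f t y z) (dx f t x z - z * dx (dz f) t x z) x := (P.sf.Hx t x z).sub ((P.sf.dz.Hx t x z).const_mul z)
    have := ((U.mul (P.su.dx.Hx t x z)).const_mul (fi c k z)).add ((U.mul pd).const_mul (bb c k z)) |>.sub (((U.mul (Uz.pow 2)).const_mul (fi c k z)).const_mul (1/2))
      |>.sub (((U.pow 3).const_mul (bb c k z)).const_mul (1/2))
    refine HasDerivAt.congr_deriv this ?_
    simp [-mul_eq_mul_left_iff]; ring
  · intro t ht x
    exact slice1 P hc hc1 hS ha (hs.trans ht.1.le) x (bu t ht x) (buz t ht x)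
  · have key := fun t (ht : t ∈ Ioc s T) x => Phi_fin P hc hc1 hS ha (hs.trans ht.1.le) x (buz t ht x)
    refine ne_top_of_le_ne_top ?_ (setLIntegral_mono_ae' measurableSet_Ioc (Eventually.of_forall fun t ht => lintegral_mono (key t ht)))
    have e : ∀ t, ∫⁻ x, (QQ r0 (u t) x + QQ r0 (dx u t) x + QQ r2 (dz u t) x) = NN r0 (u t) + NN r0 (dx u t) + NN r2 (dz u t) := by
      intro t
      have m1 := (P.su.C2 t).mQ r0c
      have m2 := (P.su.dx.C2 t).mQ r0c
      rw [lintegral_add_left (f := fun x => QQ r0 (u t) x + QQ r0 (dx u t) x) (m1.add m2), lintegral_add_left m1]; rfl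
    simp_rw [lintegral_const_mul' _ _ ofReal_ne_top, e]
    have m1 := P.su.mN r0c
    have m2 := P.su.dx.mN r0c
    rw [lintegral_add_left (f := fun t => NN r0 (u t) + NN r0 (dx u t)) (m1.add m2), lintegral_add_left m1]
    finiteness

theorem mZ_meas (S : ℝ) : Measurable (mZ S) := by
  unfold mZ
  exact Measurable.ite measurableSet_Iic (by fun_prop) measurable_const
theorem mZ_le {S : ℝ} (hS : 0 < S) (z : ℝ) : mZ S z ≤ 1 := by
  unfold mZ
  split_ifs with h
  · exact ENNReal.ofReal_le_one.2 ((div_le_one hS).2 h)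
  · exact zero_le
theorem mZ_tend (z : ℝ) : Tendsto (fun n : ℕ => mZ (n+1) z) atTop (nhds 0) := by
  have h1 : Tendsto (fun n : ℕ => z / ((n:ℝ)+1)) atTop (nhds 0) :=
    tendsto_const_nhds.div_atTop (tendsto_atTop_add_const_right _ _ tendsto_natCast_atTop_atTop)
  have h2 := (ENNReal.continuous_ofReal.tendsto 0).comp h1
  rw [ENNReal.ofReal_zero] at h2
  refine tendsto_of_tendsto_of_tendsto_of_le_of_le tendsto_const_nhds h2 (fun _ => zero_le) fun n => ?_
  simp only [mZ, Function.comp]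
  split_ifs
  · exact le_rfl
  · exact zero_le

theorem g1_split {u : ℝ → ℝ → ℝ → ℝ} (su : Sm u) (a c s T : ℝ) (n : ℕ) :
    ∫⁻ t in Ioc s T, ∫⁻ x, g1 a c (n+1) u t x = (ofReal 200 * ((∫⁻ t in Ioc s T, NN r0 (u t)) + ∫⁻ t in Ioc s T, NN r2 (dz u t))
      + ofReal (400 * a^2) * (∫⁻ t in Ioc s T, NN r0 (dx u t)))
      + ofReal (3 * (1 + 1/c^2)) * ∫⁻ t in Ioc s T, ∫⁻ x, ∫⁻ z in Ioi (0:ℝ), mZ (n+1) z * ofReal (dx u t x z ^ 2) := by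
  have mS3 : Measurable (Function.uncurry fun t x => ∫⁻ z in Ioi (0:ℝ), mZ (n+1) z * ofReal (dx u t x z ^ 2)) :=
    meas3 (((mZ_meas _).comp (by fun_prop : Measurable fun q : ℝ × ℝ × ℝ => q.2.2)).mul (ofReal_meas3 (h := fun t x z => dx u t x z ^ 2) (su.dx.c3.pow 2)))
  have e : ∀ t, ∫⁻ x, g1 a c (n+1) u t x = (ofReal 200 * (NN r0 (u t) + NN r2 (dz u t)) + ofReal (400 * a^2) * NN r0 (dx u t))
      + ofReal (3 * (1 + 1/c^2)) * ∫⁻ x, ∫⁻ z in Ioi (0:ℝ), mZ (n+1) z * ofReal (dx u t x z ^ 2) := by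
    intro t
    have m1 := (su.C2 t).mQ r0c
    have m2 := (su.dz.C2 t).mQ r2c
    have m5 := (su.dx.C2 t).mQ r0c
    have m3 : Measurable fun x => ofReal 200 * (QQ r0 (u t) x + QQ r2 (dz u t) x) := (m1.add m2).const_mul _
    have m4 : Measurable fun x => ofReal 200 * (QQ r0 (u t) x + QQ r2 (dz u t) x) + ofReal (400 * a^2) * QQ r0 (dx u t) x := m3.add (m5.const_mul _)
    unfold g1
    rw [lintegral_add_left m4, lintegral_add_left m3, lintegral_const_mul' _ _ ofReal_ne_top, lintegral_const_mul' _ _ ofReal_ne_top,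
      lintegral_const_mul' _ _ ofReal_ne_top, lintegral_add_left m1]
    rfl
  simp_rw [e]
  have m1 := su.mN r0c
  have m2 := su.dz.mN r2c
  have m5 := su.dx.mN r0c
  have m3 : Measurable fun t => ofReal 200 * (NN r0 (u t) + NN r2 (dz u t)) := (m1.add m2).const_mul _
  have m4 : Measurable fun t => ofReal 200 * (NN r0 (u t) + NN r2 (dz u t)) + ofReal (400 * a^2) * NN r0 (dx u t) := m3.add (m5.const_mul _)
  rw [lintegral_add_left m4, lintegral_add_left m3, lintegral_const_mul' _ _ ofReal_ne_top, lintegral_const_mul' _ _ ofReal_ne_top,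
      lintegral_const_mul' _ _ ofReal_ne_top, lintegral_add_left m1]

theorem stage1 {u w f : ℝ → ℝ → ℝ → ℝ} (P : Sol u w f) {a : ℝ} (ha : 0 < a) {s T : ℝ} (hs : 0 ≤ s) (hsT : s ≤ T)
    (bu : ∀ t ∈ Ioc s T, ∀ x, QQ r0 (u t) x ≤ ofReal (a^2)) (buz : ∀ t ∈ Ioc s T, ∀ x, QQ r2 (dz u t) x ≤ ofReal (a^2))
    (f1 : ∫⁻ t in Ioc s T, NN r0 (u t) ≠ ⊤) (f2 : ∫⁻ t in Ioc s T, NN r0 (dx u t) ≠ ⊤) (f3 : ∫⁻ t in Ioc s T, NN r2 (dz u t) ≠ ⊤)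
    (e1 : E0 u s ≠ ⊤) (e2 : E0 u T ≠ ⊤) : ∫⁻ t in Ioc s T, D0 u t ≠ ⊤ := by
  have c3 := P.su.dz.dz.c3
  have c4 := P.su.dx.c3
  set X := ofReal 14 * (ofReal (1/2) * E0 u s + ofReal (1/2) * E0 u T) + (ofReal 200 * ((∫⁻ t in Ioc s T, NN r0 (u t)) + ∫⁻ t in Ioc s T, NN r2 (dz u t))
      + ofReal (400 * a^2) * (∫⁻ t in Ioc s T, NN r0 (dx u t))) with hX
  have X1 : X ≠ ⊤ := by rw [hX]; finiteness
  have cA : ∀ c, Continuous (unc fun t x z => AA c z * (dx u t x z ^ 2 + dz (dz u) t x z ^ 2)) := fun c => by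
    unfold unc; fun_prop
  have hfin : ∫⁻ t in Ioc s T, ∫⁻ x, ∫⁻ z in Ioi (0:ℝ), ofReal (dx u t x z ^ 2) ≠ ⊤ := by
    simpa only [NN, QQ0] using f2
  have L := lemmaD (G := fun t x z => ofReal (dx u t x z ^ 2)) (ofReal_meas3 (h := fun t x z => dx u t x z ^ 2) (by unfold unc; fun_prop)) hfin
    (m := fun n => mZ (n+1)) (fun n => mZ_meas _) (C := 1) (by norm_num) (fun n z => mZ_le (by positivity) z) mZ_tend
  have step : ∀ c, 0 < c → c ≤ 1 → ∫⁻ t in Ioc s T, ∫⁻ x, ∫⁻ z in Ioi (0:ℝ), ofReal (AA c z * (dx u t x z ^ 2 + dz (dz u) t x z ^ 2)) ≤ X := by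
    intro c hc hc1
    have R := KK_lim3 (cA c) s T
    have L2 := (ENNReal.Tendsto.const_mul (a := ofReal (3 * (1 + 1/c^2))) L (Or.inr ofReal_ne_top)).const_add X
    rw [mul_zero, add_zero] at L2
    refine le_of_tendsto_of_tendsto' R L2 fun n => ?_
    refine (stage1S P hc hc1 (by have : (0:ℝ) ≤ n := n.cast_nonneg
                                 linarith) ha hs hsT bu buz f1 f2 f3).trans (le_of_eq ?_)
    rw [g1_split P.su, hX, ← add_assoc]
  refine ne_top_of_le_ne_top X1 ?_
  have F := fatou3 (h := fun n t x z => AA (1/((n:ℝ)+1)) z * (dx u t x z ^ 2 + dz (dz u) t x z ^ 2)) (g := dD u) (fun n => cA _) (fun t x z => by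
    have h1 : Tendsto (fun n : ℕ => (1:ℝ)/((n:ℝ)+1)) atTop (nhds 0) := tendsto_one_div_add_atTop_nhds_zero_nat
    have h2 : Continuous fun c => AA c z * (dx u t x z ^ 2 + dz (dz u) t x z ^ 2) := by
      unfold AA jc
      refine Continuous.mul (continuous_const.add (continuous_const.mul (Continuous.inv₀ (by fun_prop) fun c => by positivity))) continuous_const
    have h3 := (h2.tendsto 0).comp h1
    refine h3.congr' (Eventually.of_forall fun n => rfl) |>.trans (le_of_eq ?_)
    congr 1; unfold AA jc dD; norm_num; left; ring) s T
  simp_rw [dD_D0 P.su] at F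
  refine F.trans (liminf_le_of_frequently_le' (Frequently.of_forall fun n => step _ (by positivity) ?_))
  rw [div_le_one (by positivity)]
  have : (0:ℝ) ≤ n := n.cast_nonneg
  linarith

theorem H1a {g} (h : Sm g) (t : ℝ) : H1xL2sq (g t) = NN r0 (g t) + NN r0 (dx g t) := by
  unfold H1xL2sq NN
  rw [← lintegral_add_left ((h.C2 t).mQ r0c)]
  refine lintegral_congr fun x => ?_
  have := h.c1 t x
  rw [QQ0, QQ0, ← lintegral_add_left (by fun_prop)]
  refine lintegral_congr fun z => ?_
  rw [← ofReal_add (by positivity) (by positivity)]; rfl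
theorem H1b {g} (h : Sm g) (t : ℝ) : H1xL2sq (fun x z => jz z * g t x z) = NN r2 (g t) + NN r2 (dx g t) := by
  unfold H1xL2sq NN
  rw [← lintegral_add_left ((h.C2 t).mQ r2c)]
  refine lintegral_congr fun x => ?_
  have := h.c1 t x
  rw [QQ2, QQ2, ← lintegral_add_left (by fun_prop)]
  refine lintegral_congr fun z => ?_
  rw [← ofReal_add (by positivity) (by positivity)]
  have e : pdx (fun x z => jz z * g t x z) x z = jz z * dx g t x z := ((h.Hx t x z).const_mul (jz z)).deriv
  rw [e, mul_pow, mul_pow, jz_sq]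
def EE (u : ℝ → ℝ → ℝ → ℝ) (t : ℝ) : ENNReal := E0 u t + E0 (dx u) t
theorem EE_eq {u} (h : Sm u) (t : ℝ) : H1sq (u t) = EE u t := by
  have e2 := H1b h.dz t
  unfold H1sq EE E0
  rw [H1a h]
  have : (H1xL2sq fun x z => jz z * pdz (u t) x z) = H1xL2sq (fun x z => jz z * dz u t x z) := rfl
  rw [this, e2, h.xz]; ring
theorem DD_eq {u} (h : Sm u) (t : ℝ) : Dfun u t = D0 u t + D0 (dx u) t := by
  have e1 := H1b h.dz.dz t
  have e2 := H1b h.dx t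
  have : Dfun u t = H1xL2sq (fun x z => jz z * dz (dz u) t x z) + H1xL2sq (fun x z => jz z * dx u t x z) := rfl
  unfold D0
  rw [this, e1, e2, h.dz.xz, h.xz]; ring
theorem EE_of_norm {h : ℝ → ℝ → ℝ} {m : ℝ} (hm : 0 ≤ m) (H : H1norm h ≤ ofReal m) : H1sq h ≤ ofReal (m^2) := by
  unfold H1norm at H
  have := ENNReal.rpow_le_rpow H (by norm_num : (0:ℝ) ≤ 2)
  rw [← ENNReal.rpow_mul, ENNReal.ofReal_rpow_of_nonneg hm (by norm_num)] at this
  norm_num at this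
  simpa using this

theorem ag1 {ρ : ℝ → ℝ} (cρ : Continuous ρ) (ρ0 : ∀ z, 0 ≤ ρ z) {g} (h : Sm g) {t m : ℝ} (h1 : NN ρ (g t) + NN ρ (dx g t) ≤ ofReal (m^2)) (x : ℝ) :
    QQ ρ (g t) x ≤ ofReal (2*m^2) := by
  refine (agmon cρ ρ0 (h.C2 t) (h.dx.C2 t) (fun x z => h.Hx t x z) one_pos x).trans ?_
  calc _ ≤ ofReal 2 * NN ρ (g t) + ofReal 2 * NN ρ (dx g t) := by
        refine add_le_add ?_ (mul_le_mul_left (ofReal_le_ofReal (by norm_num)) _)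
        norm_num
    _ = ofReal 2 * (NN ρ (g t) + NN ρ (dx g t)) := by ring
    _ ≤ _ := by
        rw [ofReal_mul (by norm_num)]
        exact mul_le_mul_right h1 _

structure BS (u w f : ℝ → ℝ → ℝ → ℝ) (M : ℝ) : Prop where
  H : IsPS2D u w f
  M1 : 1 ≤ M
  b : ∀ t ≥ 0, EE u t ≤ ofReal (M^2)

variable {u w f : ℝ → ℝ → ℝ → ℝ} {M : ℝ}

theorem EE_r0 {u} {t : ℝ} : NN r0 (u t) + NN r0 (dx u t) ≤ EE u t := add_le_add le_self_add le_self_add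
theorem EE_r2 {u} (h : Sm u) {t : ℝ} : NN r2 (dz u t) + NN r2 (dx (dz u) t) ≤ EE u t := by
  rw [h.xz]; exact add_le_add le_add_self le_add_self

theorem BS.fint (B : BS u w f M) {g : ℝ → ENNReal} (hg : ∀ t ≥ 0, g t ≤ EE u t) {s : ℝ} (hs : 0 ≤ s) (T : ℝ) : ∫⁻ t in Ioc s T, g t ≠ ⊤ := by
  refine ne_top_of_le_ne_top (b := ∫⁻ t in Ioc s T, ofReal (M^2)) ?_ (setLIntegral_mono_ae' measurableSet_Ioc (Eventually.of_forall fun t ht => (hg t (hs.trans ht.1.le)).trans (B.b t (hs.trans ht.1.le))))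
  rw [setLIntegral_const]
  exact ENNReal.mul_ne_top ofReal_ne_top (by simp)
theorem BS.f0 (B : BS u w f M) {s : ℝ} (hs : 0 ≤ s) (T : ℝ) : ∫⁻ t in Ioc s T, NN r0 (u t) ≠ ⊤ :=
  B.fint (fun _ _ => le_self_add.trans EE_r0) hs T
theorem BS.bu (B : BS u w f M) {t : ℝ} (ht : 0 ≤ t) (x : ℝ) : QQ r0 (u t) x ≤ ofReal ((2*M)^2) :=
  (ag1 r0c r0p B.H.sol.su (EE_r0.trans (B.b t ht)) x).trans (ofReal_le_ofReal (by nlinarith [B.M1]))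
theorem BS.buz (B : BS u w f M) {t : ℝ} (ht : 0 ≤ t) (x : ℝ) : QQ r2 (dz u t) x ≤ ofReal ((2*M)^2) :=
  (ag1 r2c r2p B.H.sol.su.dz ((EE_r2 B.H.sol.su).trans (B.b t ht)) x).trans (ofReal_le_ofReal (by nlinarith [B.M1]))
theorem BS.fE (B : BS u w f M) {t : ℝ} (ht : 0 ≤ t) : E0 u t ≠ ⊤ :=
  ne_top_of_le_ne_top ofReal_ne_top (le_self_add.trans (B.b t ht))
theorem BS.fD (B : BS u w f M) {s T : ℝ} (hs : 0 ≤ s) (hsT : s ≤ T) : ∫⁻ t in Ioc s T, D0 u t ≠ ⊤ :=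
  stage1 B.H.sol (a := 2*M) (by linarith [B.M1]) hs hsT (fun t ht x => B.bu (hs.trans ht.1.le) x) (fun t ht x => B.buz (hs.trans ht.1.le) x)
    (B.f0 hs T) (B.fint (fun _ _ => le_add_self.trans EE_r0) hs T) (B.fint (fun _ _ => le_self_add.trans (EE_r2 B.H.sol.su)) hs T) (B.fE hs) (B.fE (hs.trans hsT))
theorem BS.e0 (B : BS u w f M) {s T : ℝ} (hs : 0 ≤ s) (hsT : s ≤ T) : E0 u T ≤ E0 u s + ofReal (2400*M) * ∫⁻ t in Ioc s T, D0 u t := by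
  have h := star0 B.H (a := 2*M) (by linarith [B.M1]) hs hsT (fun t ht x => B.bu (hs.trans ht.1.le) x) (fun t ht x => B.buz (hs.trans ht.1.le) x) (B.fD hs hsT) (B.f0 hs T)
  have h2 := mul_le_mul_right (le_self_add.trans h) (ofReal 2)
  rw [mul_add, ← mul_assoc, ← mul_assoc, ← mul_assoc, ← ofReal_mul (by norm_num), ← ofReal_mul (by norm_num)] at h2
  rw [show (2:ℝ)*(1/2) = 1 by norm_num, ENNReal.ofReal_one, one_mul, one_mul, show 2*(600*(2*M)) = 2400*M by ring] at h2
  exact h2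
theorem BS.dsm (B : BS u w f M) {s : ℝ} (hs : 0 ≤ s) {η : ℝ} (hη : 0 < η) : ∃ τ, 0 < τ ∧ ∀ t ∈ Icc s (s+τ), ∫⁻ r in Ioc s t, D0 u r ≤ ofReal η := by
  obtain ⟨δ, hδ, h⟩ := exists_pos_setLIntegral_lt_of_measure_lt (B.fD hs (by linarith : s ≤ s+1)) (ε := ofReal η) (by simpa using hη)
  obtain ⟨τ, hτ, hτδ⟩ := ENNReal.lt_iff_exists_nnreal_btwn.1 hδ
  have hτ0 : (0:ℝ) < τ := by exact_mod_cast hτ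
  refine ⟨min τ 1, by positivity, fun t ht => ?_⟩
  have sub : Ioc s t ⊆ Ioc s (s+1) := Ioc_subset_Ioc_right (ht.2.trans (by gcongr; exact min_le_right _ _))
  have := h (Ioc s t) (by
    refine (Measure.restrict_apply_le _ _).trans_lt (lt_of_le_of_lt ?_ hτδ)
    rw [Real.volume_Ioc]
    refine ENNReal.ofReal_le_of_le_toReal ?_
    have := ht.2
    have := min_le_left (τ:ℝ) 1
    simp; linarith)
  rw [Measure.restrict_restrict measurableSet_Ioc, inter_eq_left.2 sub] at this
  exact this.le

theorem c2t {g : ℝ → ℝ → ℝ → ℝ} (h : Continuous (unc g)) (t : ℝ) : C2 (g t) := h.comp (by fun_prop : Continuous fun q : ℝ × ℝ => (t, q.1, q.2))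

theorem BS.diff (B : BS u w f M) {s : ℝ} (hs : 0 ≤ s) {η : ℝ} (hη : 0 < η) : ∃ τ, 0 < τ ∧ ∀ t ∈ Ioc s (s+τ),
    ∫⁻ x, ∫⁻ z in Ioi (0:ℝ), ofReal ((u t x z - u s x z)^2 + (1+z^2) * (dz u t x z - dz u s x z)^2) ≤ ofReal η := by
  have su := B.H.sol.su
  by_contra! hcon
  have hpos : ∀ n : ℕ, (0:ℝ) < 1/((n:ℝ)+1) := fun n => by positivity
  choose t ht hbad using fun n : ℕ => hcon (1/((n:ℝ)+1)) (hpos n)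
  have tl : Tendsto t atTop (nhds s) := by
    have h1 : Tendsto (fun n : ℕ => s + (1:ℝ)/((n:ℝ)+1)) atTop (nhds (s+0)) := tendsto_one_div_add_atTop_nhds_zero_nat.const_add s
    rw [add_zero] at h1
    exact tendsto_of_tendsto_of_tendsto_of_le_of_le tendsto_const_nhds h1 (fun n => (ht n).1.le) (fun n => (ht n).2)
  have cu := fun r => su.C2 r
  have cz := fun r => su.dz.C2 r
  set d : ℕ → ℝ → ℝ → ℝ := fun n x z => (u (t n) x z - u s x z)^2 + (1+z^2) * (dz u (t n) x z - dz u s x z)^2 with hd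
  set e : ℕ → ℝ → ℝ → ℝ := fun n x z => (u (t n) x z + u s x z)^2 + (1+z^2) * (dz u (t n) x z + dz u s x z)^2 with he
  have cd : ∀ n, C2 (d n) := fun n => by
    have := cu (t n); have := cu s; have := cz (t n); have := cz s
    simp only [C2, Function.uncurry_def] at *
    fun_prop
  have ce : ∀ n, C2 (e n) := fun n => by
    have := cu (t n); have := cu s; have := cz (t n); have := cz s
    simp only [C2, Function.uncurry_def] at *
    fun_prop
  have F := fatou2 (h := e) (g := fun x z => 8 * eD u s x z) ce (fun x z => by
    have h1 : Continuous fun r => (u r x z + u s x z)^2 + (1+z^2) * (dz u r x z + dz u s x z)^2 := by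
      have := su.ct x z; have := su.dz.ct x z; fun_prop
    have := (h1.tendsto s).comp tl
    refine this.trans (le_of_eq ?_)
    congr 1; unfold eD; ring)
  have i8 : ∀ (k : ℝ) (_ : 0 ≤ k) r, ∫⁻ x, ∫⁻ z in Ioi (0:ℝ), ofReal (k * eD u r x z) = ofReal (k/2) * E0 u r := by
    intro k hk r
    simp_rw [ofReal_mul hk, lintegral_const_mul' _ _ ofReal_ne_top]
    rw [eD_E0 su, ← mul_assoc, ← ofReal_mul hk]; congr 2; ring
  rw [i8 8 (by norm_num)] at F
  have par : ∀ n, (∫⁻ x, ∫⁻ z in Ioi (0:ℝ), ofReal (d n x z)) + (∫⁻ x, ∫⁻ z in Ioi (0:ℝ), ofReal (e n x z))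
      = ofReal (4/2) * E0 u (t n) + ofReal (4/2) * E0 u s := by
    intro n
    have c4 : ∀ r, C2 (fun x z => 4 * eD u r x z) := fun r => (c2t (eDc su) r).const_mul 4
    rw [← i8 4 (by norm_num), ← i8 4 (by norm_num), ← lintegral_add_left (meas_lint (ofReal_meas2 (cd n)) _), ← lintegral_add_left (meas_lint (ofReal_meas2 (c4 _)) _)]
    refine lintegral_congr fun x => ?_
    have m1 : Measurable fun z => ofReal (d n x z) := ENNReal.measurable_ofReal.comp ((cd n).sl x).measurable
    have m2 : Measurable fun z => ofReal (4 * eD u (t n) x z) := ENNReal.measurable_ofReal.comp ((c4 _).sl x).measurable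
    rw [← lintegral_add_left m1, ← lintegral_add_left m2]
    refine lintegral_congr fun z => ?_
    rw [← ofReal_add (by simp only [hd]; positivity) (by simp only [he]; positivity), ← ofReal_add (by unfold eD; positivity) (by unfold eD; positivity)]
    congr 1; simp only [hd, he, eD]; ring
  set X := E0 u s with hX
  have X1 : X ≠ ⊤ := B.fE hs
  have M1 := B.M1
  obtain ⟨τ, hτ, hτ2⟩ := B.dsm hs (η := η/4/(4800*M)) (by positivity)
  have ev : ∀ᶠ n in atTop, t n < s + τ := tl.eventually_lt_const (by linarith)
  have key : ofReal (8/2) * X + ofReal η ≤ ofReal (8/2) * X + ofReal (η/4) := by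
    have L0 : ∀ᶠ n in atTop, (∫⁻ x, ∫⁻ z in Ioi (0:ℝ), ofReal (e n x z)) + ofReal η ≤ ofReal (8/2) * X + ofReal (η/4) := by
      refine ev.mono fun n hn => ?_
      refine (add_le_add_right (hbad n).le _).trans ?_
      rw [add_comm, par n]
      have h1 := B.e0 hs (ht n).1.le
      have h2 := hτ2 (t n) ⟨(ht n).1.le, hn.le⟩
      have h3 := h1.trans (add_le_add_right (mul_le_mul_right h2 _) _)
      rw [← ofReal_mul (by positivity)] at h3
      refine (add_le_add_left (mul_le_mul_right h3 _) _).trans (le_of_eq ?_)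
      rw [mul_add, ← ofReal_mul (by norm_num), ← hX, show (8/2:ℝ) = 4/2+4/2 by norm_num, ofReal_add (by norm_num) (by norm_num)]
      have : 4 / 2 * (2400 * M * (η / 4 / (4800 * M))) = η/4 := by field_simp; norm_num
      rw [this]; ring
    have L2 := F.trans (liminf_le_of_frequently_le' (Eventually.frequently (L0.mono fun n hn => ENNReal.le_sub_of_add_le_right ofReal_ne_top hn)))
    obtain ⟨n, hn⟩ := L0.exists
    have hle := le_add_self.trans hn
    exact (add_le_add_left L2 _).trans (tsub_add_cancel_of_le hle).le
  have := (ENNReal.add_le_add_iff_left (by finiteness)).1 key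
  rw [ENNReal.ofReal_le_ofReal_iff (by positivity)] at this
  linarith

theorem ag2 {ρ : ℝ → ℝ} (cρ : Continuous ρ) (ρ0 : ∀ z, 0 ≤ ρ z) {g} (h : Sm g) {s t ε : ℝ} (hM : 0 < M) (hε : 0 < ε)
    (h1 : NN ρ (fun x z => g t x z - g s x z) ≤ ofReal (ε^4/(8*M^2))) (h2 : NN ρ (dx g t) ≤ ofReal (M^2)) (h3 : NN ρ (dx g s) ≤ ofReal (M^2))
    {x : ℝ} (h4 : QQ ρ (g s) x ≤ ofReal (2*ε^2)) : QQ ρ (g t) x ≤ ofReal ((3*ε)^2) := by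
  have cd : C2 fun x z => g t x z - g s x z := (h.C2 t).sub (h.C2 s)
  have cd' : C2 fun x z => dx g t x z - dx g s x z := (h.dx.C2 t).sub (h.dx.C2 s)
  have a1 := agmon cρ ρ0 cd cd' (fun x z => (h.Hx t x z).sub (h.Hx s x z)) (l := 4*M^2/ε^2) (by positivity) x
  have a2 : NN ρ (fun x z => dx g t x z - dx g s x z) ≤ ofReal (4*M^2) := by
    refine (NN_sub cρ ρ0 (h.dx.C2 t)).trans ((add_le_add (mul_le_mul_right h2 _) (mul_le_mul_right h3 _)).trans (le_of_eq ?_))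
    rw [show (4*M^2) = 2*M^2+2*M^2 by ring, ofReal_add (by positivity) (by positivity), ofReal_mul (by norm_num)]; simp
  have a3 := a1.trans (add_le_add (mul_le_mul_right h1 _) (mul_le_mul_right a2 _))
  rw [← ofReal_mul (by positivity), ← ofReal_mul (by positivity), ← ofReal_add (by positivity) (by positivity)] at a3
  have e : 2 * (4 * M ^ 2 / ε ^ 2) * (ε ^ 4 / (8 * M ^ 2)) + 1 / (4 * M ^ 2 / ε ^ 2) * (4 * M ^ 2) = 2*ε^2 := by field_simp; ring
  rw [e] at a3
  have q := QQ_sub cρ ρ0 cd (fun x z => - g s x z) x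
  have e1 : QQ ρ (fun x z => g t x z - g s x z - -g s x z) x = QQ ρ (g t) x := by simp [QQ]
  have e2 : QQ ρ (fun x z => -g s x z) x = QQ ρ (g s) x := by simp [QQ]
  rw [e1, e2] at q
  refine q.trans ((add_le_add (mul_le_mul_right a3 _) (mul_le_mul_right h4 _)).trans ?_)
  rw [show (2:ENNReal) = ofReal 2 by simp, ← ofReal_mul (by positivity), ← ofReal_add (by positivity) (by positivity)]
  exact ofReal_le_ofReal (by nlinarith)

theorem BS.small (B : BS u w f M) {s ε : ℝ} (hs : 0 ≤ s) (hε : 0 < ε) (hE : EE u s ≤ ofReal (ε^2)) : ∃ τ, 0 < τ ∧ ∀ t ∈ Ioc s (s+τ), ∀ x,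
    QQ r0 (u t) x ≤ ofReal ((3*ε)^2) ∧ QQ r2 (dz u t) x ≤ ofReal ((3*ε)^2) := by
  have M1 := B.M1
  have su := B.H.sol.su
  obtain ⟨τ, h0, h⟩ := B.diff hs (η := ε^4/(8*M^2)) (by positivity)
  refine ⟨τ, h0, fun t ht x => ⟨?_, ?_⟩⟩
  · refine ag2 r0c r0p su (s := s) (by linarith) hε ?_ ((le_add_self.trans EE_r0).trans (B.b t (hs.trans ht.1.le))) ((le_add_self.trans EE_r0).trans (B.b s hs)) (ag1 r0c r0p su (EE_r0.trans hE) x)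
    refine le_trans (lintegral_mono fun x => lintegral_mono fun z => ofReal_le_ofReal ?_) (h t ht)
    simp only [r0, one_mul]
    have : 0 ≤ (1+z^2) * (dz u t x z - dz u s x z)^2 := by positivity
    linarith
  · refine ag2 r2c r2p su.dz (s := s) (by linarith) hε ?_ ((le_add_self.trans (EE_r2 su)).trans (B.b t (hs.trans ht.1.le))) ((le_add_self.trans (EE_r2 su)).trans (B.b s hs)) (ag1 r2c r2p su.dz ((EE_r2 su).trans hE) x)
    refine le_trans (lintegral_mono fun x => lintegral_mono fun z => ofReal_le_ofReal ?_) (h t ht)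
    simp only [r2]
    nlinarith [sq_nonneg (u t x z - u s x z)]

theorem half_E {X Y : ENNReal} {a : ℝ} (ha : 0 ≤ a) (h : ofReal (1/2) * X ≤ ofReal (1/2) * Y + ofReal a) : X ≤ Y + ofReal (2*a) := by
  have h2 := mul_le_mul_right h (ofReal 2)
  rw [mul_add, ← mul_assoc, ← mul_assoc, ← ofReal_mul (by norm_num), ← ofReal_mul (by norm_num)] at h2
  rwa [show (2:ℝ)*(1/2) = 1 by norm_num, ENNReal.ofReal_one, one_mul, one_mul] at h2

theorem comb {a b c d x y : ENNReal} (h1 : ofReal (1/2) * a + ofReal (3/4) * x ≤ ofReal (1/2) * b)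
    (h2 : ofReal (1/2) * c + ofReal (3/4) * y ≤ ofReal (1/2) * d + ofReal (1/4) * x) (hx : x ≠ ⊤) : a + c + (x + y) ≤ b + d := by
  have e : ofReal (3/4) = ofReal (1/2) + ofReal (1/4) := by rw [← ofReal_add (by norm_num) (by norm_num)]; norm_num
  have f : ofReal (1/4) * x ≠ ⊤ := by finiteness
  have h3 : ofReal (1/2) * (a + c + (x + y)) ≤ ofReal (1/2) * (b + d) := by
    refine (ENNReal.add_le_add_iff_right f).1 ?_
    calc _ ≤ (ofReal (1/2) * a + ofReal (3/4) * x) + (ofReal (1/2) * c + ofReal (3/4) * y) := by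
          rw [e]
          calc _ ≤ ofReal (1/2) * (a + c + (x + y)) + ofReal (1/4) * x + ofReal (1/4) * y := le_self_add
            _ = _ := by ring
      _ ≤ _ := (add_le_add h1 h2).trans (le_of_eq (by ring))
  exact (ENNReal.mul_le_mul_iff_right (by simp) ofReal_ne_top).1 h3

theorem BS.claim (B : BS u w f M) {s ε : ℝ} (hs : 0 ≤ s) (hε : 0 < ε) (he : ε ≤ 1/20000) (hE : EE u s ≤ ofReal (ε^2)) :
    ∃ τ, 0 < τ ∧ ∀ t ∈ Icc s (s+τ), EE u t + ((∫⁻ r in Ioc s t, D0 u r) + ∫⁻ r in Ioc s t, D0 (dx u) r) ≤ EE u s := by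
  have M1 := B.M1
  have su := B.H.sol.su
  obtain ⟨τ1, h1, k1⟩ := B.small hs hε hE
  obtain ⟨τ2, h2, k2⟩ := B.dsm hs (η := ε^2/2/(1024*M^4)) (by positivity)
  refine ⟨min τ1 τ2, by positivity, fun t ht => ?_⟩
  have st := ht.1
  have t1 : t ≤ s + τ1 := ht.2.trans (by gcongr; exact min_le_left _ _)
  have t2 : t ≤ s + τ2 := ht.2.trans (by gcongr; exact min_le_right _ _)
  have bm : ∀ r ∈ Ioc s t, NN r2 (dx (dz u) r) ≤ ofReal ((2*ε)^2) := by
    intro r hr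
    have S := star B.H (a := 3*ε) (by positivity) (by linarith) hs hr.1.le (fun q hq x => (k1 q ⟨hq.1, hq.2.trans (hr.2.trans t1)⟩ x).1)
      (fun q hq x => (k1 q ⟨hq.1, hq.2.trans (hr.2.trans t1)⟩ x).2) (B.fD hs hr.1.le) (B.f0 hs r) (m := M) (by linarith)
      (fun q hq => (le_add_self.trans (EE_r2 su)).trans (B.b q (hs.trans hq.1.le)))
    have S2 := le_self_add.trans (S.trans (add_le_add_right (mul_le_mul_right (k2 r ⟨hr.1.le, hr.2.trans t2⟩) _) _))
    rw [← ofReal_mul (by positivity)] at S2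
    have S3 := half_E (by positivity) S2
    rw [su.xz]
    refine (le_add_self.trans S3).trans ((add_le_add_left (le_add_self.trans hE) _).trans ?_)
    rw [← ofReal_add (by positivity) (by positivity)]
    refine ofReal_le_ofReal ?_
    have : 1024 * M^4 * (ε^2/2/(1024*M^4)) = ε^2/2 := by field_simp
    rw [this]; nlinarith
  have bu : ∀ q ∈ Ioc s t, ∀ x, QQ r0 (u q) x ≤ ofReal ((3*ε)^2) := fun q hq x => (k1 q ⟨hq.1, hq.2.trans t1⟩ x).1
  have buz : ∀ q ∈ Ioc s t, ∀ x, QQ r2 (dz u q) x ≤ ofReal ((3*ε)^2) := fun q hq x => (k1 q ⟨hq.1, hq.2.trans t1⟩ x).2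
  have fD := B.fD hs st
  have A1 := star0 B.H (a := 3*ε) (by positivity) hs st bu buz fD (B.f0 hs t)
  have A2 := star B.H (a := 3*ε) (by positivity) (by linarith) hs st bu buz fD (B.f0 hs t) (m := 2*ε) (by positivity) bm
  have A3 := absorb (c := 0) fD (k := 600*(3*ε)) (by linarith) (by rwa [add_zero])
  rw [add_zero] at A3
  refine comb A3 (A2.trans (add_le_add_right (mul_le_mul_left (ofReal_le_ofReal ?_) _) _)) fD
  have h5 : ε^4 ≤ (1/20000)^4 := pow_le_pow_left₀ hε.le he 4
  nlinarith

theorem liminf_add_le2 (a b : ℕ → ENNReal) : liminf a atTop + liminf b atTop ≤ liminf (fun n => a n + b n) atTop := by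
  have e : ∀ a : ℕ → ENNReal, Tendsto (fun n => ⨅ i ≥ n, a i) atTop (nhds (liminf a atTop)) := fun a => by
    rw [liminf_eq_iSup_iInf_of_nat]
    exact tendsto_atTop_iSup fun n m hnm => le_iInf₂ fun i hi => iInf₂_le i (hnm.trans hi)
  refine le_of_tendsto_of_tendsto' ((e a).add (e b)) (e _) fun n => le_iInf₂ fun i hi => ?_
  exact add_le_add (iInf₂_le i hi) (iInf₂_le i hi)

theorem EE_half {u} (h : Sm u) (t : ℝ) : (∫⁻ x, ∫⁻ z in Ioi (0:ℝ), ofReal (2 * eD u t x z)) + (∫⁻ x, ∫⁻ z in Ioi (0:ℝ), ofReal (2 * eD (dx u) t x z)) = EE u t := by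
  simp_rw [ofReal_mul (show (0:ℝ) ≤ 2 by norm_num), lintegral_const_mul' _ _ ofReal_ne_top]
  rw [eD_E0 h, eD_E0 h.dx, ← mul_assoc, ← mul_assoc, ← ofReal_mul (by norm_num)]
  norm_num [EE]

theorem E_lsc {u} (h : Sm u) {t : ℕ → ℝ} {s : ℝ} (ht : Tendsto t atTop (nhds s)) : ∫⁻ x, ∫⁻ z in Ioi (0:ℝ), ofReal (2 * eD u s x z) ≤
    liminf (fun n => ∫⁻ x, ∫⁻ z in Ioi (0:ℝ), ofReal (2 * eD u (t n) x z)) atTop := by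
  refine fatou2 (h := fun n x z => 2 * eD u (t n) x z) (g := fun x z => 2 * eD u s x z) (fun n => (c2t (eDc h) _).const_mul 2) fun x z => ?_
  have : Continuous fun r => eD u r x z := (eDc h).comp (by fun_prop : Continuous fun r : ℝ => ((r, x, z) : ℝ × ℝ × ℝ))
  exact ((this.tendsto s).comp ht).const_mul 2

theorem D_lsc {g : ℝ → ENNReal} (hg : Measurable g) {t : ℕ → ℝ} {s : ℝ} (ht : Tendsto t atTop (nhds s)) :
    ∫⁻ r in Ioc 0 s, g r ≤ liminf (fun n => ∫⁻ r in Ioc 0 (t n), g r) atTop := by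
  rw [setLIntegral_congr Ioo_ae_eq_Ioc.symm, ← lintegral_indicator measurableSet_Ioo]
  simp_rw [← lintegral_indicator measurableSet_Ioc]
  refine le_trans (lintegral_mono fun r => ?_) (lintegral_liminf_le fun n => hg.indicator measurableSet_Ioc)
  by_cases hr : r ∈ Ioo 0 s
  · rw [indicator_of_mem hr]
    refine le_liminf_of_le (by isBoundedDefault) ((ht.eventually_const_lt hr.2).mono fun n hn => ?_)
    rw [indicator_of_mem (show r ∈ Ioc 0 (t n) from ⟨hr.1, hn.le⟩)]
  · rw [indicator_of_notMem hr]; exact zero_le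

theorem BS.main (B : BS u w f M) {ε : ℝ} (hε : 0 < ε) (he : ε ≤ 1/20000) (hE : EE u 0 ≤ ofReal (ε^2)) {T : ℝ} (hT : 0 ≤ T) :
    EE u T + (∫⁻ r in Ioc 0 T, (D0 u r + D0 (dx u) r)) ≤ ofReal (ε^2) := by
  have su := B.H.sol.su
  have mD : Measurable fun r => D0 u r + D0 (dx u) r := su.mD0.add su.dx.mD0
  have key : Icc 0 T ⊆ {t | EE u t + (∫⁻ r in Ioc 0 t, (D0 u r + D0 (dx u) r)) ≤ ofReal (ε^2)} := by
    refine IsClosed.Icc_subset_of_forall_exists_gt ?_ ?_ ?_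
    · refine IsSeqClosed.isClosed fun t s h ht => ?_
      refine ⟨?_, isClosed_Icc.isSeqClosed (fun n => (h n).2) ht⟩
      have a := fun n => (h n).1
      simp only [mem_ofPred_eq] at a ⊢
      rw [← EE_half su]
      refine lsum (b := fun n => ∫⁻ r in Ioc 0 (t n), (D0 u r + D0 (dx u) r)) (a := fun n => EE u (t n)) ?_ (D_lsc mD ht) a
      simp_rw [← EE_half su]
      refine (add_le_add (E_lsc su ht) (E_lsc su.dx ht)).trans ?_
      exact liminf_add_le2 _ _
    · simpa using hE
    · rintro s ⟨h1, h2⟩ y hy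
      simp only [mem_ofPred_eq] at h1
      obtain ⟨τ, h0, k⟩ := B.claim h2.1 hε he (le_self_add.trans h1)
      have hy' : s < y := hy
      have st : s < min (s+τ) y := lt_min (by linarith) hy'
      refine ⟨min (s+τ) y, ?_, st, min_le_right _ _⟩
      have q := k (min (s+τ) y) ⟨st.le, min_le_left _ _⟩
      simp only [mem_ofPred_eq]
      rw [← Ioc_union_Ioc_eq_Ioc h2.1 st.le, lintegral_union measurableSet_Ioc (Ioc_disjoint_Ioc_of_le le_rfl), lintegral_add_left (μ := volume.restrict (Ioc s (min (s+τ) y))) su.mD0]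
      refine le_trans (le_of_eq ?_) ((add_le_add_left q _).trans h1)
      ring
  exact key ⟨hT, le_rfl⟩

theorem statement0 :
    ∃ ε₀ : ℝ, 0 < ε₀ ∧
      ∀ (u w f : ℝ → ℝ → ℝ → ℝ) (u₀ : ℝ → ℝ → ℝ),
        IsPS2D u w f →
        (∀ x z : ℝ, u 0 x z = u₀ x z) →
        (∃ M : ℝ, ∀ t ≥ (0 : ℝ), H1norm (u t) ≤ ENNReal.ofReal M) →
        H1norm u₀ ≤ ENNReal.ofReal ε₀ →
        ∀ t ≥ (0 : ℝ),
          H1sq (u t) + (∫⁻ s in Set.Ioc (0 : ℝ) t, Dfun u s)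
            ≤ ENNReal.ofReal (ε₀ ^ 2) := by
  refine ⟨1/20000, by norm_num, fun u w f u₀ H h0 hM hE t ht => ?_⟩
  obtain ⟨M, hM⟩ := hM
  have su := H.sol.su
  have e0 : u 0 = u₀ := by funext x z; exact h0 x z
  have B : BS u w f (max M 1) := ⟨H, le_max_right _ _, fun t ht => by
    rw [← EE_eq su]
    exact EE_of_norm (by positivity) ((hM t ht).trans (ofReal_le_ofReal (le_max_left _ _)))⟩
  have := B.main (ε := 1/20000) (by norm_num) le_rfl (by
    rw [← EE_eq su, e0]
    exact EE_of_norm (by norm_num) hE) ht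
  simp_rw [EE_eq su, DD_eq su]
  exact this
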